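/- Let A be a closed annulus in the plane and let D be a collection of disjoint arcs properly embedded in A, each joining the two boundary circles, together with exactly one transverse crossing point between two of the arcs in the interior. Then the pair (A, A ∩ D) is homeomorphic to a standard model: an annulus containing two arcs crossing once and finitely many parallel arcs, as in Fig. 3. -/

import Mathlib

/-- The standard closed round annulus `1 ≤ ‖p‖ ≤ 2` in the plane. -/
def stdAnnulus : Set (ℝ × ℝ) :=
  {p : ℝ × ℝ | 1 ≤ p.1 ^ 2 + p.2 ^ 2 ∧ p.1 ^ 2 + p.2 ^ 2 ≤ 4}

/-- The unit vector at angle `θ`. -/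
noncomputable def dirPt (θ : ℝ) : ℝ × ℝ := (Real.cos θ, Real.sin θ)

/-- The standard model of `n` arcs properly embedded in the standard annulus, each
joining the two boundary circles: two straight arcs crossing in exactly one interior
point, and `n - 2` parallel (disjoint radial) arcs, as in Fig. 3. -/
noncomputable def stdModel (n : ℕ) : Set (ℝ × ℝ) :=
  segment ℝ (dirPt 0) ((2:ℝ) • dirPt 1) ∪
  segment ℝ (dirPt 1) ((2:ℝ) • dirPt 0) ∪
  ⋃ k : Fin (n - 2),
    segment ℝ (dirPt (2 + 4 * ((k : ℕ) + 1) / n)) ((2:ℝ) • dirPt (2 + 4 * ((k : ℕ) + 1) / n))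

open Set Filter Topology Metric
def HasLg (g : ℂ → ℂ) (X : Set ℂ) : Prop :=
  ∃ L : ℂ → ℂ, ContinuousOn L X ∧ ∀ z ∈ X, Complex.exp (L z) = g z

lemma HasLg.mono {g : ℂ → ℂ} {X Y : Set ℂ} (h : HasLg g X) (hY : Y ⊆ X) : HasLg g Y := by
  obtain ⟨L, h1, h2⟩ := h
  exact ⟨L, h1.mono hY, fun z hz => h2 z (hY hz)⟩

lemma HasLg.congr {g g' : ℂ → ℂ} {X : Set ℂ} (h : HasLg g X) (hY : EqOn g g' X) :
    HasLg g' X := by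
  obtain ⟨L, h1, h2⟩ := h
  exact ⟨L, h1, fun z hz => (h2 z hz).trans (hY hz)⟩

lemma HasLg.mul {g g' : ℂ → ℂ} {X : Set ℂ} (h : HasLg g X) (h' : HasLg g' X) :
    HasLg (fun z => g z * g' z) X := by
  obtain ⟨L, h1, h2⟩ := h
  obtain ⟨L', h1', h2'⟩ := h'
  exact ⟨fun z => L z + L' z, h1.add h1', fun z hz => by rw [Complex.exp_add, h2 z hz, h2' z hz]⟩

lemma HasLg.div {g g' : ℂ → ℂ} {X : Set ℂ} (h : HasLg g X) (h' : HasLg g' X) :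
    HasLg (fun z => g z / g' z) X := by
  obtain ⟨L, h1, h2⟩ := h
  obtain ⟨L', h1', h2'⟩ := h'
  exact ⟨fun z => L z - L' z, h1.sub h1', fun z hz => by rw [Complex.exp_sub, h2 z hz, h2' z hz]⟩

lemma HasLg.const {c : ℂ} (hc : c ≠ 0) (X : Set ℂ) : HasLg (fun _ => c) X :=
  ⟨fun _ => Complex.log c, continuousOn_const, fun _ _ => Complex.exp_log hc⟩

lemma HasLg.slit {g : ℂ → ℂ} {X : Set ℂ} (hg : ContinuousOn g X)
    (h : ∀ z ∈ X, g z ∈ Complex.slitPlane) : HasLg g X :=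
  ⟨fun z => Complex.log (g z), hg.clog h,
    fun z hz => Complex.exp_log (Complex.slitPlane_ne_zero (h z hz))⟩

lemma HasLg.near_one {g : ℂ → ℂ} {X : Set ℂ} (hg : ContinuousOn g X)
    (h : ∀ z ∈ X, ‖g z - 1‖ < 1) : HasLg g X := by
  refine HasLg.slit hg fun z hz => ?_
  have := Complex.mem_slitPlane_of_norm_lt_one (h z hz)
  simpa using this

lemma HasLg.convex {g : ℂ → ℂ} {U : Set ℂ} (hU : Convex ℝ U) (hne : U.Nonempty) (ho : IsOpen U)
    (hg : ContinuousOn g U) (h : ∀ z ∈ U, g z ≠ 0) : HasLg g U := by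
  have : ContractibleSpace U := hU.contractibleSpace hne
  obtain ⟨f, h1, h2⟩ := Complex.exists_continuousOn_eqOn_exp_comp
    (SimplyConnectedSpace.ofContractible U : IsSimplyConnected U) ho hg
    (by rintro ⟨z, hz, h0⟩; exact h z hz h0)
  exact ⟨f, h1, h2⟩

lemma lg_diff {L L' : ℂ → ℂ} {C : Set ℂ} (hC : IsPreconnected C) (h : ContinuousOn L C)
    (h' : ContinuousOn L' C) (he : ∀ z ∈ C, Complex.exp (L z) = Complex.exp (L' z)) :
    ∃ n : ℤ, ∀ z ∈ C, L z = L' z + n * (2 * Real.pi * Complex.I) := by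
  rcases C.eq_empty_or_nonempty with rfl | ⟨w, hw⟩
  · exact ⟨0, by simp⟩
  have hI : (2 * Real.pi * Complex.I : ℂ) ≠ 0 := Complex.two_pi_I_ne_zero
  have hT : IsDiscrete (range ((↑) : ℤ → ℂ)) := by
    constructor
    have := Complex.isometry_ofReal.isEmbedding.comp Int.isClosedEmbedding_coe_real.isEmbedding
    have e : range ((↑) : ℤ → ℂ) = range (Complex.ofReal ∘ ((↑) : ℤ → ℝ)) := by
      congr 1
    rw [e]
    exact this.toHomeomorph.symm.isEmbedding.discreteTopology
  have key := fun z (hz : z ∈ C) => hC.constant_of_mapsTo hT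
    (f := fun z => (L z - L' z) / (2 * Real.pi * Complex.I))
    ((h.sub h').div_const _) (fun z hz => by
      obtain ⟨n, hn⟩ := Complex.exp_eq_exp_iff_exists_int.1 (he z hz)
      exact ⟨n, by simp only [hn]; field_simp; ring⟩) hz hw
  obtain ⟨n, hn⟩ := Complex.exp_eq_exp_iff_exists_int.1 (he w hw)
  refine ⟨n, fun z hz => ?_⟩
  have := key z hz
  rw [div_left_inj' hI] at this
  linear_combination this + hn

lemma glue_cont {L L' : ℂ → ℂ} {A B : Set ℂ} (hA : IsClosed A) (hB : IsClosed B)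
    (h : ContinuousOn L A) (h' : ContinuousOn L' B) (he : ∀ z ∈ A ∩ B, L z = L' z) :
    ∃ M, ContinuousOn M (A ∪ B) ∧ EqOn M L A ∧ EqOn M L' B := by
  classical
  have e1 : EqOn (A.piecewise L L') L A := fun z hz => by simp [hz]
  have e2 : EqOn (A.piecewise L L') L' B := fun z hz => by
    by_cases hzA : z ∈ A
    · simp [hzA, he z ⟨hzA, hz⟩]
    · simp [hzA]
  exact ⟨A.piecewise L L', (h.congr e1).union_of_isClosed (h'.congr e2) hA hB, e1, e2⟩

lemma HasLg.glue {g : ℂ → ℂ} {A B : Set ℂ} (hA : IsClosed A) (hB : IsClosed B)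
    (hAB : IsPreconnected (A ∩ B)) (h : HasLg g A) (h' : HasLg g B) : HasLg g (A ∪ B) := by
  obtain ⟨L, h1, h2⟩ := h
  obtain ⟨L', h1', h2'⟩ := h'
  obtain ⟨n, hn⟩ := lg_diff hAB (h1.mono inter_subset_left) (h1'.mono inter_subset_right)
    (fun z hz => (h2 z hz.1).trans (h2' z hz.2).symm)
  obtain ⟨M, m1, m2, m3⟩ := glue_cont (L' := fun z => L' z + n * (2 * Real.pi * Complex.I))
    hA hB h1 (h1'.add continuousOn_const) hn
  refine ⟨M, m1, ?_⟩
  rintro z (hz | hz)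
  · rw [m2 hz, h2 z hz]
  · rw [m3 hz, ← h2' z hz]
    exact Complex.exp_eq_exp_iff_exists_int.2 ⟨n, rfl⟩

lemma tietze {L : ℂ → ℂ} {X : Set ℂ} (hX : IsClosed X) (h : ContinuousOn L X) :
    ∃ M : ℂ → ℂ, Continuous M ∧ EqOn M L X := by
  obtain ⟨g, hg⟩ := ContinuousMap.exists_restrict_eq hX ⟨X.domRestrict L, h.domRestrict⟩
  exact ⟨g, g.continuous, fun z hz => congrArg (fun f => f ⟨z, hz⟩) hg⟩

lemma no_lg_circle {r : ℝ} (hr : 0 < r) (c : ℂ) : ¬ HasLg (fun z => z - c) (sphere c r) := by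
  rintro ⟨L, h1, h2⟩
  have hm : ∀ t : ℝ, c + r * Complex.exp (t * Complex.I) ∈ sphere c r := fun t => by
    simp [Complex.norm_exp_ofReal_mul_I, abs_of_pos hr]
  have hcont : Continuous fun t : ℝ => L (c + r * Complex.exp (t * Complex.I)) :=
    h1.comp_continuous (by fun_prop) hm
  -- consider along the real line in the complex plane
  obtain ⟨n, hn⟩ := lg_diff (C := (fun t : ℝ => (t : ℂ)) '' univ)
    (L := fun z => L (c + r * Complex.exp (z.re * Complex.I)))
    (L' := fun z => Real.log r + z.re * Complex.I)
    (isPreconnected_univ.image _ Complex.continuous_ofReal.continuousOn)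
    ((hcont.comp Complex.continuous_re).continuousOn) (by fun_prop) (by
      rintro z -
      rw [h2 _ (hm _), Complex.exp_add, ← Complex.ofReal_exp, Real.exp_log hr]
      ring)
  have a0 := hn (0 : ℝ) ⟨0, trivial, rfl⟩
  have a1 := hn ((2 * Real.pi : ℝ)) ⟨2 * Real.pi, trivial, rfl⟩
  simp only [Complex.ofReal_re] at a0 a1
  have e : Complex.exp (((2 * Real.pi : ℝ) : ℂ) * Complex.I) = Complex.exp (((0:ℝ) : ℂ) * Complex.I) := by
    push_cast
    rw [Complex.exp_two_pi_mul_I]; simp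
  rw [e, a0] at a1
  have : (2 * Real.pi * Complex.I : ℂ) = 0 := by
    push_cast at a1
    linear_combination -a1
  exact Complex.two_pi_I_ne_zero this

lemma lg_frontier {X V : Set ℂ} (hX : IsCompact X) (hV : IsOpen V) (hVb : Bornology.IsBounded V)
    (hf : frontier V ⊆ X) {a b : ℂ} (ha : a ∈ V) (hb : b ∉ V) (hbX : b ∉ X) :
    ¬ HasLg (fun z => (z - a) / (z - b)) X := by
  rintro ⟨L, h1, h2⟩
  obtain ⟨L', l1, l2⟩ := tietze hX.isClosed h1
  obtain ⟨M, m1, m2, m3⟩ := glue_cont (A := closure V) (B := Vᶜ)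
    (L := fun z => (z - b) * Complex.exp (L' z)) (L' := fun z => z - a)
    isClosed_closure hV.isClosed_compl (by fun_prop) (by fun_prop) (by
      rintro z ⟨hz, hz'⟩
      have hzX : z ∈ X := hf ⟨hz, by rwa [hV.interior_eq]⟩
      have : z - b ≠ 0 := sub_ne_zero.2 (fun h => hbX (h ▸ hzX))
      simp only [l2 hzX, h2 z hzX]
      field_simp)
  have hu : closure V ∪ Vᶜ = univ := by
    refine eq_univ_of_forall fun z => ?_
    by_cases h : z ∈ V
    · exact Or.inl (subset_closure h)
    · exact Or.inr h
  rw [hu] at m1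
  have hM : HasLg M univ := by
    refine HasLg.convex convex_univ univ_nonempty isOpen_univ m1 fun z _ => ?_
    by_cases h : z ∈ closure V
    · rw [m2 h]
      refine mul_ne_zero (sub_ne_zero.2 ?_) (Complex.exp_ne_zero _)
      rintro rfl
      exact hbX (hf ⟨h, by rwa [hV.interior_eq]⟩)
    · rw [m3 (fun h' => h (subset_closure h'))]
      exact sub_ne_zero.2 (fun h' => h (subset_closure (h' ▸ ha)))
  obtain ⟨R, hR0, hR⟩ := hVb.subset_ball_lt 0 a
  refine no_lg_circle hR0 a ((hM.mono (subset_univ _)).congr fun z hz => m3 ?_)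
  intro h
  have := hR h
  rw [mem_ball] at this; rw [mem_sphere] at hz; linarith

lemma frontier_comp {X : Set ℂ} (hX : IsClosed X) (a : ℂ) :
    frontier (connectedComponentIn Xᶜ a) ⊆ X := by
  intro z hz
  by_contra hzX
  have hW := hX.isOpen_compl.connectedComponentIn (x := z)
  have hzW : z ∈ connectedComponentIn Xᶜ z := mem_connectedComponentIn hzX
  obtain ⟨w, hw, hw'⟩ := mem_closure_iff.1 hz.1 _ hW hzW
  have e1 := connectedComponentIn_eq hw
  have e2 := connectedComponentIn_eq hw'
  apply hz.2
  rw [(hX.isOpen_compl.connectedComponentIn).interior_eq, e2, ← e1]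
  exact hzW

lemma preconn_compl_closedBall {R : ℝ} (hR : 0 < R) : IsPreconnected {z : ℂ | R < ‖z‖} := by
  have : {z : ℂ | R < ‖z‖} = Complex.exp '' {w : ℂ | Real.log R < w.re} := by
    ext z
    constructor
    · intro h
      have hz : z ≠ 0 := fun h0 => by simp [h0] at h; linarith
      refine ⟨Complex.log z, ?_, Complex.exp_log hz⟩
      simp only [mem_ofPred_eq, Complex.log_re]
      exact Real.log_lt_log hR h
    · rintro ⟨w, hw, rfl⟩
      simp only [mem_ofPred_eq, Complex.norm_exp] at hw ⊢
      rwa [← Real.log_lt_iff_lt_exp hR]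
  rw [this]
  exact (convex_halfSpace_re_gt _).isPreconnected.image _ Complex.continuous_exp.continuousOn

lemma HasLg.swap {X : Set ℂ} {a b : ℂ} (h : HasLg (fun z => (z - a) / (z - b)) X) :
    HasLg (fun z => (z - b) / (z - a)) X :=
  ((HasLg.const one_ne_zero X).div h).congr fun z _ => by simp

lemma unbdd_comp_eq {X : Set ℂ} (hX : IsCompact X) {a b : ℂ}
    (ha : ¬ Bornology.IsBounded (connectedComponentIn Xᶜ a))
    (hb : ¬ Bornology.IsBounded (connectedComponentIn Xᶜ b)) :
    connectedComponentIn Xᶜ a = connectedComponentIn Xᶜ b := by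
  obtain ⟨R, hR0, hR⟩ := hX.isBounded.subset_ball_lt 0 0
  have hS : {z : ℂ | R < ‖z‖} ⊆ Xᶜ := fun z hz hzX => by
    have := hR hzX; simp at this hz; linarith
  have key : ∀ c : ℂ, ¬ Bornology.IsBounded (connectedComponentIn Xᶜ c) →
      ∃ w, R < ‖w‖ ∧ w ∈ connectedComponentIn Xᶜ c := by
    intro c hc
    by_contra! hcon
    apply hc
    refine (isBounded_closedBall (x := (0:ℂ)) (r := R)).subset fun z hz => ?_
    by_contra hz'
    exact hcon z (by simpa using hz') hz
  obtain ⟨w, hw, hwa⟩ := key a ha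
  obtain ⟨v, hv, hvb⟩ := key b hb
  rw [connectedComponentIn_eq hwa, connectedComponentIn_eq hvb]
  exact connectedComponentIn_eq ((preconn_compl_closedBall hR0).subset_connectedComponentIn
    hw hS hv)

lemma lg_same_comp {X : Set ℂ} (hX : IsCompact X) {a b : ℂ} (ha : a ∉ X) (hb : b ∉ X)
    (h : HasLg (fun z => (z - a) / (z - b)) X) : b ∈ connectedComponentIn Xᶜ a := by
  have hao := hX.isClosed.isOpen_compl.connectedComponentIn (x := a)
  have hbo := hX.isClosed.isOpen_compl.connectedComponentIn (x := b)
  have haa : a ∈ connectedComponentIn Xᶜ a := mem_connectedComponentIn ha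
  have hbb : b ∈ connectedComponentIn Xᶜ b := mem_connectedComponentIn hb
  by_contra hcon
  by_cases h1 : Bornology.IsBounded (connectedComponentIn Xᶜ a)
  · exact lg_frontier hX hao h1 (frontier_comp hX.isClosed a) haa hcon hb h
  by_cases h2 : Bornology.IsBounded (connectedComponentIn Xᶜ b)
  · refine lg_frontier hX hbo h2 (frontier_comp hX.isClosed b) hbb (fun hab => hcon ?_) ha h.swap
    rwa [← connectedComponentIn_eq hab]
  rw [unbdd_comp_eq hX h1 h2] at hcon
  exact hcon hbb

lemma lg_of_conn {X C : Set ℂ} (hX : IsClosed X) (hC : IsPreconnected C) (hCX : C ⊆ Xᶜ) {a b : ℂ}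
    (ha : a ∈ C) (hb : b ∈ C) : HasLg (fun z => (z - a) / (z - b)) X := by
  refine hC.induction₂' (fun a b => HasLg (fun z => (z - a) / (z - b)) X) ?_ ?_ ha hb
  · intro x hx
    have : ∃ r > 0, ball x r ⊆ Xᶜ := Metric.isOpen_iff.1 hX.isOpen_compl x (hCX hx)
    obtain ⟨r, hr, hrX⟩ := this
    filter_upwards [mem_nhdsWithin_of_mem_nhds (ball_mem_nhds x hr)] with y hy
    have : HasLg (fun z => (z - y) / (z - x)) X := by
      have hzx : ∀ z ∈ X, r ≤ ‖z - x‖ := fun z hz => by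
        by_contra hlt
        exact hrX (by simpa [dist_eq_norm] using hlt) hz
      have hne : ∀ z ∈ X, z - x ≠ 0 := fun z hz h0 => by
        have := hzx z hz; rw [h0, norm_zero] at this; linarith
      refine HasLg.near_one (ContinuousOn.div (by fun_prop) (by fun_prop) hne) fun z hz => ?_
      have h1 := hne z hz
      have : (z - y) / (z - x) - 1 = (x - y) / (z - x) := by field_simp; ring
      rw [this, norm_div, div_lt_one (norm_pos_iff.2 h1)]
      refine lt_of_lt_of_le ?_ (hzx z hz)
      rw [mem_ball, dist_comm, dist_eq_norm] at hy
      exact hy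
    exact ⟨this.swap, this⟩
  · intro x y z hx hy hz h1 h2
    refine (h1.mul h2).congr fun w hw => ?_
    have : w - y ≠ 0 := sub_ne_zero.2 fun h => hCX hy (h ▸ hw)
    simp only
    field_simp

lemma lg_exterior {B : Set ℂ} {k a : ℂ} {r : ℝ} (hB : B ⊆ ball k r) (ha : a ∉ ball k r) :
    HasLg (fun z => z - a) B := by
  rcases B.eq_empty_or_nonempty with rfl | ⟨w, hw⟩
  · exact ⟨fun _ => 0, continuousOn_const, by simp⟩
  have hr : 0 < r := (dist_nonneg).trans_lt (hB hw)
  rw [mem_ball, not_lt, dist_eq_norm] at ha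
  have hka : k - a ≠ 0 := fun h0 => by
    rw [← norm_neg, neg_sub, h0, norm_zero] at ha; linarith
  have h1 : HasLg (fun z => (z - a) / (k - a)) B := by
    refine HasLg.near_one (by fun_prop) fun z hz => ?_
    have : (z - a) / (k - a) - 1 = (z - k) / (k - a) := by field_simp; ring
    rw [this, norm_div, div_lt_one (norm_pos_iff.2 hka), norm_sub_rev k a]
    have := hB hz
    rw [mem_ball, dist_eq_norm] at this
    linarith
  refine (h1.mul (HasLg.const hka B)).congr fun z _ => ?_
  simp only; field_simp

lemma lg_pole {X : Set ℂ} (hX : IsCompact X) (hc : IsPreconnected Xᶜ) {p : ℂ} (hp : p ∉ X) :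
    HasLg (fun z => z - p) X := by
  obtain ⟨R, hR0, hR⟩ := hX.isBounded.subset_ball_lt 0 0
  have hq : (R : ℂ) ∉ ball (0:ℂ) R := by simp [abs_of_pos hR0]
  have h1 := lg_of_conn hX.isClosed hc subset_rfl hp (fun h => hq (hR h))
  refine (h1.mul (lg_exterior hR hq)).congr fun z hz => ?_
  have : z - R ≠ 0 := sub_ne_zero.2 fun h => hq (h ▸ hR hz)
  simp only; field_simp

lemma exists_min_nolg {X : Set ℂ} (hX : IsCompact X) {g : ℂ → ℂ} (hg : Continuous g)
    (hXc : IsPreconnected Xᶜ) (h : ¬ HasLg g X) :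
    ∃ Y ⊆ X, IsClosed Y ∧ IsPreconnected Yᶜ ∧ ¬ HasLg g Y ∧
      ∀ Z ⊆ Y, IsClosed Z → IsPreconnected Zᶜ → Z ≠ Y → HasLg g Z := by
  obtain ⟨q, hq⟩ : ∃ q, q ∉ X := by
    obtain ⟨R, hR0, hR⟩ := hX.isBounded.subset_ball_lt 0 0
    exact ⟨R, fun h => by have := hR h; simp [abs_of_pos hR0] at this⟩
  obtain ⟨Y, hY⟩ := zorn_superset {Y : Set ℂ | Y ⊆ X ∧ IsClosed Y ∧ IsPreconnected Yᶜ ∧ ¬ HasLg g Y} (by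
    intro c hc hch
    rcases c.eq_empty_or_nonempty with rfl | hne
    · exact ⟨X, ⟨subset_rfl, hX.isClosed, hXc, h⟩, by simp⟩
    refine ⟨⋂₀ c, ⟨?_, isClosed_sInter fun s hs => (hc hs).2.1, ?_, ?_⟩,
      fun s hs => sInter_subset_of_mem hs⟩
    · obtain ⟨s, hs⟩ := hne
      exact (sInter_subset_of_mem hs).trans (hc hs).1
    · rw [compl_sInter]
      refine isPreconnected_sUnion q _ ?_ ?_
      · rintro _ ⟨s, hs, rfl⟩ hqs
        exact hq ((hc hs).1 hqs)
      · rintro _ ⟨s, hs, rfl⟩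
        exact (hc hs).2.2.1
    rintro ⟨L, h1, h2⟩
    obtain ⟨M, m1, m2⟩ := tietze (isClosed_sInter fun s hs => (hc hs).2.1) h1
    have hopen : IsOpen {z | ‖g z / Complex.exp (M z) - 1‖ < 1} :=
      isOpen_lt (Continuous.norm (Continuous.sub (hg.div (by fun_prop)
        fun z => Complex.exp_ne_zero _) continuous_const)) continuous_const
    have : Nonempty c := hne.to_subtype
    have hdir : Directed (fun x1 x2 => x1 ⊇ x2) (fun s : c => (s : Set ℂ)) := by
      rintro ⟨s, hs⟩ ⟨t, ht⟩
      rcases hch.total hs ht with hst | hst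
      · exact ⟨⟨s, hs⟩, subset_rfl, hst⟩
      · exact ⟨⟨t, ht⟩, hst, subset_rfl⟩
    obtain ⟨⟨s, hs⟩, hsub⟩ := exists_subset_nhds_of_isCompact hdir
      (fun s => hX.of_isClosed_subset (hc s.2).2.1 (hc s.2).1)
      (U := {z | ‖g z / Complex.exp (M z) - 1‖ < 1}) (by
        intro z hz
        rw [← sInter_eq_iInter] at hz
        refine hopen.mem_nhds ?_
        have : g z / Complex.exp (M z) = 1 := by
          rw [m2 hz, h2 z hz, div_self]
          rw [← h2 z hz]; exact Complex.exp_ne_zero _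
        simp [this])
    apply (hc hs).2.2.2
    have e1 : HasLg (fun z => g z / Complex.exp (M z)) s :=
      HasLg.near_one (hg.div (by fun_prop) fun z => Complex.exp_ne_zero _).continuousOn
        fun z hz => hsub hz
    refine (e1.mul ⟨M, m1.continuousOn, fun z _ => rfl⟩).congr fun z _ => ?_
    simp only
    have := Complex.exp_ne_zero (M z)
    field_simp)
  refine ⟨Y, hY.prop.1, hY.prop.2.1, hY.prop.2.2.1, hY.prop.2.2.2, fun Z hZ hZc hZp hne => ?_⟩
  by_contra hno
  exact hne (hZ.antisymm (hY.2 ⟨hZ.trans hY.prop.1, hZc, hZp, hno⟩ hZ))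

lemma jump_aux {z : ℂ} (h0 : z.re = 0) (h : 0 < z.im) :
    Complex.log z - Complex.log (-z) = Real.pi * Complex.I := by
  have e1 : z = (z.im : ℂ) * Complex.I := by apply Complex.ext <;> simp [h0]
  have e2 : -z = (z.im : ℂ) * (-Complex.I) := by rw [mul_neg, ← e1]
  rw [e2]
  nth_rewrite 1 [e1]
  rw [Complex.log_ofReal_mul h Complex.I_ne_zero,
    Complex.log_ofReal_mul h (neg_ne_zero.2 Complex.I_ne_zero), Complex.log_I, Complex.log_neg_I]
  ring

lemma slit_aux {z : ℂ} (h0 : 0 ≤ z.re) (h : z ≠ 0) : z ∈ Complex.slitPlane := by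
  rw [Complex.mem_slitPlane_iff]
  rcases h0.lt_or_eq with h1 | h1
  · exact Or.inl h1
  · exact Or.inr fun h2 => h (Complex.ext h1.symm h2)

lemma jump_one {Y : Set ℂ} {t : ℝ} {p : ℂ} (hpt : p.re = t) (hpY : p ∉ Y)
    (hp : HasLg (fun z => z - p) Y) : ∃ N1 N2 : ℂ → ℂ, ContinuousOn N1 (Y ∩ {z | z.re ≤ t}) ∧
      ContinuousOn N2 (Y ∩ {z | t ≤ z.re}) ∧ (∀ z ∈ Y ∩ {z | z.re ≤ t}, Complex.exp (N1 z) = 1) ∧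
      (∀ z ∈ Y ∩ {z | t ≤ z.re}, Complex.exp (N2 z) = 1) ∧
      ∀ z ∈ Y, z.re = t → (p.im < z.im → N1 z - N2 z = 2 * Real.pi * Complex.I) ∧
        (z.im < p.im → N1 z = N2 z) := by
  obtain ⟨l, l1, l2⟩ := hp
  have hne : ∀ z ∈ Y, z - p ≠ 0 := fun z hz => sub_ne_zero.2 fun h => hpY (h ▸ hz)
  have hne' : ∀ z ∈ Y, p - z ≠ 0 := fun z hz => sub_ne_zero.2 fun h => hpY (h ▸ hz)
  refine ⟨fun z => l z - Complex.log (p - z) + Real.pi * Complex.I,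
    fun z => l z - Complex.log (z - p), ?_, ?_, ?_, ?_, ?_⟩
  · refine ((l1.mono inter_subset_left).sub (ContinuousOn.clog (by fun_prop) ?_)).add
      continuousOn_const
    rintro z ⟨hz, hzt⟩
    exact slit_aux (by simp at hzt; simp [hpt, hzt]) (hne' z hz)
  · refine ((l1.mono inter_subset_left).sub (ContinuousOn.clog (by fun_prop) ?_))
    rintro z ⟨hz, hzt⟩
    exact slit_aux (by simp at hzt; simp [hpt, hzt]) (hne z hz)
  · rintro z ⟨hz, -⟩
    have h1 := hne' z hz
    rw [Complex.exp_add, Complex.exp_sub, l2 z hz, Complex.exp_log h1, Complex.exp_pi_mul_I]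
    field_simp; ring
  · rintro z ⟨hz, -⟩
    have h1 := hne z hz
    rw [Complex.exp_sub, l2 z hz, Complex.exp_log h1]
    field_simp
  · intro z hz hzt
    constructor
    · intro hlt
      have := jump_aux (z := z - p) (by simp [hpt, hzt]) (by simpa using hlt)
      rw [neg_sub] at this
      simp only
      linear_combination this
    · intro hlt
      have := jump_aux (z := p - z) (by simp [hpt, hzt]) (by simpa using hlt)
      rw [neg_sub] at this
      simp only
      linear_combination -this

lemma lg_cut {Y : Set ℂ} (hY : IsCompact Y) {g : ℂ → ℂ} {t : ℝ}
    (hp : ∀ p : ℂ, p ∉ Y → HasLg (fun z => z - p) Y)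
    (hA : HasLg g (Y ∩ {z | z.re ≤ t})) (hB : HasLg g (Y ∩ {z | t ≤ z.re})) : HasLg g Y := by
  set A := Y ∩ {z : ℂ | z.re ≤ t} with hAd
  set B := Y ∩ {z : ℂ | t ≤ z.re} with hBd
  have hAc : IsClosed A := hY.isClosed.inter (isClosed_le Complex.continuous_re continuous_const)
  have hBc : IsClosed B := hY.isClosed.inter (isClosed_le continuous_const Complex.continuous_re)
  have hAB : A ∪ B = Y := by
    rw [hAd, hBd, ← inter_union_distrib_left]
    refine inter_eq_left.2 fun z _ => le_total z.re t
  have hSY : ∀ z ∈ A ∩ B, z ∈ Y ∧ z.re = t := fun z hz => ⟨hz.1.1, le_antisymm hz.1.2 hz.2.2⟩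
  obtain ⟨R, hR0, hR⟩ := hY.isBounded.subset_ball_lt 0 0
  have him : ∀ z ∈ Y, |z.im| ≤ R := fun z hz => (Complex.abs_im_le_norm z).trans (by
    have := hR hz; simp at this; exact this.le)
  have hS : IsCompact (A ∩ B) := hY.of_isClosed_subset (hAc.inter hBc) fun z hz => hz.1.1
  obtain ⟨L, a1, a2⟩ := hA
  obtain ⟨L', b1, b2⟩ := hB
  have hU := hS.uniformContinuousOn_of_continuous
    ((a1.mono inter_subset_left).sub (b1.mono inter_subset_right))
  obtain ⟨η, hη, hU⟩ := Metric.uniformContinuousOn_iff.1 hU 1 one_pos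
  have key : ∀ k : ℕ, ∃ L1 L2 : ℂ → ℂ, ContinuousOn L1 A ∧ ContinuousOn L2 B ∧
      (∀ z ∈ A, Complex.exp (L1 z) = g z) ∧ (∀ z ∈ B, Complex.exp (L2 z) = g z) ∧
      (∀ z ∈ A ∩ B, ∀ w ∈ A ∩ B, |z.im - w.im| < η → L1 z - L2 z = L1 w - L2 w) ∧
      (∀ z ∈ A ∩ B, z.im ≤ - R - 1 + k * (η / 2) → L1 z = L2 z) := by
    intro k
    induction k with
    | zero =>
      refine ⟨L, L', a1, b1, a2, b2, ?_, ?_⟩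
      · intro z hz w hw hzw
        have hd : dist z w < η := by
          rw [dist_eq_norm]
          have : z - w = ((z.im - w.im : ℝ) : ℂ) * Complex.I := by
            apply Complex.ext <;> simp [(hSY z hz).2, (hSY w hw).2]
          rw [this, norm_mul, Complex.norm_I, mul_one, Complex.norm_real]; exact hzw
        have h1 := hU z hz w hw hd
        obtain ⟨n, hn⟩ := Complex.exp_eq_exp_iff_exists_int.1 ((a2 z hz.1).trans (b2 z hz.2).symm)
        obtain ⟨m, hm⟩ := Complex.exp_eq_exp_iff_exists_int.1 ((a2 w hw.1).trans (b2 w hw.2).symm)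
        rw [dist_eq_norm] at h1
        simp only [Pi.sub_apply] at h1
        have e : L z - L' z - (L w - L' w) = ((n - m : ℤ) : ℂ) * (2 * Real.pi * Complex.I) := by
          push_cast; linear_combination hn - hm
        rw [e] at h1
        have h3 : ‖(2 * Real.pi * Complex.I : ℂ)‖ = 2 * Real.pi := by
          simp [abs_of_pos Real.pi_pos]
        rw [norm_mul, h3, Complex.norm_intCast] at h1
        have h4 : |((n - m : ℤ) : ℝ)| < 1 := by
          have := Real.pi_gt_three
          have := abs_nonneg ((n - m : ℤ) : ℝ)
          nlinarith
        have h5 : n - m = 0 := by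
          rw [← Int.abs_lt_one_iff]; exact_mod_cast h4
        rw [h5] at e
        simpa [sub_eq_zero] using e
      · intro z hz hzi
        have := (abs_le.1 (him z hz.1.1)).1
        simp at hzi
        linarith
    | succ k ih =>
      obtain ⟨L1, L2, c1, c2, e1, e2, P, Q⟩ := ih
      set y := - R - 1 + k * (η / 2) with hy
      have hy' : - R - 1 + ((k + 1 : ℕ) : ℝ) * (η / 2) = y + η / 2 := by
        rw [hy]; push_cast; ring
      rw [hy']
      by_cases hc : ∀ z ∈ A ∩ B, z.im ≤ y + η / 2 → L1 z = L2 z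
      · exact ⟨L1, L2, c1, c2, e1, e2, P, hc⟩
      push Not at hc
      obtain ⟨w, hw, hwy, hwne⟩ := hc
      have hwy' : y < w.im := by
        by_contra h; exact hwne (Q w hw (not_lt.1 h))
      have gap : ∀ z ∈ A ∩ B, y - η / 2 < z.im → y < z.im := by
        intro z hz hz1
        by_contra h
        have := P z hz w hw (by rw [abs_lt]; constructor <;> linarith)
        rw [Q z hz (not_lt.1 h), sub_self] at this
        exact hwne (sub_eq_zero.1 this.symm)
      obtain ⟨m, hm⟩ := Complex.exp_eq_exp_iff_exists_int.1 ((e1 w hw.1).trans (e2 w hw.2).symm)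
      have hpY : (⟨t, y - η / 4⟩ : ℂ) ∉ Y := fun h => by
        have := gap ⟨t, y - η / 4⟩ ⟨⟨h, le_refl t⟩, ⟨h, le_refl t⟩⟩ (by simp; linarith)
        simp at this; linarith
      obtain ⟨N1, N2, n1, n2, n3, n4, n5⟩ := jump_one (t := t) rfl hpY (hp _ hpY)
      simp only at n5
      have n6 : ∀ z ∈ A ∩ B, y < z.im → N1 z - N2 z = 2 * Real.pi * Complex.I := fun z hz h =>
        (n5 z (hSY z hz).1 (hSY z hz).2).1 (by linarith)
      have n7 : ∀ z ∈ A ∩ B, z.im ≤ y → N1 z = N2 z := fun z hz h =>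
        (n5 z (hSY z hz).1 (hSY z hz).2).2 (by
          by_contra h'
          have := gap z hz (by linarith)
          linarith)
      refine ⟨fun z => L1 z - m * N1 z, fun z => L2 z - m * N2 z, c1.sub (continuousOn_const.mul n1),
        c2.sub (continuousOn_const.mul n2), ?_, ?_, ?_, ?_⟩
      · intro z hz
        rw [Complex.exp_sub, Complex.exp_int_mul, n3 z hz, e1 z hz]; simp
      · intro z hz
        rw [Complex.exp_sub, Complex.exp_int_mul, n4 z hz, e2 z hz]; simp
      · have aux : ∀ z ∈ A ∩ B, ∀ v ∈ A ∩ B, |z.im - v.im| < η → z.im ≤ y → y < v.im → False := by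
          intro z hz v hv hzv h1 h2
          rw [abs_lt] at hzv
          have h3 : z.im ≤ y - η / 2 := by
            by_contra h; exact absurd (gap z hz (not_le.1 h)) (not_lt.2 h1)
          have h4 := P z hz v hv (abs_lt.2 hzv)
          have h5 := P v hv w hw (by rw [abs_lt]; constructor <;> linarith)
          rw [Q z hz h1, sub_self, h5] at h4
          exact hwne (sub_eq_zero.1 h4.symm)
        intro z hz v hv hzv
        have hP := P z hz v hv hzv
        by_cases h1 : z.im ≤ y <;> by_cases h2 : v.im ≤ y
        · simp only [n7 z hz h1, n7 v hv h2]; linear_combination hP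
        · exact (aux z hz v hv hzv h1 (not_le.1 h2)).elim
        · exact (aux v hv z hz (by rwa [abs_sub_comm]) h2 (not_le.1 h1)).elim
        · have q1 := n6 z hz (not_le.1 h1)
          have q2 := n6 v hv (not_le.1 h2)
          linear_combination hP - m * q1 + m * q2
      · intro z hz hzy
        by_cases h1 : z.im ≤ y
        · simp only [n7 z hz h1, Q z hz h1]
        · have q1 := n6 z hz (not_le.1 h1)
          have hP := P z hz w hw (by
            have := not_le.1 h1
            rw [abs_lt]; constructor <;> linarith)
          linear_combination hP + hm - m * q1
  obtain ⟨k, hk⟩ := exists_nat_gt ((2 * R + 1) / (η / 2))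
  rw [div_lt_iff₀ (by positivity)] at hk
  obtain ⟨L1, L2, c1, c2, e1, e2, -, Q⟩ := key k
  obtain ⟨M, m1, m2, m3⟩ := glue_cont hAc hBc c1 c2 (fun z hz => Q z hz (by
    have := (abs_le.1 (him z hz.1.1)).2
    linarith))
  rw [← hAB]
  refine ⟨M, m1, ?_⟩
  rintro z (hz | hz)
  · rw [m2 hz, e1 z hz]
  · rw [m3 hz, e2 z hz]

lemma precon_cut {Y H : Set ℂ} (hY : IsCompact Y) (hYc : IsPreconnected Yᶜ) (hH : IsPreconnected Hᶜ)
    (hu : ¬ Bornology.IsBounded Hᶜ) : IsPreconnected (Y ∩ H)ᶜ := by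
  rw [compl_inter]
  obtain ⟨x, hx, hx'⟩ : ∃ x ∈ Hᶜ, x ∉ Y := by
    by_contra! hcon
    exact hu (hY.isBounded.subset hcon)
  exact hYc.union x hx' hx hH

lemma unbdd_half (f : ℂ → ℝ) {v : ℂ} (hv : ∀ s : ℝ, f (s * v) = s) (t : ℝ) :
    ¬ Bornology.IsBounded {z : ℂ | t < f z} := by
  intro h
  obtain ⟨R, hR0, hR⟩ := h.subset_ball_lt 0 0
  have hv0 : v ≠ 0 := by
    rintro rfl
    have h1 := hv 0
    have h2 := hv 1
    simp at h1 h2; linarith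
  have hv1 : 0 < ‖v‖ := norm_pos_iff.2 hv0
  have := hR (show ((|t| + 1 + R / ‖v‖ : ℝ) : ℂ) * v ∈ _ by
    simp only [mem_ofPred_eq, hv]
    have := le_abs_self t
    have : 0 < R / ‖v‖ := by positivity
    linarith)
  rw [mem_ball_zero_iff, norm_mul, Complex.norm_real, Real.norm_of_nonneg (by positivity),
    add_mul, div_mul_cancel₀ _ hv1.ne'] at this
  have : 0 < (|t| + 1) * ‖v‖ := by positivity
  linarith

lemma borsuk {X : Set ℂ} (hX : IsCompact X) (hc : IsPreconnected Xᶜ) {g : ℂ → ℂ}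
    (hg : ContinuousOn g X) (h0 : ∀ z ∈ X, g z ≠ 0) : HasLg g X := by
  obtain ⟨g', g1, g2⟩ := tietze hX.isClosed hg
  suffices HasLg g' X from this.congr g2
  by_contra hno
  obtain ⟨Y, hYX, hYc, hYp, hYno, hmin⟩ := exists_min_nolg hX g1 hc hno
  have hY := hX.of_isClosed_subset hYc hYX
  apply hYno
  have c1 : ∀ t : ℝ, IsPreconnected (Y ∩ {z : ℂ | z.re ≤ t})ᶜ := fun t => by
    have e : {z : ℂ | z.re ≤ t}ᶜ = {z | t < z.re} := by ext; simp
    refine precon_cut hY hYp ?_ ?_ <;> rw [e]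
    · exact (convex_halfSpace_re_gt _).isPreconnected
    · exact unbdd_half (v := 1) _ (by simp) t
  have c2 : ∀ t : ℝ, IsPreconnected (Y ∩ {z : ℂ | t ≤ z.re})ᶜ := fun t => by
    have e : {z : ℂ | t ≤ z.re}ᶜ = {z | -t < -z.re} := by ext; simp
    refine precon_cut hY hYp ?_ ?_ <;> rw [e]
    · simp only [neg_lt_neg_iff]; exact (convex_halfSpace_re_lt _).isPreconnected
    · exact unbdd_half (v := -1) (fun z => - z.re) (by simp) (-t)
  have c3 : ∀ t : ℝ, IsPreconnected (Y ∩ {z : ℂ | z.im ≤ t})ᶜ := fun t => by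
    have e : {z : ℂ | z.im ≤ t}ᶜ = {z | t < z.im} := by ext; simp
    refine precon_cut hY hYp ?_ ?_ <;> rw [e]
    · exact (convex_halfSpace_im_gt _).isPreconnected
    · exact unbdd_half (v := Complex.I) _ (by simp) t
  have c4 : ∀ t : ℝ, IsPreconnected (Y ∩ {z : ℂ | t ≤ z.im})ᶜ := fun t => by
    have e : {z : ℂ | t ≤ z.im}ᶜ = {z | -t < -z.im} := by ext; simp
    refine precon_cut hY hYp ?_ ?_ <;> rw [e]
    · simp only [neg_lt_neg_iff]; exact (convex_halfSpace_im_lt _).isPreconnected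
    · exact unbdd_half (v := -Complex.I) (fun z => - z.im) (by simp) (-t)
  by_cases h1 : ∃ z ∈ Y, ∃ w ∈ Y, z.re < w.re
  · obtain ⟨z, hz, w, hw, hzw⟩ := h1
    obtain ⟨t, ht1, ht2⟩ := exists_between hzw
    refine lg_cut (t := t) hY (fun p hp => lg_pole hY hYp hp) (hmin _ inter_subset_left
      (hYc.inter (isClosed_le Complex.continuous_re continuous_const)) (c1 t) ?_)
      (hmin _ inter_subset_left
      (hYc.inter (isClosed_le continuous_const Complex.continuous_re)) (c2 t) ?_)
    · intro h
      rw [← h] at hw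
      exact absurd hw.2 (not_le.2 ht2)
    · intro h
      rw [← h] at hz
      exact absurd hz.2 (not_le.2 ht1)
  push Not at h1
  by_cases h2 : ∃ z ∈ Y, ∃ w ∈ Y, z.im < w.im
  · obtain ⟨z, hz, w, hw, hzw⟩ := h2
    obtain ⟨t, ht1, ht2⟩ := exists_between hzw
    have hcA := hYc.inter (isClosed_le Complex.continuous_im (continuous_const (y := t)))
    have hcB := hYc.inter (isClosed_le (continuous_const (y := t)) Complex.continuous_im)
    have hu : (Y ∩ {z : ℂ | z.im ≤ t}) ∪ (Y ∩ {z : ℂ | t ≤ z.im}) = Y := by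
      rw [← inter_union_distrib_left]
      exact inter_eq_left.2 fun z _ => le_total z.im t
    rw [← hu]
    refine HasLg.glue hcA hcB ?_ (hmin _ inter_subset_left hcA (c3 t) ?_)
      (hmin _ inter_subset_left hcB (c4 t) ?_)
    · apply Set.Subsingleton.isPreconnected
      rintro a ⟨⟨ha, ha1⟩, -, ha2⟩ b ⟨⟨hb, hb1⟩, -, hb2⟩
      exact Complex.ext (le_antisymm (h1 b hb a ha) (h1 a ha b hb))
        ((le_antisymm ha1 ha2).trans (le_antisymm hb1 hb2).symm)
    · intro h
      rw [← h] at hw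
      exact absurd hw.2 (not_le.2 ht2)
    · intro h
      rw [← h] at hz
      exact absurd hz.2 (not_le.2 ht1)
  push Not at h2
  rcases Y.eq_empty_or_nonempty with rfl | ⟨z, hz⟩
  · exact ⟨fun _ => 0, continuousOn_const, by simp⟩
  refine (HasLg.const (h0 z (hYX hz)) Y).congr fun w hw => ?_
  have : w = z := Complex.ext (le_antisymm (h1 z hz w hw) (h1 w hw z hz))
    (le_antisymm (h2 z hz w hw) (h2 w hw z hz))
  rw [this, g2 (hYX hz)]

lemma compact_inv {α β : Type*} [TopologicalSpace α] [TopologicalSpace β] [T2Space β] [Nonempty α]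
    {f : α → β} {K : Set α} (hK : IsCompact K) (hf : ContinuousOn f K) (hi : InjOn f K) :
    ∃ k : β → α, ContinuousOn k (f '' K) ∧ ∀ x ∈ K, k (f x) = x := by
  have hl : ∀ x ∈ K, Function.invFunOn f K (f x) = x := fun x hx =>
    hi.leftInvOn_invFunOn hx
  refine ⟨Function.invFunOn f K, ?_, hl⟩
  rw [continuousOn_iff_isClosed]
  intro t ht
  refine ⟨f '' (K ∩ t), ((hK.inter_right ht).image_of_continuousOn
    (hf.mono inter_subset_left)).isClosed, ?_⟩
  ext y
  constructor
  · rintro ⟨hy, x, hx, rfl⟩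
    exact ⟨⟨x, ⟨hx, by rwa [mem_preimage, hl x hx] at hy⟩, rfl⟩, ⟨x, hx, rfl⟩⟩
  · rintro ⟨⟨x, hx, rfl⟩, h⟩
    exact ⟨by rw [mem_preimage, hl x hx.1]; exact hx.2, h⟩

lemma lg_arc {e : ℝ → ℂ} {a b : ℝ} (hab : a ≤ b) (he : ContinuousOn e (Icc a b))
    (hi : InjOn e (Icc a b)) {g : ℂ → ℂ}
    (hg : ContinuousOn g (e '' Icc a b)) (h0 : ∀ z ∈ e '' Icc a b, g z ≠ 0) :
    HasLg g (e '' Icc a b) := by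
  obtain ⟨k, k1, k2⟩ := compact_inv isCompact_Icc he hi
  have hm : ∀ z : ℂ, e (projIcc a b hab z.re) ∈ e '' Icc a b := fun z => ⟨_, (projIcc a b hab z.re).2, rfl⟩
  have hcont : Continuous fun z : ℂ => e (projIcc a b hab z.re) :=
    he.comp_continuous (by fun_prop) fun z => (projIcc a b hab z.re).2
  obtain ⟨L, l1, l2⟩ := HasLg.convex (g := fun z : ℂ => g (e (projIcc a b hab z.re)))
    convex_univ univ_nonempty isOpen_univ
    (hg.comp_continuous hcont hm).continuousOn (fun z _ => h0 _ (hm z))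
  rw [continuousOn_univ] at l1
  refine ⟨fun z => L (k z), (l1.comp Complex.continuous_ofReal).comp_continuousOn k1, ?_⟩
  rintro _ ⟨t, ht, rfl⟩
  rw [l2 _ trivial, k2 t ht]
  simp [projIcc_of_mem hab ht]

lemma compl_conn_of_lg {X : Set ℂ} (hX : IsCompact X)
    (h : ∀ a ∉ X, ∀ b ∉ X, HasLg (fun z => (z - a) / (z - b)) X) : IsPreconnected Xᶜ := by
  refine isPreconnected_of_forall_pair fun a ha b hb => ?_
  exact ⟨connectedComponentIn Xᶜ a, connectedComponentIn_subset _ _, mem_connectedComponentIn ha,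
    lg_same_comp hX ha hb (h a ha b hb), isPreconnected_connectedComponentIn⟩

lemma ratio_cont {X : Set ℂ} {a b : ℂ} (hb : b ∉ X) :
    ContinuousOn (fun z => (z - a) / (z - b)) X :=
  ContinuousOn.div (by fun_prop) (by fun_prop) fun z hz => sub_ne_zero.2 fun h => hb (h ▸ hz)

lemma ratio_ne {X : Set ℂ} {a b : ℂ} (ha : a ∉ X) (hb : b ∉ X) : ∀ z ∈ X, (z - a) / (z - b) ≠ 0 :=
  fun _ hz => div_ne_zero (sub_ne_zero.2 fun h => ha (h ▸ hz)) (sub_ne_zero.2 fun h => hb (h ▸ hz))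

lemma arc_compact {e : ℝ → ℂ} {a b : ℝ} (he : ContinuousOn e (Icc a b)) : IsCompact (e '' Icc a b) :=
  isCompact_Icc.image_of_continuousOn he

lemma arc_compl_conn {e : ℝ → ℂ} {a b : ℝ} (hab : a ≤ b) (he : ContinuousOn e (Icc a b))
    (hi : InjOn e (Icc a b)) : IsPreconnected (e '' Icc a b)ᶜ :=
  compl_conn_of_lg (arc_compact he) fun _ ha _ hb =>
    lg_arc hab he hi (ratio_cont hb) (ratio_ne ha hb)

def IsJord (J : Set ℂ) : Prop :=
  ∃ j : ℂ → ℂ, ContinuousOn j (sphere 0 1) ∧ InjOn j (sphere 0 1) ∧ j '' sphere 0 1 = J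

lemma sphere_expI (t : ℝ) : Complex.exp (t * Complex.I) ∈ sphere (0:ℂ) 1 := by
  simp [Complex.norm_exp_ofReal_mul_I]

lemma sphere_param {z : ℂ} (hz : z ∈ sphere (0:ℂ) 1) (s : ℝ) :
    ∃ t ∈ Ico s (s + 2 * Real.pi), Complex.exp (t * Complex.I) = z := by
  have hz1 : ‖z‖ = 1 := by simpa using hz
  refine ⟨toIcoMod Real.two_pi_pos s z.arg, toIcoMod_mem_Ico _ _ _, ?_⟩
  have h1 : Complex.exp (z.arg * Complex.I) = z := by
    have := Complex.norm_mul_exp_arg_mul_I z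
    rwa [hz1, Complex.ofReal_one, one_mul] at this
  rw [toIcoMod, zsmul_eq_mul]
  push_cast
  rw [sub_mul, Complex.exp_sub, h1]
  have : Complex.exp ((toIcoDiv Real.two_pi_pos s z.arg : ℂ) * (2 * Real.pi) * Complex.I) = 1 :=
    Complex.exp_eq_one_iff.2 ⟨toIcoDiv Real.two_pi_pos s z.arg, by ring⟩
  rw [this, div_one]

lemma expI_inj {s t u : ℝ} (hs : s ∈ Ico u (u + 2 * Real.pi)) (ht : t ∈ Ico u (u + 2 * Real.pi))
    (h : Complex.exp (s * Complex.I) = Complex.exp (t * Complex.I)) : s = t := by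
  obtain ⟨n, hn⟩ := Complex.exp_eq_exp_iff_exists_int.1 h
  have h1 : s = t + n * (2 * Real.pi) := by
    have h2 : (s : ℂ) = t + n * (2 * Real.pi) := by
      apply mul_right_cancel₀ Complex.I_ne_zero
      rw [hn]; ring
    exact_mod_cast h2
  have hn0 : n = 0 := by
    rw [← Int.abs_lt_one_iff]
    have h3 : |(n : ℝ)| < 1 := by
      rw [abs_lt]
      have := Real.pi_pos
      constructor
      · by_contra hc; nlinarith [hs.1, hs.2, ht.1, ht.2, not_lt.1 hc]
      · by_contra hc; nlinarith [hs.1, hs.2, ht.1, ht.2, not_lt.1 hc]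
    exact_mod_cast h3
  rw [h1, hn0]; simp

lemma sphere_conn : IsPreconnected (sphere (0:ℂ) 1) := by
  have : sphere (0:ℂ) 1 = (fun t : ℝ => Complex.exp (t * Complex.I)) '' univ := by
    ext z
    constructor
    · intro hz
      obtain ⟨t, -, h⟩ := sphere_param hz 0
      exact ⟨t, trivial, h⟩
    · rintro ⟨t, -, rfl⟩; exact sphere_expI t
  rw [this]
  exact isPreconnected_univ.image _ (by fun_prop)

lemma sphere_diff_conn {w : ℂ} (hw : w ∈ sphere (0:ℂ) 1) : IsPreconnected (sphere (0:ℂ) 1 \ {w}) := by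
  obtain ⟨s, -, rfl⟩ := sphere_param hw 0
  have : sphere (0:ℂ) 1 \ {Complex.exp (s * Complex.I)} =
      (fun t : ℝ => Complex.exp (t * Complex.I)) '' Ioo s (s + 2 * Real.pi) := by
    ext z
    constructor
    · rintro ⟨hz, hne⟩
      obtain ⟨t, ht, h⟩ := sphere_param hz s
      refine ⟨t, ⟨lt_of_le_of_ne ht.1 ?_, ht.2⟩, h⟩
      rintro rfl
      exact hne h.symm
    · rintro ⟨t, ht, rfl⟩
      refine ⟨sphere_expI t, fun h => ?_⟩
      have := expI_inj ⟨ht.1.le, ht.2⟩ ⟨le_refl s, by linarith [Real.pi_pos]⟩ h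
      exact ht.1.ne' this
  rw [this]
  exact isPreconnected_Ioo.image _ (by fun_prop)

lemma sphere_cap {w : ℂ} (hw : w ∈ sphere (0:ℂ) 1) {r : ℝ} (hr : 0 < r) :
    ∃ S ⊆ sphere (0:ℂ) 1, IsClosed S ∧ IsPreconnected S ∧ w ∈ S ∧ S ⊆ ball w r ∧
      ∃ δ > 0, sphere (0:ℂ) 1 ∩ ball w δ ⊆ S := by
  obtain ⟨s, -, rfl⟩ := sphere_param hw 0
  have hc : Continuous fun t : ℝ => Complex.exp (t * Complex.I) := by fun_prop
  obtain ⟨d, hd, hd'⟩ := Metric.continuous_iff.1 hc s r hr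
  obtain ⟨c, hc0, hcd⟩ := exists_between (lt_min hd Real.pi_pos)
  have hcd' := hcd.trans_le (min_le_left _ _)
  have hcpi := hcd.trans_le (min_le_right _ _)
  set E := fun t : ℝ => Complex.exp (t * Complex.I)
  have hcl : IsClosed (E '' Icc (s + c) (s + 2 * Real.pi - c)) :=
    (isCompact_Icc.image hc).isClosed
  have hout : E s ∈ (E '' Icc (s + c) (s + 2 * Real.pi - c))ᶜ := by
    rintro ⟨t, ht, hts⟩
    have := expI_inj (u := s) ⟨by linarith [ht.1], by linarith [ht.2]⟩
      ⟨le_refl s, by linarith [Real.pi_pos]⟩ hts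
    linarith [ht.1]
  obtain ⟨δ, hδ, hδ'⟩ := Metric.isOpen_iff.1 hcl.isOpen_compl _ hout
  refine ⟨E '' Icc (s - c) (s + c), ?_, (isCompact_Icc.image hc).isClosed,
    isPreconnected_Icc.image _ hc.continuousOn, ⟨s, ⟨by linarith, by linarith⟩, rfl⟩, ?_, δ, hδ, ?_⟩
  · rintro _ ⟨t, -, rfl⟩; exact sphere_expI t
  · rintro _ ⟨t, ht, rfl⟩
    refine hd' t ?_
    rw [Real.dist_eq, abs_lt]
    constructor <;> linarith [ht.1, ht.2]
  · rintro z ⟨hz, hzb⟩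
    obtain ⟨t, ht, rfl⟩ := sphere_param hz (s - c)
    refine ⟨t, ⟨ht.1, ?_⟩, rfl⟩
    by_contra hlt
    exact hδ' hzb ⟨t, ⟨(not_le.1 hlt).le, by linarith [ht.2]⟩, rfl⟩

lemma IsJord.compact {J : Set ℂ} (h : IsJord J) : IsCompact J := by
  obtain ⟨j, h1, -, rfl⟩ := h
  exact (isCompact_sphere 0 1).image_of_continuousOn h1

lemma IsJord.conn {J : Set ℂ} (h : IsJord J) : IsPreconnected J := by
  obtain ⟨j, h1, -, rfl⟩ := h
  exact sphere_conn.image _ h1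

lemma IsJord.nonempty {J : Set ℂ} (h : IsJord J) : J.Nonempty := by
  obtain ⟨j, h1, -, rfl⟩ := h
  exact ⟨j 1, 1, by simp, rfl⟩

lemma IsJord.diff_conn {J : Set ℂ} (h : IsJord J) (p : ℂ) : IsPreconnected (J \ {p}) := by
  by_cases hp : p ∈ J
  · obtain ⟨j, h1, h2, rfl⟩ := h
    obtain ⟨w, hw, rfl⟩ := hp
    have : j '' sphere 0 1 \ {j w} = j '' (sphere 0 1 \ {w}) := by
      rw [h2.image_sdiff_subset (by simpa using hw), image_singleton]
    rw [this]
    exact (sphere_diff_conn hw).image _ (h1.mono sdiff_subset)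
  · rw [sdiff_singleton_eq_self hp]; exact h.conn

lemma IsJord.cap {J : Set ℂ} (h : IsJord J) {p : ℂ} (hp : p ∈ J) {r : ℝ} (hr : 0 < r) :
    ∃ S ⊆ J, IsClosed S ∧ IsPreconnected S ∧ p ∈ S ∧ S ⊆ ball p r ∧ ∃ δ > 0, J ∩ ball p δ ⊆ S := by
  obtain ⟨j, h1, h2, rfl⟩ := h
  obtain ⟨w, hw, rfl⟩ := hp
  obtain ⟨k, k1, k2⟩ := compact_inv (isCompact_sphere (0:ℂ) 1) h1 h2
  obtain ⟨a, ha, ha'⟩ := Metric.continuousOn_iff.1 h1 w hw r hr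
  obtain ⟨S, s1, s2, s3, s4, s5, δ, hδ, s6⟩ := sphere_cap hw ha
  obtain ⟨b, hb, hb'⟩ := Metric.continuousOn_iff.1 k1 (j w) ⟨w, hw, rfl⟩ δ hδ
  refine ⟨j '' S, image_mono s1, (((isCompact_sphere (0:ℂ) 1).of_isClosed_subset s2
    s1).image_of_continuousOn (h1.mono s1)).isClosed, s3.image _ (h1.mono s1), ⟨w, s4, rfl⟩, ?_,
    b, hb, ?_⟩
  · rintro _ ⟨z, hz, rfl⟩
    exact ha' z (s1 hz) (s5 hz)
  · rintro _ ⟨⟨z, hz, rfl⟩, hzb⟩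
    have := hb' (j z) ⟨z, hz, rfl⟩ hzb
    rw [k2 z hz, k2 w hw] at this
    exact ⟨z, s6 ⟨hz, this⟩, rfl⟩

lemma compl_comp_conn {J : Set ℂ} (hJ : IsClosed J) (hJc : IsPreconnected J) (hne : J.Nonempty)
    (a : ℂ) : IsPreconnected (connectedComponentIn Jᶜ a)ᶜ := by
  obtain ⟨q, hq⟩ := hne
  set U := connectedComponentIn Jᶜ a
  have hU : IsOpen U := hJ.isOpen_compl.connectedComponentIn
  have hJU : J ⊆ Uᶜ := fun z hz hzU => connectedComponentIn_subset _ _ hzU hz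
  refine isPreconnected_of_forall q fun z hz => ?_
  by_cases hzJ : z ∈ J
  · exact ⟨J, hJU, hq, hzJ, hJc⟩
  set V := connectedComponentIn Jᶜ z
  have hzV : z ∈ V := mem_connectedComponentIn hzJ
  have hVU : V ⊆ Uᶜ := fun w hwV hwU => by
    apply hz
    have e1 := connectedComponentIn_eq hwV
    have e2 := connectedComponentIn_eq hwU
    change z ∈ connectedComponentIn Jᶜ a
    rw [e2, ← e1]; exact hzV
  have hVf : (frontier V).Nonempty := by
    by_contra hcon
    rw [not_nonempty_iff_eq_empty, frontier_eq_empty_iff] at hcon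
    rcases hcon with h | h
    · rw [h] at hzV; exact hzV
    · exact connectedComponentIn_subset _ _ (h ▸ trivial : q ∈ V) hq
  obtain ⟨w, hw⟩ := hVf
  refine ⟨closure V ∪ J, union_subset (closure_minimal hVU hU.isClosed_compl) hJU, Or.inr hq,
    Or.inl (subset_closure hzV), ?_⟩
  exact IsPreconnected.union w hw.1 (frontier_comp hJ z hw)
    isPreconnected_connectedComponentIn.closure hJc

def LgDom (U : Set ℂ) : Prop :=
  ∀ g : ℂ → ℂ, ContinuousOn g U → (∀ z ∈ U, g z ≠ 0) → HasLg g U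

lemma lgDom_of {U : Set ℂ} (hU : IsOpen U) (hb : Bornology.IsBounded U) (hconn : IsConnected U)
    (hc : IsPreconnected Uᶜ) : LgDom U := by
  intro g hg h0
  obtain ⟨z0, hz0⟩ := hconn.nonempty
  have hne : (Uᶜ : Set ℂ).Nonempty := by
    obtain ⟨R, hR0, hR⟩ := hb.subset_ball_lt 0 0
    exact ⟨R, fun h => by have := hR h; simp [abs_of_pos hR0] at this⟩
  have hpos : ∀ z ∈ U, 0 < infDist z Uᶜ := fun z hz =>
    (hU.isClosed_compl.notMem_iff_infDist_pos hne).1 (fun h => h hz)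
  set X : ℕ → Set ℂ := fun n => {z | 1 / ((n : ℝ) + 1) ≤ infDist z Uᶜ}
  have hXU : ∀ n, X n ⊆ U := fun n z hz => by
    by_contra hzU
    have h1 : infDist z Uᶜ = 0 := infDist_zero_of_mem hzU
    have h2 : 1 / ((n : ℝ) + 1) ≤ infDist z Uᶜ := hz
    have : 0 < 1 / ((n : ℝ) + 1) := by positivity
    linarith
  have hXc : ∀ n, IsCompact (X n) := fun n =>
    Metric.isCompact_of_isClosed_isBounded (isClosed_le continuous_const (continuous_infDist_pt _))
      (hb.subset (hXU n))
  have hXm : ∀ m n, m ≤ n → X m ⊆ X n := fun m n hmn z hz =>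
    le_trans (one_div_le_one_div_of_le (by positivity : (0:ℝ) < (m:ℝ) + 1) (by
      have : (m : ℝ) ≤ n := by exact_mod_cast hmn
      linarith)) hz
  have hXp : ∀ n, IsPreconnected (X n)ᶜ := by
    intro n
    obtain ⟨q, hq⟩ := hne
    have hUX : Uᶜ ⊆ (X n)ᶜ := compl_subset_compl.2 (hXU n)
    refine isPreconnected_of_forall q fun z hz => ?_
    have hz' : infDist z Uᶜ < 1 / ((n : ℝ) + 1) := not_le.1 hz
    obtain ⟨w, hw, hzw⟩ := (infDist_lt_iff ⟨q, hq⟩).1 hz'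
    refine ⟨Uᶜ ∪ ball w (1 / ((n : ℝ) + 1)), union_subset hUX ?_, Or.inl hq, Or.inr hzw, ?_⟩
    · intro v hv
      exact not_le.2 (lt_of_le_of_lt (infDist_le_dist_of_mem hw) hv)
    · exact hc.union w hw (mem_ball_self (by positivity)) (convex_ball _ _).isPreconnected
  have hL : ∀ n, ∃ L : ℂ → ℂ, ContinuousOn L (X n) ∧ (∀ z ∈ X n, Complex.exp (L z) = g z) ∧
      (L z0 = Complex.log (g z0)) := by
    intro n
    obtain ⟨L, h1, h2⟩ := borsuk (hXc n) (hXp n) (hg.mono (hXU n)) (fun z hz => h0 z (hXU n hz))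
    by_cases hz : z0 ∈ X n
    · refine ⟨fun z => L z + (Complex.log (g z0) - L z0), h1.add continuousOn_const, fun z hz' => ?_,
        by ring⟩
      rw [Complex.exp_add, Complex.exp_sub, Complex.exp_log (h0 z0 hz0), h2 z hz', h2 z0 hz,
        div_self (h0 z0 hz0), mul_one]
    · classical
      refine ⟨Function.update L z0 (Complex.log (g z0)), h1.congr fun z hz' => ?_, fun z hz' => ?_,
        by simp⟩ <;> have : z ≠ z0 := (fun h => hz (h ▸ hz')) <;> simp [this]
      exact h2 z hz'
  choose L l1 l2 l3 using hL
  set Y : ℕ → Set ℂ := fun n => connectedComponentIn (X n) z0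
  have hYX : ∀ n, Y n ⊆ X n := fun n => connectedComponentIn_subset _ _
  have cons : ∀ m n, m ≤ n → ∀ z ∈ Y m, L m z = L n z := by
    intro m n hmn z hz
    have hz0Y : z0 ∈ Y m := by
      apply mem_connectedComponentIn
      by_contra h
      change z ∈ connectedComponentIn (X m) z0 at hz
      rw [connectedComponentIn_eq_empty h] at hz
      exact hz
    obtain ⟨k, hk⟩ := lg_diff (C := Y m) isPreconnected_connectedComponentIn
      ((l1 m).mono (hYX m)) ((l1 n).mono ((hYX m).trans (hXm m n hmn)))
      (fun w hw => (l2 m w (hYX m hw)).trans (l2 n w (hXm m n hmn (hYX m hw))).symm)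
    have e := hk z0 hz0Y
    rw [l3, l3] at e
    have e' : (k : ℂ) * (2 * Real.pi * Complex.I) = 0 := by linear_combination -e
    rw [hk z hz, e', add_zero]
  have cons' : ∀ m n, ∀ z, z ∈ Y m → z ∈ Y n → L m z = L n z := fun m n z h1 h2 => by
    rcases le_total m n with h | h
    · exact cons m n h z h1
    · exact (cons n m h z h2).symm
  have cover : ∀ z ∈ U, ∃ n, Y n ∈ 𝓝 z := by
    intro z hz
    obtain ⟨r, hr, hrU⟩ := Metric.isOpen_iff.1 hU z hz
    have hpc := (hU.isConnected_iff_isPathConnected.1 hconn)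
    obtain ⟨γ, hγ⟩ := hpc.joinedIn z0 hz0 z hz
    set K := range γ ∪ closedBall z (r / 2)
    have hK : IsCompact K := (isCompact_range γ.continuous).union (isCompact_closedBall _ _)
    have hKU : K ⊆ U := union_subset (by rintro _ ⟨t, rfl⟩; exact hγ t)
      ((closedBall_subset_ball (by linarith)).trans hrU)
    have hKc : IsPreconnected K := by
      refine IsPreconnected.union z ⟨1, by simp⟩ (mem_closedBall_self (by positivity))
        (isPreconnected_range γ.continuous) (convex_closedBall _ _).isPreconnected
    have hz0K : z0 ∈ K := Or.inl ⟨0, by simp⟩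
    obtain ⟨w, hw, hmin⟩ := hK.exists_isMinOn ⟨z0, hz0K⟩ (continuous_infDist_pt Uᶜ).continuousOn
    obtain ⟨n, hn⟩ := exists_nat_one_div_lt (hpos w (hKU hw))
    have hKX : K ⊆ X n := fun v hv => hn.le.trans (hmin hv)
    refine ⟨n, Filter.mem_of_superset (closedBall_mem_nhds z (by positivity : 0 < r / 2)) ?_⟩
    exact subset_union_right.trans (hKc.subset_connectedComponentIn hz0K hKX)
  choose! N hN using cover
  refine ⟨fun z => L (N z) z, fun z hz => ContinuousAt.continuousWithinAt ?_, fun z hz =>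
    l2 _ _ (hYX _ (mem_of_mem_nhds (hN z hz)))⟩
  have : ContinuousAt (L (N z)) z := (l1 (N z)).continuousAt (mem_of_superset (hN z hz) (hYX _))
  refine this.congr ?_
  filter_upwards [hN z hz, hU.mem_nhds hz] with w hw hwU
  exact cons' _ _ w hw (mem_of_mem_nhds (hN w hwU))

lemma LgDom.sqrt {U : Set ℂ} (hU : IsOpen U) (h : LgDom U) {g : ℂ → ℂ} (hg : DifferentiableOn ℂ g U)
    (h0 : ∀ z ∈ U, g z ≠ 0) : ∃ s : ℂ → ℂ, DifferentiableOn ℂ s U ∧ ∀ z ∈ U, s z ^ 2 = g z := by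
  obtain ⟨L, l1, l2⟩ := h g hg.continuousOn h0
  have hs : ∀ z ∈ U, Complex.exp (L z / 2) ^ 2 = g z := fun z hz => by
    rw [← Complex.exp_nat_mul, ← l2 z hz]; congr 1; push_cast; ring
  refine ⟨fun z => Complex.exp (L z / 2), fun z hz => ?_, hs⟩
  have hc : ContinuousAt (fun z => Complex.exp (L z / 2)) z :=
    (Complex.continuous_exp.comp_continuousOn (l1.div_const 2)).continuousAt (hU.mem_nhds hz)
  have hd := (hg.differentiableAt (hU.mem_nhds hz)).hasDerivAt
  rw [hasDerivAt_iff_tendsto_slope] at hd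
  have h2 : Tendsto (fun w => slope g z w / (Complex.exp (L w / 2) + Complex.exp (L z / 2)))
      (𝓝[≠] z) (𝓝 (deriv g z / (Complex.exp (L z / 2) + Complex.exp (L z / 2)))) := by
    refine hd.div ((hc.tendsto.mono_left nhdsWithin_le_nhds).add tendsto_const_nhds) ?_
    rw [← two_mul]; exact mul_ne_zero two_ne_zero (Complex.exp_ne_zero _)
  refine (HasDerivAt.differentiableAt (f' := deriv g z /
    (Complex.exp (L z / 2) + Complex.exp (L z / 2))) ?_).differentiableWithinAt
  rw [hasDerivAt_iff_tendsto_slope]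
  refine h2.congr' ?_
  have hne : ∀ᶠ w in 𝓝 z, Complex.exp (L w / 2) + Complex.exp (L z / 2) ≠ 0 := by
    refine ContinuousAt.eventually_ne (hc.fun_add continuousAt_const) ?_
    rw [← two_mul]; exact mul_ne_zero two_ne_zero (Complex.exp_ne_zero _)
  filter_upwards [nhdsWithin_le_nhds hne, nhdsWithin_le_nhds (hU.mem_nhds hz)] with w hw hwU
  rw [slope_def_field, slope_def_field, ← hs w hwU, ← hs z hz]
  by_cases hwz : w = z
  · simp [hwz]
  have := sub_ne_zero.2 hwz
  field_simp
  ring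

noncomputable def mob (w z : ℂ) : ℂ := (z - w) / (1 - (starRingEnd ℂ) w * z)

lemma mob_den {w z : ℂ} (hw : ‖w‖ < 1) (hz : ‖z‖ < 1) : 1 - (starRingEnd ℂ) w * z ≠ 0 := by
  intro h
  have h1 : (starRingEnd ℂ) w * z = 1 := (sub_eq_zero.1 h).symm
  have h2 := congrArg norm h1
  rw [norm_mul, Complex.norm_conj, norm_one] at h2
  nlinarith [norm_nonneg w, norm_nonneg z]

lemma mob_lt {w z : ℂ} (hw : ‖w‖ < 1) (hz : ‖z‖ < 1) : ‖mob w z‖ < 1 := by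
  have hd := mob_den hw hz
  rw [mob, norm_div, div_lt_one (norm_pos_iff.2 hd)]
  rw [← sq_lt_sq₀ (norm_nonneg _) (norm_nonneg _), ← Complex.normSq_eq_norm_sq,
    ← Complex.normSq_eq_norm_sq]
  have e1 : Complex.normSq w < 1 := by
    rw [Complex.normSq_eq_norm_sq]; nlinarith [norm_nonneg w]
  have e2 : Complex.normSq z < 1 := by
    rw [Complex.normSq_eq_norm_sq]; nlinarith [norm_nonneg z]
  simp only [Complex.normSq_apply] at *
  simp
  nlinarith [mul_pos (sub_pos.2 e1) (sub_pos.2 e2)]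

lemma mob_mob {w z : ℂ} (hw : ‖w‖ < 1) (hz : ‖z‖ < 1) : mob (-w) (mob w z) = z := by
  have hd := mob_den hw hz
  have hww : 1 - (starRingEnd ℂ) w * w ≠ 0 := mob_den hw hw
  simp only [mob, map_neg]
  generalize (starRingEnd ℂ) w = c at *
  have e : 1 - -c * ((z - w) / (1 - c * z)) = (1 - c * w) / (1 - c * z) := by
    rw [eq_div_iff hd, sub_mul, mul_assoc, div_mul_cancel₀ _ hd]; ring
  have e2 : (z - w) / (1 - c * z) - -w = z * (1 - c * w) / (1 - c * z) := by
    rw [eq_div_iff hd, sub_mul, div_mul_cancel₀ _ hd]; ring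
  rw [e, e2, div_div_div_cancel_right₀ hd, mul_div_cancel_right₀ _ hww]

lemma mob_diff {w : ℂ} (hw : ‖w‖ < 1) : DifferentiableOn ℂ (mob w) (ball 0 1) := by
  refine DifferentiableOn.div (by fun_prop) (by fun_prop) fun z hz => mob_den hw (by simpa using hz)

lemma montel_lim {U : Set ℂ} (hU : IsOpen U) (p : Ultrafilter ℕ) {f : ℕ → ℂ → ℂ}
    (hd : ∀ n, DifferentiableOn ℂ (f n) U) (hm : ∀ n, MapsTo (f n) U (closedBall 0 1)) :
    ∃ F : ℂ → ℂ, TendstoLocallyUniformlyOn f F (p : Filter ℕ) U := by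
  have h1 : ∀ z, ∃ w, z ∈ U → Tendsto (fun n => f n z) p (𝓝 w) := by
    intro z
    by_cases hz : z ∈ U
    · obtain ⟨w, -, hw⟩ := (isCompact_closedBall (0:ℂ) 1).ultrafilter_le_nhds' (p.map fun n => f n z)
        (by rw [Ultrafilter.mem_map]; exact Filter.univ_mem' fun n => hm n hz)
      exact ⟨w, fun _ => hw⟩
    · exact ⟨0, fun h => absurd h hz⟩
  choose F hF using h1
  refine ⟨F, ?_⟩
  rw [Metric.tendstoLocallyUniformlyOn_iff]
  intro ε hε x hx
  obtain ⟨r, hr, hrU⟩ := Metric.isOpen_iff.1 hU x hx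
  have key : ∀ n, ∀ z ∈ ball x r, dist (f n z) (f n x) ≤ 2 / r * dist z x := fun n z hz =>
    Complex.dist_le_div_mul_dist_of_mapsTo_ball ((hd n).mono hrU) (fun w hw => by
      have h1 := hm n (hrU hw)
      have h2 := hm n hx
      rw [mem_closedBall, dist_eq_norm, sub_zero] at h1 h2
      rw [mem_closedBall, dist_eq_norm]
      calc _ ≤ ‖f n w‖ + ‖f n x‖ := norm_sub_le _ _
        _ ≤ 2 := by linarith) hz
  have keyF : ∀ z ∈ ball x r, dist (F z) (F x) ≤ 2 / r * dist z x := fun z hz =>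
    le_of_tendsto ((hF z (hrU hz)).dist (hF x hx)) (Eventually.of_forall fun n => key n z hz)
  set δ := min r (ε * r / 8)
  have hδ : 0 < δ := by positivity
  refine ⟨ball x δ, mem_nhdsWithin_of_mem_nhds (ball_mem_nhds _ hδ), ?_⟩
  filter_upwards [(Metric.tendsto_nhds.1 (hF x hx)) (ε/4) (by positivity)] with n hn y hy
  have hyr : y ∈ ball x r := ball_subset_ball (min_le_left _ _) hy
  have hyd : dist y x < ε * r / 8 := lt_of_lt_of_le hy (min_le_right _ _)
  have e1 : 2 / r * dist y x ≤ ε / 4 := by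
    calc 2 / r * dist y x ≤ 2 / r * (ε * r / 8) := by gcongr
      _ = ε / 4 := by field_simp; ring
  have t1 := key n y hyr
  have t2 := keyF y hyr
  have t3 := dist_triangle4 (F y) (F x) (f n x) (f n y)
  rw [dist_comm (F x), dist_comm (f n x) (f n y)] at t3
  linarith

lemma iso_val {U : Set ℂ} (hU : IsOpen U) (hc : IsPreconnected U) {F : ℂ → ℂ}
    (hF : DifferentiableOn ℂ F U) {p q : ℂ} (hp : p ∈ U) (hq : q ∈ U) (hpq : F p ≠ F q)
    {a : ℂ} (ha : a ∈ U) : ∀ᶠ z in 𝓝[≠] a, F z ≠ F a := by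
  have hA : AnalyticOnNhd ℂ F U := hF.analyticOnNhd hU
  rcases (hA.sub (analyticOnNhd_const (v := F a)) a ha).eventually_eq_zero_or_eventually_ne_zero
    with h | h
  · exfalso
    have := hA.eqOn_of_preconnected_of_eventuallyEq (analyticOnNhd_const (v := F a)) hc ha
      (by filter_upwards [h] with z hz; exact sub_eq_zero.1 hz)
    exact hpq ((this hp).trans (this hq).symm)
  · filter_upwards [h] with z hz h'
    exact hz (sub_eq_zero.2 h')

lemma hurwitz {U : Set ℂ} (hU : IsOpen U) (hc : IsPreconnected U) (p : Ultrafilter ℕ)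
    {f : ℕ → ℂ → ℂ} {F : ℂ → ℂ}
    (hd : ∀ n, DifferentiableOn ℂ (f n) U) (hi : ∀ n, InjOn (f n) U)
    (hF : TendstoLocallyUniformlyOn f F (p : Filter ℕ) U)
    {z0 z1 : ℂ} (hz0 : z0 ∈ U) (hz1 : z1 ∈ U) (hne : F z0 ≠ F z1) : InjOn F U := by
  have hFd : DifferentiableOn ℂ F U := hF.differentiableOn (Eventually.of_forall hd) hU
  intro a ha b hb hab
  by_contra hne'
  have hiso := iso_val hU hc hFd hz0 hz1 hne ha
  rw [eventually_nhdsWithin_iff] at hiso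
  have hb' : ∀ᶠ z in 𝓝 a, z ≠ b := (isOpen_ne.mem_nhds hne')
  obtain ⟨r, hr, hrs⟩ := Metric.nhds_basis_closedBall.mem_iff.1
    (hiso.and (hb'.and (hU.mem_nhds ha)))
  have hrU : closedBall a r ⊆ U := fun z hz => (hrs hz).2.2
  have hsph : ∀ z ∈ sphere a r, F z ≠ F a := fun z hz =>
    (hrs (sphere_subset_closedBall hz)).1 (ne_of_mem_sphere hz hr.ne')
  obtain ⟨w, hw, hwm⟩ := (isCompact_sphere a r).exists_isMinOn (NormedSpace.sphere_nonempty.2 hr.le)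
    (f := fun z => ‖F z - F a‖)
    ((hFd.continuousOn.mono (sphere_subset_closedBall.trans hrU)).sub continuousOn_const).norm
  set ε := ‖F w - F a‖ with hεd
  have hε : 0 < ε := norm_pos_iff.2 (sub_ne_zero.2 (hsph w hw))
  have hK : IsCompact (closedBall a r ∪ {b}) := (isCompact_closedBall a r).union isCompact_singleton
  have hu := (tendstoLocallyUniformlyOn_iff_forall_isCompact hU).1 hF _
    (union_subset hrU (singleton_subset_iff.2 hb)) hK
  obtain ⟨n, hn⟩ := (Metric.tendstoUniformlyOn_iff.1 hu (ε/8) (by positivity)).exists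
  have hna : dist (F a) (f n a) < ε/8 := hn a (Or.inl (mem_closedBall_self hr.le))
  have hnb : dist (F b) (f n b) < ε/8 := hn b (Or.inr rfl)
  have hsub := DiffContOnCl.ball_subset_image_closedBall (f := f n) (z₀ := a) (r := r) (ε := ε/2)
    (((hd n).mono hrU).diffContOnCl_ball subset_rfl) hr
    (fun z hz => by
      have h1 := hn z (Or.inl (sphere_subset_closedBall hz))
      have h2 : ε ≤ ‖F z - F a‖ := hwm hz
      have := dist_triangle4 (F z) (f n z) (f n a) (F a)
      rw [dist_comm (f n a) (F a), dist_eq_norm (F z) (F a), dist_eq_norm (f n z)] at this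
      linarith)
    (by
      have h1 : ∀ᶠ z in 𝓝[≠] a, z ∈ U := eventually_nhdsWithin_of_eventually_nhds (hU.mem_nhds ha)
      have h3 : ∀ᶠ z in 𝓝[≠] a, z ≠ a := self_mem_nhdsWithin
      have h2 : ∃ᶠ z in 𝓝[≠] a, f n z ≠ f n a :=
        (h1.and h3).frequently.mono fun z hz h => hz.2 ((hi n) hz.1 ha h)
      exact h2.filter_mono nhdsWithin_le_nhds)
  have hfb : f n b ∈ ball (f n a) (ε / 2 / 2) := by
    rw [mem_ball]
    have := dist_triangle_left (f n b) (f n a) (F a)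
    rw [← hab] at hnb
    linarith
  obtain ⟨z, hz, hzb⟩ := hsub hfb
  exact (hrs hz).2.1 (hi n (hrU hz) hb hzb)

def RMc (U : Set ℂ) (z0 : ℂ) (f : ℂ → ℂ) : Prop :=
  DifferentiableOn ℂ f U ∧ InjOn f U ∧ MapsTo f U (ball 0 1) ∧ f z0 = 0

lemma mob_self (w : ℂ) : mob w w = 0 := by simp [mob]

lemma mob_inj {w : ℂ} (hw : ‖w‖ < 1) : InjOn (mob w) (ball 0 1) := fun a ha b hb h => by
  rw [← mob_mob (z := a) hw (by simpa using ha), h, mob_mob hw (by simpa using hb)]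

lemma koebe {U : Set ℂ} (hU : IsOpen U) (hL : LgDom U) {z0 z1 : ℂ} (hz0 : z0 ∈ U) (hz1 : z1 ∈ U)
    (hne : z1 ≠ z0) {F : ℂ → ℂ} (hF : RMc U z0 F) {w : ℂ} (hw : ‖w‖ < 1) (hwF : w ∉ F '' U) :
    ∃ g, RMc U z0 g ∧ ‖F z1‖ < ‖g z1‖ := by
  obtain ⟨Fd, Fi, Fm, F0⟩ := hF
  have Fm' : ∀ z ∈ U, ‖F z‖ < 1 := fun z hz => by simpa using Fm hz
  have mm : MapsTo (mob w) (ball 0 1) (ball 0 1) := fun z hz => by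
    simpa using mob_lt hw (by simpa using hz)
  obtain ⟨s, sd, hs⟩ := hL.sqrt hU (g := fun z => mob w (F z)) ((mob_diff hw).comp Fd Fm)
    (fun z hz h => hwF ⟨z, hz, mob_inj hw (Fm hz) (by simpa using hw) (by rw [h, mob_self])⟩)
  have s1 : ∀ z ∈ U, ‖s z‖ < 1 := fun z hz => by
    have h1 : ‖mob w (F z)‖ < 1 := mob_lt hw (Fm' z hz)
    rw [← hs z hz, norm_pow] at h1
    exact (sq_lt_one_iff₀ (norm_nonneg _)).1 h1
  have hc := s1 z0 hz0
  set c := s z0 with hcd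
  have hc' : ‖-c‖ < 1 := by simpa using hc
  have hw' : ‖-w‖ < 1 := by simpa using hw
  have smap : MapsTo s U (ball 0 1) := fun z hz => by simpa using s1 z hz
  have si : InjOn s U := fun a ha b hb h =>
    Fi ha hb (mob_inj hw (Fm ha) (Fm hb) (by rw [← hs a ha, ← hs b hb, h]))
  set g : ℂ → ℂ := fun z => mob c (s z) with hg
  have gR : RMc U z0 g := ⟨(mob_diff hc).comp sd smap, fun a ha b hb h =>
    si ha hb (mob_inj hc (smap ha) (smap hb) h), fun z hz => by
      simpa using mob_lt hc (s1 z hz), mob_self _⟩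
  refine ⟨g, gR, ?_⟩
  set h : ℂ → ℂ := fun u => mob (-w) ((mob (-c) u) ^ 2) with hh
  have hsq : ∀ u, ‖u‖ < 1 → ‖(mob (-c) u) ^ 2‖ < 1 := fun u hu => by
    rw [norm_pow]; exact (sq_lt_one_iff₀ (norm_nonneg _)).2 (mob_lt hc' hu)
  have hd : DifferentiableOn ℂ h (ball 0 1) :=
    (mob_diff hw').comp ((mob_diff hc').pow 2) fun u hu => by
      simpa using hsq u (by simpa using hu)
  have hm : MapsTo h (ball 0 1) (closedBall 0 1) := fun u hu => by
    have := mob_lt hw' (hsq u (by simpa using hu))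
    simpa using this.le
  have hg' : ∀ z ∈ U, h (g z) = F z := fun z hz => by
    simp only [hh, hg]
    rw [mob_mob hc (s1 z hz), hs z hz, mob_mob hw (Fm' z hz)]
  have h0 : h 0 = 0 := by
    have := hg' z0 hz0
    rwa [gR.2.2.2, F0] at this
  have g1 : ‖g z1‖ < 1 := mob_lt hc (s1 z1 hz1)
  have g1' : g z1 ≠ 0 := fun h => hne (gR.2.1 hz1 hz0 (by rw [h, gR.2.2.2]))
  have hle : ‖F z1‖ ≤ ‖g z1‖ := by
    rw [← hg' z1 hz1]
    exact Complex.norm_le_norm_of_mapsTo_ball hd hm h0 g1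
  refine lt_of_le_of_ne hle fun heq => ?_
  have haff := Complex.affine_of_mapsTo_ball_of_norm_dslope_eq_div (z₀ := g z1) hd (by rwa [h0])
    (by simpa using g1) (by
      rw [dslope_of_ne _ g1', slope_def_field, h0, sub_zero, sub_zero, norm_div, hg' z1 hz1, heq,
        div_self (norm_ne_zero_iff.2 g1'), div_one])
  set C := dslope h 0 (g z1) with hC
  have hC0 : C ≠ 0 := by
    rw [hC, dslope_of_ne _ g1', slope_def_field, h0, sub_zero, sub_zero, hg' z1 hz1]
    refine div_ne_zero ?_ g1'
    rw [← norm_ne_zero_iff, heq, norm_ne_zero_iff]; exact g1'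
  have ht : ‖(1/2 : ℂ)‖ < 1 := by norm_num
  have ht' : ‖(-1/2 : ℂ)‖ < 1 := by norm_num
  have e1 : h (mob c (1/2)) = h (mob c (-1/2)) := by
    simp only [hh]
    rw [mob_mob hc ht, mob_mob hc ht']; norm_num
  have m1 : mob c (1/2) ∈ ball (0:ℂ) 1 := by simpa using mob_lt hc ht
  have m2 : mob c (-1/2) ∈ ball (0:ℂ) 1 := by simpa using mob_lt hc ht'
  rw [haff m1, haff m2] at e1
  simp only [sub_zero, smul_eq_mul, add_right_inj] at e1
  have := mob_inj hc (by simpa using ht) (by simpa using ht') (mul_right_cancel₀ hC0 e1)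
  norm_num at this

theorem rmt {U : Set ℂ} (hU : IsOpen U) (hb : Bornology.IsBounded U) (hconn : IsConnected U)
    (hL : LgDom U) : ∃ φ : ℂ → ℂ, DifferentiableOn ℂ φ U ∧ InjOn φ U ∧ φ '' U = ball 0 1 := by
  obtain ⟨z0, hz0⟩ := hconn.nonempty
  obtain ⟨r, hr, hrU⟩ := Metric.isOpen_iff.1 hU z0 hz0
  obtain ⟨z1, hz1, hne⟩ : ∃ z1 ∈ U, z1 ≠ z0 := ⟨z0 + (r/2 : ℝ), hrU (by
    simp [abs_of_pos hr, hr]), by simp [hr.ne']⟩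
  set S : Set ℝ := {x | ∃ f, RMc U z0 f ∧ ‖f z1‖ = x}
  have hSb : BddAbove S := ⟨1, by
    rintro x ⟨f, hf, rfl⟩
    have := hf.2.2.1 hz1
    simp at this; exact this.le⟩
  obtain ⟨R, hR0, hR⟩ := hb.subset_ball_lt 0 z0
  set f0 : ℂ → ℂ := fun z => (z - z0) / R
  have hRc : (R : ℂ) ≠ 0 := by exact_mod_cast hR0.ne'
  have hf0 : RMc U z0 f0 := by
    refine ⟨by fun_prop, fun a _ b _ h => ?_, fun z hz => ?_, by simp [f0]⟩
    · have : a - z0 = b - z0 := by simpa [f0, hRc] using h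
      simpa using this
    · have := hR hz
      rw [mem_ball, dist_eq_norm] at this
      simp only [f0, mem_ball, dist_zero_right, norm_div, Complex.norm_real, Real.norm_eq_abs,
        abs_of_pos hR0]
      rwa [div_lt_one hR0]
  have hSne : S.Nonempty := ⟨_, f0, hf0, rfl⟩
  have hM : 0 < sSup S := lt_of_lt_of_le (norm_pos_iff.2 (by
    simp [f0, hRc, sub_ne_zero.2 hne])) (le_csSup hSb ⟨f0, hf0, rfl⟩)
  obtain ⟨u, -, hu, huS⟩ := exists_seq_tendsto_sSup hSne hSb
  choose f hf hfu using huS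
  set p : Ultrafilter ℕ := hyperfilter ℕ
  obtain ⟨F, hF⟩ := montel_lim hU p (f := f) (fun n => (hf n).1)
    (fun n z hz => ball_subset_closedBall ((hf n).2.2.1 hz))
  have hpt : ∀ z ∈ U, Tendsto (fun n => f n z) p (𝓝 (F z)) := fun z hz => hF.tendsto_at hz
  have hF0 : F z0 = 0 := tendsto_nhds_unique (hpt z0 hz0)
    (by simp only [(hf _).2.2.2]; exact tendsto_const_nhds)
  have hp : (p : Filter ℕ) ≤ atTop := by
    rw [← Nat.cofinite_eq_atTop]; exact hyperfilter_le_cofinite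
  have hF1 : ‖F z1‖ = sSup S := tendsto_nhds_unique (hpt z1 hz1).norm
    (by simp only [hfu]; exact hu.mono_left hp)
  have hFne : F z0 ≠ F z1 := by
    rw [hF0]; intro h; rw [← h, norm_zero] at hF1; linarith
  have hFd : DifferentiableOn ℂ F U := hF.differentiableOn (Eventually.of_forall fun n => (hf n).1) hU
  have hFi := hurwitz hU hconn.isPreconnected p (fun n => (hf n).1) (fun n => (hf n).2.1) hF hz0 hz1
    hFne
  have hFc : MapsTo F U (closedBall 0 1) := fun z hz =>
    isClosed_closedBall.mem_of_tendsto (hpt z hz)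
      (Eventually.of_forall fun n => ball_subset_closedBall ((hf n).2.2.1 hz))
  have hop : IsOpen (F '' U) := by
    rcases (hFd.analyticOnNhd hU).is_constant_or_isOpen hconn.isPreconnected with ⟨w, hw⟩ | h
    · exact absurd ((hw z0 hz0).trans (hw z1 hz1).symm) hFne
    · exact h U subset_rfl hU
  have hFm : MapsTo F U (ball 0 1) := fun z hz => by
    have : F '' U ⊆ interior (closedBall 0 1) := interior_maximal hFc.image_subset hop
    rw [interior_closedBall _ one_ne_zero] at this
    exact this ⟨z, hz, rfl⟩
  have hFR : RMc U z0 F := ⟨hFd, hFi, hFm, hF0⟩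
  refine ⟨F, hFd, hFi, Subset.antisymm hFm.image_subset fun w hw => ?_⟩
  by_contra hwF
  obtain ⟨g, hg, hlt⟩ := koebe hU hL hz0 hz1 hne hFR (by simpa using hw) hwF
  have := le_csSup hSb ⟨g, hg, rfl⟩
  linarith

theorem holo_inv {U : Set ℂ} (hU : IsOpen U) (hconn : IsPreconnected U) {φ : ℂ → ℂ}
    (hd : DifferentiableOn ℂ φ U) (hi : InjOn φ U) : ∃ f : ℂ → ℂ,
    DifferentiableOn ℂ f (φ '' U) ∧ (∀ z ∈ U, f (φ z) = z) := by
  rcases U.subsingleton_or_nontrivial with hs | hnt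
  · rcases U.eq_empty_or_nonempty with rfl | ⟨z, hz⟩
    · exact ⟨id, differentiableOn_id, by simp⟩
    · exact ⟨fun _ => z, differentiableOn_const _, fun x hx => hs hz hx⟩
  obtain ⟨p, hp, q, hq, hpq⟩ := hnt
  have hA := hd.analyticOnNhd hU
  have hφpq : φ p ≠ φ q := fun h => hpq (hi hp hq h)
  have hop : ∀ V ⊆ U, IsOpen V → IsOpen (φ '' V) := by
    rcases hA.is_constant_or_isOpen hconn with ⟨w, hw⟩ | h
    · exact absurd ((hw p hp).trans (hw q hq).symm) hφpq
    · exact h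
  set f := Function.invFunOn φ U with hf
  have hfl : ∀ z ∈ U, f (φ z) = z := fun z hz => hi.leftInvOn_invFunOn hz
  have hfc : ∀ z ∈ U, ContinuousAt f (φ z) := by
    intro z hz V hV
    rw [hfl z hz] at hV
    obtain ⟨W, hWV, hWo, hzW⟩ := _root_.mem_nhds_iff.1 (inter_mem hV (hU.mem_nhds hz))
    refine mem_map.2 (mem_of_superset ((hop W (fun x hx => (hWV hx).2) hWo).mem_nhds ⟨z, hzW, rfl⟩) ?_)
    rintro _ ⟨x, hx, rfl⟩
    rw [mem_preimage, hfl x (hWV hx).2]; exact (hWV hx).1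
  have hd1 : ∀ z ∈ U, deriv φ z ≠ 0 → DifferentiableAt ℂ f (φ z) := by
    intro z hz h0
    refine (HasDerivAt.of_local_left_inverse (f := φ) (f' := deriv φ z) (hfc z hz) ?_ h0 ?_).differentiableAt
    · rw [hfl z hz]; exact (hd.differentiableAt (hU.mem_nhds hz)).hasDerivAt
    · filter_upwards [(hop U subset_rfl hU).mem_nhds ⟨z, hz, rfl⟩]
      rintro _ ⟨x, hx, rfl⟩
      rw [hfl x hx]
  refine ⟨f, ?_, hfl⟩
  rintro _ ⟨z, hz, rfl⟩
  apply DifferentiableAt.differentiableWithinAt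
  have hdA : AnalyticOnNhd ℂ (deriv φ) U := hA.deriv
  rcases (hdA z hz).eventually_eq_zero_or_eventually_ne_zero with h | h
  · exfalso
    obtain ⟨r, hr, hrs⟩ := Metric.mem_nhds_iff.1 (inter_mem h (hU.mem_nhds hz))
    have hy : z + (r/2 : ℝ) ∈ ball z r := by simp [abs_of_pos hr, hr]
    have hcon := (convex_ball z r).is_const_of_fderivWithin_eq_zero (𝕜 := ℂ)
      (hd.mono fun x hx => (hrs hx).2) (fun x hx => by
        rw [fderivWithin_of_isOpen isOpen_ball hx]
        have : deriv φ x = 0 := (hrs hx).1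
        exact ContinuousLinearMap.ext_ring (by simpa using this))
      (mem_ball_self hr) hy
    have := hi hz (hrs hy).2 hcon
    simp [hr.ne'] at this
  · rw [eventually_nhdsWithin_iff] at h
    obtain ⟨W, hWV, hWo, hzW⟩ := _root_.mem_nhds_iff.1 (inter_mem h (hU.mem_nhds hz))
    have hWU : W ⊆ U := fun x hx => (hWV hx).2
    have hφW := hop W hWU hWo
    have := (Complex.differentiableOn_compl_singleton_and_continuousAt_iff (f := f)
      (hφW.mem_nhds ⟨z, hzW, rfl⟩)).1 ⟨?_, hfc z hz⟩
    · exact this.differentiableAt (hφW.mem_nhds ⟨z, hzW, rfl⟩)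
    · rintro _ ⟨⟨x, hx, rfl⟩, hxz⟩
      exact (hd1 x (hWU hx) ((hWV hx).1 fun h => hxz (by rw [mem_singleton_iff.1 h]; rfl))).differentiableWithinAt

lemma area_eq {Ω : Set ℂ} (hΩ : IsOpen Ω) {g : ℂ → ℂ} (hg : DifferentiableOn ℂ g Ω)
    (hi : InjOn g Ω) :
    ∫⁻ w in Ω, ENNReal.ofReal (‖deriv g w‖ ^ 2) = MeasureTheory.volume (g '' Ω) := by
  rw [← MeasureTheory.lintegral_abs_det_fderiv_eq_addHaar_image MeasureTheory.volume
    (f' := fun w => (ContinuousLinearMap.toSpanSingleton ℂ (deriv g w)).restrictScalars ℝ)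
    hΩ.measurableSet (fun w hw => by
      have := (hg.differentiableAt (hΩ.mem_nhds hw)).hasDerivAt.hasFDerivAt.restrictScalars ℝ
      exact this.hasFDerivWithinAt) hi]
  refine MeasureTheory.lintegral_congr fun w => ?_
  congr 1
  have : ((ContinuousLinearMap.toSpanSingleton ℂ (deriv g w)).restrictScalars ℝ).det
      = Algebra.norm ℝ (deriv g w) := by
    rw [ContinuousLinearMap.det, Algebra.norm_apply]
    congr 1
    ext
    simp [mul_comm]
  rw [this, Algebra.norm_complex_apply, Complex.normSq_eq_norm_sq, abs_of_nonneg (by positivity)]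

lemma area_iter {Ω : Set ℂ} (hΩ : IsOpen Ω) (g : ℂ → ℂ) :
    ∫⁻ w in Ω, ENNReal.ofReal (‖deriv g w‖ ^ 2) =
    ∫⁻ s : ℝ, ∫⁻ t : ℝ, Ω.indicator (fun w => ENNReal.ofReal (‖deriv g w‖ ^ 2)) ⟨s, t⟩ := by
  rw [← MeasureTheory.lintegral_indicator hΩ.measurableSet]
  have hm : Measurable (Ω.indicator (fun w => ENNReal.ofReal (‖deriv g w‖ ^ 2))) :=
    ((measurable_deriv g).norm.pow_const 2).ennreal_ofReal.indicator hΩ.measurableSet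
  rw [← (Complex.volume_preserving_equiv_real_prod.symm).lintegral_comp hm,
    MeasureTheory.Measure.volume_eq_prod, MeasureTheory.lintegral_prod]
  · rfl
  · exact (hm.comp Complex.measurableEquivRealProd.symm.measurable).aemeasurable

lemma col_bound {Ω : Set ℂ} (hΩ : IsOpen Ω) {g : ℂ → ℂ} (hg : DifferentiableOn ℂ g Ω) {s a b ε : ℝ}
    (hab : a ≤ b) (hbπ : b - a ≤ Real.pi) (hε : 0 < ε)
    (hin : ∀ t ∈ Icc a b, (⟨s, t⟩ : ℂ) ∈ Ω) (he : ε ≤ ‖g ⟨s, b⟩ - g ⟨s, a⟩‖) :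
    ENNReal.ofReal (ε ^ 2 / Real.pi) ≤
      ∫⁻ t : ℝ, Ω.indicator (fun w => ENNReal.ofReal (‖deriv g w‖ ^ 2)) ⟨s, t⟩ := by
  have hpi := Real.pi_pos
  set x : ℝ → ℝ := fun t => ‖deriv g ⟨s, t⟩‖ with hx
  have hmk : ∀ t : ℝ, (⟨s, t⟩ : ℂ) = s + t * Complex.I := fun t => by
    apply Complex.ext <;> simp
  have hmkc : Continuous fun t : ℝ => (⟨s, t⟩ : ℂ) := by
    simp only [hmk]; fun_prop
  have hdc : ContinuousOn (deriv g) Ω := (hg.deriv hΩ).continuousOn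
  have hdc' : ContinuousOn (fun t : ℝ => deriv g ⟨s, t⟩) (Icc a b) := hdc.comp hmkc.continuousOn hin
  have xc : ContinuousOn x (Icc a b) := hdc'.norm
  have hder : ∀ t ∈ uIcc a b, HasDerivAt (fun t : ℝ => g ⟨s, t⟩) (deriv g ⟨s, t⟩ * Complex.I) t := by
    intro t ht
    rw [uIcc_of_le hab] at ht
    have h1 : HasDerivAt (fun t : ℝ => (⟨s, t⟩ : ℂ)) Complex.I t := by
      simp only [hmk]
      simpa using ((Complex.ofRealCLM.hasDerivAt (x := t)).mul_const Complex.I).const_add (s : ℂ)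
    exact (hg.differentiableAt (hΩ.mem_nhds (hin t ht))).hasDerivAt.comp t h1
  have hint : IntervalIntegrable (fun t : ℝ => deriv g ⟨s, t⟩ * Complex.I) MeasureTheory.volume a b :=
    ContinuousOn.intervalIntegrable (by
      rw [uIcc_of_le hab]; exact hdc'.mul continuousOn_const)
  have h1 : ε ≤ ∫ t in a..b, x t := by
    refine he.trans ?_
    rw [← intervalIntegral.integral_eq_sub_of_hasDerivAt hder hint]
    refine (intervalIntegral.norm_integral_le_integral_norm hab).trans_eq ?_
    simp [hx]
  have xi : IntervalIntegrable x MeasureTheory.volume a b :=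
    ContinuousOn.intervalIntegrable (by rwa [uIcc_of_le hab])
  have xi2 : IntervalIntegrable (fun t => x t ^ 2) MeasureTheory.volume a b :=
    ContinuousOn.intervalIntegrable (by rw [uIcc_of_le hab]; exact xc.pow 2)
  set c := ε / Real.pi with hc
  have h2 : ε ^ 2 / Real.pi ≤ ∫ t in a..b, x t ^ 2 := by
    have : ∫ t in a..b, (2 * c * x t - c ^ 2) ≤ ∫ t in a..b, x t ^ 2 :=
      intervalIntegral.integral_mono_on hab ((xi.const_mul _).sub intervalIntegrable_const) xi2
        fun t _ => by nlinarith [sq_nonneg (x t - c)]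
    rw [intervalIntegral.integral_sub (xi.const_mul _) intervalIntegrable_const,
      intervalIntegral.integral_const_mul, intervalIntegral.integral_const, smul_eq_mul] at this
    have h3 : 2 * c * ε ≤ 2 * c * ∫ t in a..b, x t := by gcongr
    have h4 : (b - a) * c ^ 2 ≤ Real.pi * c ^ 2 := by gcongr
    have h5 : 2 * c * ε - Real.pi * c ^ 2 = ε ^ 2 / Real.pi := by rw [hc]; field_simp; ring
    linarith
  calc ENNReal.ofReal (ε ^ 2 / Real.pi) ≤ ENNReal.ofReal (∫ t in a..b, x t ^ 2) :=
        ENNReal.ofReal_le_ofReal h2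
    _ = ∫⁻ t in Ioc a b, ENNReal.ofReal (x t ^ 2) := by
        rw [intervalIntegral.integral_of_le hab]
        exact MeasureTheory.ofReal_integral_eq_lintegral_ofReal xi2.1
          (Eventually.of_forall fun t => by positivity)
    _ = ∫⁻ t, (Ioc a b).indicator (fun t => ENNReal.ofReal (x t ^ 2)) t := by
        rw [MeasureTheory.lintegral_indicator measurableSet_Ioc]
    _ ≤ _ := by
        refine MeasureTheory.lintegral_mono fun t => ?_
        by_cases ht : t ∈ Ioc a b
        · rw [indicator_of_mem ht, indicator_of_mem (hin t (Ioc_subset_Icc_self ht))]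
        · rw [indicator_of_notMem ht]; exact zero_le

lemma log_coord {ζ : ℂ} (hζ : ‖ζ‖ = 1) {s : ℝ} {z : ℂ} (hz : ‖z‖ < 1)
    (hzs : dist z ζ = Real.exp s) :
    ∃ t : ℝ, |t| < Real.pi / 2 ∧ z = ζ * (1 - Complex.exp ⟨s, t⟩) := by
  have hζ0 : ζ ≠ 0 := by rintro rfl; simp at hζ
  set u := 1 - z / ζ with hu
  have hzu : z = ζ * (1 - u) := by rw [hu]; field_simp; ring
  have hun : ‖u‖ = Real.exp s := by
    rw [← hzs, dist_comm, dist_eq_norm]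
    rw [hzu, ← mul_one_sub, sub_sub_cancel, norm_mul, hζ, one_mul]
  have hu0 : u ≠ 0 := by rw [← norm_ne_zero_iff, hun]; positivity
  have h1u : ‖1 - u‖ < 1 := by rwa [hzu, norm_mul, hζ, one_mul] at hz
  have hre : 0 < u.re := by
    have := (Complex.abs_re_le_norm (1 - u)).trans_lt h1u
    rw [abs_lt] at this
    simp at this; linarith
  refine ⟨u.arg, Complex.abs_arg_lt_pi_div_two_iff.2 (Or.inl hre), ?_⟩
  have : (⟨s, u.arg⟩ : ℂ) = Complex.log u := by
    apply Complex.ext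
    · rw [Complex.log_re, hun, Real.log_exp]
    · rw [Complex.log_im]
  rw [this, Complex.exp_log hu0]
  exact hzu

lemma log_norm {ζ : ℂ} (hζ : ‖ζ‖ = 1) {s t : ℝ} :
    ‖ζ * (1 - Complex.exp ⟨s, t⟩)‖ < 1 ↔ Real.exp s < 2 * Real.cos t := by
  rw [norm_mul, hζ, one_mul, ← sq_lt_one_iff₀ (norm_nonneg _), ← Complex.normSq_eq_norm_sq,
    Complex.normSq_apply]
  simp only [Complex.sub_re, Complex.sub_im, Complex.one_re, Complex.one_im, Complex.exp_re,
    Complex.exp_im]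
  have h := Real.exp_pos s
  have e : (1 - Real.exp s * Real.cos t) * (1 - Real.exp s * Real.cos t) +
      (0 - Real.exp s * Real.sin t) * (0 - Real.exp s * Real.sin t) =
      1 + Real.exp s * (Real.exp s - 2 * Real.cos t) := by
    linear_combination (Real.exp s) ^ 2 * Real.sin_sq_add_cos_sq t
  rw [e]
  constructor
  · intro h1; by_contra h2
    nlinarith
  · intro h1; nlinarith

lemma length_area {f : ℂ → ℂ} (hf : DifferentiableOn ℂ f (ball 0 1)) (hi : InjOn f (ball 0 1))
    (hb : Bornology.IsBounded (f '' ball 0 1)) {ζ : ℂ} (hζ : ‖ζ‖ = 1) {ε δ : ℝ} (hε : 0 < ε)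
    (hδ : 0 < δ) : ∃ ρ, 0 < ρ ∧ ρ < δ ∧ ∀ z ∈ ball (0:ℂ) 1, ∀ z' ∈ ball (0:ℂ) 1, dist z ζ = ρ →
      dist z' ζ = ρ → ‖f z - f z'‖ ≤ ε := by
  by_contra! hcon
  have hπ := Real.pi_pos
  have hζ0 : ζ ≠ 0 := by rintro rfl; simp at hζ
  have hV : MeasureTheory.volume (f '' ball 0 1) < ⊤ := hb.measure_lt_top
  set V := (MeasureTheory.volume (f '' ball 0 1)).toReal with hVd
  set L : ℝ := max (max 0 (-Real.log δ)) (V * Real.pi / ε ^ 2) + 1 with hL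
  have hL0 : 0 ≤ max (max 0 (-Real.log δ)) (V * Real.pi / ε ^ 2) := (le_max_left _ _).trans
    (le_max_left _ _) |>.trans' le_rfl
  have hLδ : -Real.log δ < L := lt_of_le_of_lt ((le_max_right _ _).trans (le_max_left _ _)) (lt_add_one _)
  have hLV : V * Real.pi / ε ^ 2 < L := lt_of_le_of_lt (le_max_right _ _) (lt_add_one _)
  set m : ℂ → ℂ := fun w => ζ * (1 - Complex.exp w) with hm
  have hmd : Differentiable ℂ m := by fun_prop
  set Ω : Set ℂ := {w | |w.im| < Real.pi / 2} ∩ m ⁻¹' ball 0 1 with hΩ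
  have hΩo : IsOpen Ω := (isOpen_lt (by fun_prop) continuous_const).inter
    (isOpen_ball.preimage hmd.continuous)
  have hmi : InjOn m Ω := by
    intro w hw w' hw' h
    have h1 : Complex.exp w = Complex.exp w' := by
      have := mul_left_cancel₀ hζ0 h
      simpa using this
    have h2 : _ ∧ _ := abs_lt.1 (show |w.im| < _ from hw.1)
    have h3 : _ ∧ _ := abs_lt.1 (show |w'.im| < _ from hw'.1)
    exact Complex.exp_inj_of_neg_pi_lt_of_le_pi (by linarith) (by linarith) (by linarith)
      (by linarith) h1
  set g := f ∘ m
  have hg : DifferentiableOn ℂ g Ω := hf.comp hmd.differentiableOn fun w hw => hw.2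
  have hgi : InjOn g Ω := hi.comp hmi fun w hw => hw.2
  have hA := area_eq hΩo hg hgi
  rw [area_iter hΩo] at hA
  have hle : MeasureTheory.volume (g '' Ω) ≤ ENNReal.ofReal V := by
    rw [hVd, ENNReal.ofReal_toReal hV.ne]
    refine MeasureTheory.measure_mono ?_
    rintro _ ⟨w, hw, rfl⟩
    exact ⟨m w, hw.2, rfl⟩
  have hcol : ∀ s ∈ Ioo (-(2 * L)) (-L), ENNReal.ofReal (ε ^ 2 / Real.pi) ≤
      ∫⁻ t : ℝ, Ω.indicator (fun w => ENNReal.ofReal (‖deriv g w‖ ^ 2)) ⟨s, t⟩ := by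
    intro s hs
    obtain ⟨z, hz, z', hz', hzs, hzs', hlt⟩ := hcon (Real.exp s) (Real.exp_pos _) (by
      rw [← Real.exp_log hδ, Real.exp_lt_exp]; linarith [hs.2])
    have key : ∀ a b : ℝ, |a| < Real.pi / 2 → |b| < Real.pi / 2 → a ≤ b →
        ‖m ⟨s, a⟩‖ < 1 → ‖m ⟨s, b⟩‖ < 1 → ε ≤ ‖g ⟨s, b⟩ - g ⟨s, a⟩‖ →
        ENNReal.ofReal (ε ^ 2 / Real.pi) ≤
      ∫⁻ t : ℝ, Ω.indicator (fun w => ENNReal.ofReal (‖deriv g w‖ ^ 2)) ⟨s, t⟩ := by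
      intro a b ha hb hab hma hmb he
      refine col_bound hΩo hg hab ?_ hε ?_ he
      · have := abs_lt.1 ha; have := abs_lt.1 hb; linarith
      · intro t ht
        have ha' := abs_lt.1 ha
        have hb' := abs_lt.1 hb
        have hma' := (log_norm hζ).1 hma
        have hmb' := (log_norm hζ).1 hmb
        refine ⟨show |t| < _ from abs_lt.2 ⟨by linarith [ht.1], by linarith [ht.2]⟩, ?_⟩
        rw [mem_preimage, mem_ball, dist_zero_right]
        refine (log_norm hζ).2 ?_
        rcases le_total 0 t with h0 | h0
        · have : Real.cos b ≤ Real.cos t := Real.cos_le_cos_of_nonneg_of_le_pi h0 (by linarith) ht.2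
          linarith
        · have : Real.cos a ≤ Real.cos t := by
            rw [← Real.cos_neg a, ← Real.cos_neg t]
            exact Real.cos_le_cos_of_nonneg_of_le_pi (by linarith) (by linarith) (by linarith [ht.1])
          linarith
    rw [mem_ball, dist_zero_right] at hz hz'
    obtain ⟨a, ha, rfl⟩ := log_coord hζ hz hzs
    obtain ⟨b, hb', rfl⟩ := log_coord hζ hz' hzs'
    rcases le_total a b with h | h
    · exact key a b ha hb' h hz hz' (by rw [norm_sub_rev]; exact hlt.le)
    · exact key b a hb' ha h hz' hz hlt.le
  have hfin : ENNReal.ofReal (ε ^ 2 / Real.pi) * ENNReal.ofReal L ≤ ENNReal.ofReal V := by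
    refine le_trans ?_ (hA.le.trans hle)
    calc ENNReal.ofReal (ε ^ 2 / Real.pi) * ENNReal.ofReal L
        = ∫⁻ s in Ioo (-(2 * L)) (-L), ENNReal.ofReal (ε ^ 2 / Real.pi) := by
          rw [MeasureTheory.setLIntegral_const, Real.volume_Ioo]; congr 2; ring
      _ ≤ ∫⁻ s in Ioo (-(2 * L)) (-L), ∫⁻ t : ℝ, Ω.indicator (fun w => ENNReal.ofReal (‖deriv g w‖ ^ 2)) ⟨s, t⟩ :=
          MeasureTheory.setLIntegral_mono' measurableSet_Ioo hcol
      _ ≤ _ := MeasureTheory.setLIntegral_le_lintegral _ _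
  rw [← ENNReal.ofReal_mul (by positivity), ENNReal.ofReal_le_ofReal_iff (by positivity)] at hfin
  rw [div_lt_iff₀ (by positivity)] at hLV
  rw [div_mul_eq_mul_div, div_le_iff₀ hπ] at hfin
  linarith

structure RM (J U : Set ℂ) (f : ℂ → ℂ) : Prop where
  jord : IsJord J
  opn : IsOpen U
  conn : IsConnected U
  bdd : Bornology.IsBounded U
  fr : frontier U ⊆ J
  disj : U ⊆ Jᶜ
  df : DifferentiableOn ℂ f (ball 0 1)
  inj : InjOn f (ball 0 1)
  im : f '' ball 0 1 = U

lemma exists_RM {J : Set ℂ} (hJ : IsJord J) {a : ℂ} (ha : a ∉ J)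
    (hb : Bornology.IsBounded (connectedComponentIn Jᶜ a)) :
    ∃ f, RM J (connectedComponentIn Jᶜ a) f := by
  have hJc := hJ.compact.isClosed
  have hU : IsOpen (connectedComponentIn Jᶜ a) := hJc.isOpen_compl.connectedComponentIn
  have hconn : IsConnected (connectedComponentIn Jᶜ a) := isConnected_connectedComponentIn_iff.2 ha
  have hcc := compl_comp_conn hJc hJ.conn hJ.nonempty a
  obtain ⟨φ, h1, h2, h3⟩ := rmt hU hb hconn (lgDom_of hU hb hconn hcc)
  obtain ⟨f, f1, f2⟩ := holo_inv hU hconn.isPreconnected h1 h2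
  rw [h3] at f1
  refine ⟨f, hJ, hU, hconn, hb, frontier_comp hJc a, connectedComponentIn_subset _ _, f1, ?_, ?_⟩
  · rw [← h3]
    rintro _ ⟨x, hx, rfl⟩ _ ⟨y, hy, rfl⟩ h
    rw [f2 x hx, f2 y hy] at h; rw [h]
  · rw [← h3, image_image]
    exact (image_congr fun z hz => f2 z hz).trans (image_id' _)

lemma precon_sub {U C : Set ℂ} (hC : IsPreconnected C) (hfr : ∀ z ∈ frontier U, z ∉ C)
    {q : ℂ} (hq : q ∈ C) (hqU : q ∈ U) : C ⊆ U := by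
  have h1 : C ⊆ interior U ∪ (closure U)ᶜ := by
    intro x hx
    by_contra hc
    rw [mem_union, not_or, mem_compl_iff, not_not] at hc
    exact hfr x ⟨hc.2, hc.1⟩ hx
  have h2 : q ∈ interior U := (h1 hq).resolve_right fun h => h (subset_closure hqU)
  have h3 := hC.subset_left_of_subset_union isOpen_interior isClosed_closure.isOpen_compl
    (disjoint_left.2 fun x hx hx' => hx' (subset_closure (interior_subset hx))) h1 ⟨q, hq, h2⟩
  exact h3.trans interior_subset

namespace RM
variable {J U : Set ℂ} {f : ℂ → ℂ}

lemma clos (h : RM J U f) : closure U ⊆ U ∪ J := by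
  rw [closure_eq_self_union_frontier]
  exact union_subset_union_right _ h.fr

lemma inv (h : RM J U f) : ∃ φ : ℂ → ℂ, ContinuousOn φ U ∧ (∀ z ∈ ball (0:ℂ) 1, φ (f z) = z) ∧
    MapsTo φ U (ball 0 1) ∧ ∀ w ∈ U, f (φ w) = w := by
  obtain ⟨φ, h1, h2⟩ := holo_inv isOpen_ball (convex_ball (0:ℂ) 1).isPreconnected h.df h.inj
  rw [h.im] at h1
  refine ⟨φ, h1.continuousOn, h2, ?_, ?_⟩
  · intro w hw; rw [← h.im] at hw; obtain ⟨z, hz, rfl⟩ := hw; rwa [h2 z hz]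
  · intro w hw; rw [← h.im] at hw; obtain ⟨z, hz, rfl⟩ := hw; rw [h2 z hz]

lemma mem (h : RM J U f) {z : ℂ} (hz : z ∈ ball (0:ℂ) 1) : f z ∈ U := h.im ▸ ⟨z, hz, rfl⟩

lemma proper (h : RM J U f) {ι : Type*} {l : Filter ι} [NeBot l] {u : ι → ℂ} {ζ p : ℂ}
    (hζ : ‖ζ‖ = 1) (hu : ∀ᶠ i in l, u i ∈ ball (0:ℂ) 1) (huζ : Tendsto u l (𝓝 ζ))
    (hp : Tendsto (fun i => f (u i)) l (𝓝 p)) : p ∈ J := by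
  obtain ⟨φ, h1, h2, h3, -⟩ := h.inv
  have hpc : p ∈ closure U := mem_closure_of_tendsto hp (hu.mono fun i hi => h.mem hi)
  refine (h.clos hpc).resolve_left fun hpU => ?_
  have ht : Tendsto (fun i => φ (f (u i))) l (𝓝 (φ p)) :=
    ((h1.continuousAt (h.opn.mem_nhds hpU)).tendsto).comp hp
  have ht' : Tendsto u l (𝓝 (φ p)) := ht.congr' (hu.mono fun i hi => h2 _ hi)
  have := h3 hpU
  rw [← tendsto_nhds_unique huζ ht'] at this
  simp [hζ] at this

lemma cross (h : RM J U f) {ζ : ℂ} (hζ : ‖ζ‖ = 1) : ∃ p ∈ J, ∀ η > 0, ∃ ρ, 0 < ρ ∧ ρ < 1/2 ∧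
    ∀ z ∈ ball (0:ℂ) 1, dist z ζ = ρ → f z ∈ ball p η := by
  have hb : Bornology.IsBounded (f '' ball 0 1) := by rw [h.im]; exact h.bdd
  have := fun n : ℕ => length_area h.df h.inj hb hζ (ε := 1 / ((n:ℝ)+1)) (δ := 1 / ((n:ℝ)+2))
    (by positivity) (by positivity)
  choose ρ h0 h1 h2 using this
  have hρ1 : ∀ n, ρ n < 1/2 := fun n => (h1 n).trans_le
    (one_div_le_one_div_of_le (by norm_num) (by linarith [(Nat.cast_nonneg n : (0:ℝ) ≤ n)]))
  have hρ : Tendsto ρ atTop (𝓝 0) := squeeze_zero (fun n => (h0 n).le)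
    (fun n => (h1 n).le.trans (one_div_le_one_div_of_le (by positivity) (by linarith)))
    tendsto_one_div_add_atTop_nhds_zero_nat
  set u : ℕ → ℂ := fun n => (1 - ρ n : ℝ) * ζ with hu
  have hub : ∀ n, u n ∈ ball (0:ℂ) 1 := fun n => by
    simp only [hu, mem_ball, dist_zero_right, norm_mul, hζ, mul_one, Complex.norm_real,
      Real.norm_eq_abs]
    rw [abs_of_pos (by linarith [hρ1 n])]; linarith [h0 n]
  have hud : ∀ n, dist (u n) ζ = ρ n := fun n => by
    rw [dist_eq_norm, hu, show ((1 - ρ n : ℝ) : ℂ) * ζ - ζ = -(ρ n : ℂ) * ζ by push_cast; ring,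
      norm_mul, hζ, mul_one, norm_neg, Complex.norm_real, Real.norm_eq_abs, abs_of_pos (h0 n)]
  have huζ : Tendsto u atTop (𝓝 ζ) := by
    rw [tendsto_iff_dist_tendsto_zero]; simpa only [hud] using hρ
  obtain ⟨p, -, k, hk, hkp⟩ := h.bdd.isCompact_closure.tendsto_subseq
    (x := fun n => f (u n)) (fun n => subset_closure (h.mem (hub n)))
  refine ⟨p, h.proper hζ (Eventually.of_forall fun n => hub (k n)) (huζ.comp hk.tendsto_atTop) hkp, ?_⟩
  intro η hη
  have e1 : ∀ᶠ n in atTop, dist (f (u (k n))) p < η / 2 := (Metric.tendsto_nhds.1 hkp) _ (by positivity)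
  have e2 : ∀ᶠ n in atTop, 1 / ((k n : ℝ) + 1) < η / 2 :=
    (tendsto_one_div_add_atTop_nhds_zero_nat.comp hk.tendsto_atTop).eventually
      (gt_mem_nhds (by positivity : (0:ℝ) < η / 2))
  obtain ⟨n, n1, n2⟩ := (e1.and e2).exists
  refine ⟨ρ (k n), h0 _, hρ1 _, fun z hz hzd => ?_⟩
  have := h2 (k n) z hz (u (k n)) (hub _) hzd (hud _)
  rw [← dist_eq_norm] at this
  rw [mem_ball]
  calc _ ≤ dist (f z) (f (u (k n))) + dist (f (u (k n))) p := dist_triangle _ _ _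
    _ < η := by linarith

lemma osc (h : RM J U f) {ζ : ℂ} (hζ : ‖ζ‖ = 1) {ε : ℝ} (hε : 0 < ε) : ∃ δ > 0,
    ∀ z ∈ ball (0:ℂ) 1 ∩ ball ζ δ, ∀ z' ∈ ball (0:ℂ) 1 ∩ ball ζ δ, dist (f z) (f z') < ε := by
  obtain ⟨φ, hφ, φf, φm, fφ⟩ := h.inv
  obtain ⟨p, hp, hcr⟩ := h.cross hζ
  have b0 : (0:ℂ) ∈ ball (0:ℂ) 1 := by simp
  have b1 : (1/4:ℂ) ∈ ball (0:ℂ) 1 := by simp; norm_num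
  have hd : 0 < dist (f 0) (f (1/4)) := dist_pos.2 fun h' => by
    have := h.inj b0 b1 h'
    norm_num at this
  set r := min (ε / 2) (dist (f 0) (f (1/4)) / 2) with hr
  have hr0 : 0 < r := by positivity
  obtain ⟨z0, hz0, hz0b, hz0p⟩ : ∃ z0 : ℂ, z0 ∈ ball (0:ℂ) 1 ∧ ‖z0‖ < 1/2 ∧ f z0 ∉ ball p r := by
    by_contra! hc
    have t0 := hc 0 b0 (by simp)
    have t1 := hc (1/4) b1 (by norm_num)
    rw [mem_ball] at t0 t1
    have := dist_triangle_right (f 0) (f (1/4)) p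
    have := min_le_right (ε / 2) (dist (f 0) (f (1/4)) / 2)
    linarith
  obtain ⟨S, hSJ, hSc, hSp, hpS, hSr, δ, hδ, hJS⟩ := h.jord.cap hp hr0
  obtain ⟨ρ, hρ0, hρ1, hρ⟩ := hcr (min δ r / 2) (by positivity)
  set C := {z | z ∈ ball (0:ℂ) 1 ∧ dist z ζ = ρ} with hC
  set K := closure (f '' C) with hK
  have hKb : K ⊆ closedBall p (min δ r / 2) := closure_minimal (by
    rintro _ ⟨z, hz, rfl⟩; exact ball_subset_closedBall (hρ z hz.1 hz.2)) isClosed_closedBall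
  have hmin : min δ r / 2 < min δ r := by have : 0 < min δ r := by positivity
                                          linarith
  have hKδ : K ⊆ ball p δ := hKb.trans (closedBall_subset_ball (hmin.trans_le (min_le_left _ _)))
  have hKr : K ⊆ ball p r := hKb.trans (closedBall_subset_ball (hmin.trans_le (min_le_right _ _)))
  have hJc := h.jord.compact
  have hKc : IsCompact K := (isCompact_closedBall _ _).of_isClosed_subset isClosed_closure hKb
  refine ⟨ρ, hρ0, ?_⟩
  suffices H : ∀ z ∈ ball (0:ℂ) 1 ∩ ball ζ ρ, f z ∈ ball p r by
    intro z hz z' hz'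
    have t0 := H z hz
    have t1 := H z' hz'
    rw [mem_ball] at t0 t1
    have := dist_triangle_right (f z) (f z') p
    have := min_le_left (ε / 2) (dist (f 0) (f (1/4)) / 2)
    linarith
  intro z ⟨hz, hzρ⟩
  by_contra hzp
  have hSK : S ∪ K ⊆ ball p r := union_subset hSr hKr
  have l1 : HasLg (fun w => (w - f z) / (w - f z0)) (S ∪ K) :=
    (lg_exterior hSK hzp).div (lg_exterior hSK hz0p)
  have l2 : HasLg (fun w => (w - f z) / (w - f z0)) J :=
    lg_of_conn hJc.isClosed h.conn.isPreconnected h.disj (h.mem hz) (h.mem hz0)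
  have hint : J ∩ (S ∪ K) = S := by
    apply Subset.antisymm
    · rintro x ⟨hxJ, hx | hx⟩
      · exact hx
      · exact hJS ⟨hxJ, hKδ hx⟩
    · exact fun x hx => ⟨hSJ hx, Or.inl hx⟩
  have l3 := HasLg.glue hJc.isClosed (hSc.union hKc.isClosed) (by rw [hint]; exact hSp) l2 l1
  have hXc : IsCompact (J ∪ (S ∪ K)) := hJc.union ((hJc.of_isClosed_subset hSc hSJ).union hKc)
  have nz : f z ∉ J ∪ (S ∪ K) := by
    rintro (hx | hx)
    · exact h.disj (h.mem hz) hx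
    · exact hzp (hSK hx)
  have nz0 : f z0 ∉ J ∪ (S ∪ K) := by
    rintro (hx | hx)
    · exact h.disj (h.mem hz0) hx
    · exact hz0p (hSK hx)
  have hcomp := lg_same_comp hXc nz nz0 l3
  set D := connectedComponentIn (J ∪ (S ∪ K))ᶜ (f z) with hD
  have hDp : IsPreconnected D := isPreconnected_connectedComponentIn
  have hDs : D ⊆ (J ∪ (S ∪ K))ᶜ := connectedComponentIn_subset _ _
  have hzD : f z ∈ D := mem_connectedComponentIn nz
  have hDU : D ⊆ U := precon_sub hDp (fun x hx hxD => hDs hxD (Or.inl (h.fr hx))) hzD (h.mem hz)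
  have hcon : IsPreconnected ((fun w => dist (φ w) ζ) '' D) :=
    hDp.image _ (by have := hφ.mono hDU; fun_prop)
  have hz0ζ : ρ < dist z0 ζ := by
    have := norm_sub_norm_le ζ z0
    rw [hζ, ← dist_eq_norm, dist_comm] at this
    linarith
  obtain ⟨w, hwD, hw⟩ := hcon.ordConnected.out ⟨f z, hzD, rfl⟩ ⟨f z0, hcomp, rfl⟩
    (show ρ ∈ Icc _ _ from by simp only [φf z hz, φf z0 hz0]; exact ⟨(le_of_lt hzρ), hz0ζ.le⟩)
  exact hDs hwD (Or.inr (Or.inr (subset_closure ⟨φ w, ⟨φm (hDU hwD), hw⟩, fφ w (hDU hwD)⟩)))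

theorem extend (h : RM J U f) : ∃ F : ℂ → ℂ, ContinuousOn F (closedBall 0 1) ∧
    (∀ z ∈ ball (0:ℂ) 1, F z = f z) ∧ MapsTo F (sphere 0 1) J := by
  have hA : closedBall (0:ℂ) 1 ⊆ closure (ball 0 1) := by rw [closure_ball _ one_ne_zero]
  have hcont := h.df.continuousOn
  have hex : ∀ x ∈ closedBall (0:ℂ) 1, ∃ y, Tendsto f (𝓝[ball 0 1] x) (𝓝 y) := by
    intro x hx
    by_cases hxb : x ∈ ball (0:ℂ) 1
    · exact ⟨f x, hcont x hxb⟩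
    have hx1 : ‖x‖ = 1 := by
      simp only [mem_closedBall, mem_ball, dist_zero_right, not_lt] at hx hxb
      exact le_antisymm hx hxb
    have hne : NeBot (𝓝[ball 0 1] x) := mem_closure_iff_nhdsWithin_neBot.1 (hA hx)
    have hc : Cauchy (map f (𝓝[ball 0 1] x)) := by
      rw [Metric.cauchy_iff]
      refine ⟨hne.map f, fun ε hε => ?_⟩
      obtain ⟨δ, hδ, hδ'⟩ := h.osc hx1 hε
      refine ⟨f '' (ball 0 1 ∩ ball x δ), image_mem_map (inter_mem self_mem_nhdsWithin
        (mem_nhdsWithin_of_mem_nhds (ball_mem_nhds _ hδ))), ?_⟩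
      rintro _ ⟨z, hz, rfl⟩ _ ⟨z', hz', rfl⟩
      exact hδ' z hz z' hz'
    exact CompleteSpace.complete hc
  refine ⟨extendFrom (ball 0 1) f, continuousOn_extendFrom hA hex, fun z hz =>
    extendFrom_extends hcont z hz, fun ζ hζ => ?_⟩
  have hζ1 : ‖ζ‖ = 1 := by simpa using hζ
  have hne : NeBot (𝓝[ball 0 1] ζ) :=
    mem_closure_iff_nhdsWithin_neBot.1 (hA (sphere_subset_closedBall hζ))
  exact h.proper hζ1 (l := 𝓝[ball 0 1] ζ) (u := id) self_mem_nhdsWithin (tendsto_id.mono_left nhdsWithin_le_nhds)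
    (tendsto_extendFrom (hex ζ (sphere_subset_closedBall hζ)))

end RM

lemma const_arc {F : ℂ → ℂ} (hF : ContinuousOn F (closedBall 0 1))
    (hd : DifferentiableOn ℂ F (ball 0 1)) {p ζ0 : ℂ} {η : ℝ} (hη : 0 < η) (hζ0 : ‖ζ0‖ = 1)
    (hp : ∀ ζ, ‖ζ‖ = 1 → dist ζ ζ0 < η → F ζ = p) : F 0 = p := by
  have hcov : ∀ ζ ∈ sphere (0:ℂ) 1, {z | dist (ζ0 / ζ * z) ζ0 < η} ∈ 𝓝 ζ := fun ζ hζ => by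
    have h0 : ζ ≠ 0 := ne_of_mem_sphere hζ one_ne_zero
    refine IsOpen.mem_nhds (isOpen_lt (by fun_prop) continuous_const) ?_
    simp [h0, hη]
  obtain ⟨T, hT, hTc⟩ := (isCompact_sphere (0:ℂ) 1).elim_nhds_subcover _ hcov
  set G : ℂ → ℂ := fun z => ∏ c ∈ T, (F (ζ0 / c * z) - p) with hG
  have hc1 : ∀ c ∈ T, ‖ζ0 / c‖ = 1 := fun c hc => by
    have := hT c hc
    rw [mem_sphere, dist_zero_right] at this
    rw [norm_div, hζ0, this, div_one]
  have hGd : DiffContOnCl ℂ G (ball 0 1) := by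
    constructor
    · refine DifferentiableOn.fun_finsetProd fun c hc => ?_
      refine (hd.comp (by fun_prop) fun z hz => ?_).sub_const p
      rw [mem_ball, dist_zero_right, norm_mul, hc1 c hc, one_mul]; simpa using hz
    · rw [closure_ball _ one_ne_zero]
      refine continuousOn_finsetProd _ fun c hc => ?_
      refine (hF.comp (by fun_prop) fun z hz => ?_).sub continuousOn_const
      rw [mem_closedBall, dist_zero_right, norm_mul, hc1 c hc, one_mul]; simpa using hz
  have hG0 : EqOn G (fun _ => 0) (frontier (ball 0 1)) := by
    rw [frontier_ball _ one_ne_zero]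
    intro ζ hζ
    obtain ⟨c, hcT, hc⟩ : ∃ c ∈ T, dist (ζ0 / c * ζ) ζ0 < η := by simpa using hTc hζ
    refine Finset.prod_eq_zero hcT (sub_eq_zero.2 (hp _ ?_ hc))
    rw [norm_mul, hc1 c hcT, one_mul]; simpa using hζ
  have := Complex.eqOn_of_eqOn_frontier isBounded_ball hGd diffContOnCl_const hG0
    (mem_ball_self one_pos)
  simp only [hG, mul_zero] at this
  obtain ⟨c, -, hc⟩ := Finset.prod_eq_zero_iff.1 this
  exact sub_eq_zero.1 hc

lemma lg_closedBall {g : ℂ → ℂ} (hg : ContinuousOn g (closedBall 0 1))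
    (h0 : ∀ z ∈ closedBall (0:ℂ) 1, g z ≠ 0) : HasLg g (closedBall 0 1) := by
  set r : ℂ → ℂ := fun z => ((max 1 ‖z‖)⁻¹ : ℝ) * z
  have hm : ∀ z : ℂ, (0:ℝ) < max 1 ‖z‖ := fun z => lt_max_of_lt_left one_pos
  have hr : Continuous r := by
    have : Continuous fun z : ℂ => (max 1 ‖z‖)⁻¹ :=
      Continuous.inv₀ (by fun_prop) fun z => (hm z).ne'
    fun_prop
  have hrb : ∀ z, r z ∈ closedBall (0:ℂ) 1 := fun z => by
    simp only [r, mem_closedBall, dist_zero_right, norm_mul, Complex.norm_real, norm_inv,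
      Real.norm_eq_abs, abs_of_pos (hm z)]
    rw [inv_mul_le_iff₀ (hm z)]; simp
  have : HasLg (fun z => g (r z)) univ := HasLg.convex convex_univ univ_nonempty isOpen_univ
    (hg.comp hr.continuousOn fun z _ => hrb z) fun z _ => h0 _ (hrb z)
  refine (this.mono (subset_univ _)).congr fun z hz => ?_
  have hz1 : ‖z‖ ≤ 1 := by simpa using hz
  simp [r, hz1]

lemma chord_mem {ζ1 ζ2 z : ℂ} (h1 : ‖ζ1‖ = 1) (h2 : ‖ζ2‖ = 1) (hne : ζ1 ≠ ζ2) (hz : ‖z‖ < 1)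
    (hl : ((z - ζ1) / (ζ2 - ζ1)).im = 0) :
    ∃ l : ℝ, 0 < l ∧ l < 1 ∧ z = ζ1 + l * (ζ2 - ζ1) := by
  have hd : ζ2 - ζ1 ≠ 0 := sub_ne_zero.2 hne.symm
  set l := ((z - ζ1) / (ζ2 - ζ1)).re with hld
  have hle : ((l : ℝ) : ℂ) = (z - ζ1) / (ζ2 - ζ1) := by
    apply Complex.ext <;> simp [hld, hl]
  have hzl : z = ζ1 + l * (ζ2 - ζ1) := by rw [hle, div_mul_cancel₀ _ hd]; ring
  refine ⟨l, ?_, ?_, hzl⟩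
  · by_contra! h0
    have e : ((1 - l : ℝ) : ℂ) * ζ1 = z + (-l : ℝ) * ζ2 := by rw [hzl]; push_cast; ring
    have := congrArg norm e
    rw [norm_mul, h1, Complex.norm_real, Real.norm_eq_abs, abs_of_pos (by linarith)] at this
    have h3 := norm_add_le z ((-l : ℝ) * ζ2)
    rw [norm_mul, h2, Complex.norm_real, Real.norm_eq_abs, abs_of_nonneg (by linarith)] at h3
    linarith
  · by_contra! h0
    have e : (l : ℂ) * ζ2 = z + (l - 1 : ℝ) * ζ1 := by rw [hzl]; push_cast; ring
    have := congrArg norm e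
    rw [norm_mul, h2, Complex.norm_real, Real.norm_eq_abs, abs_of_pos (by linarith)] at this
    have h3 := norm_add_le z ((l - 1 : ℝ) * ζ1)
    rw [norm_mul, h1, Complex.norm_real, Real.norm_eq_abs, abs_of_nonneg (by linarith)] at h3
    linarith

lemma chord_sides {ζ1 ζ2 : ℂ} (h1 : ‖ζ1‖ = 1) (h2 : ‖ζ2‖ = 1) (hne : ζ1 ≠ ζ2) {s : ℝ}
    (hs : s = 1 ∨ s = -1) : ∃ ν : ℂ, ‖ν‖ = 1 ∧ 0 < s * ((ν - ζ1) / (ζ2 - ζ1)).im := by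
  have hd : ζ2 - ζ1 ≠ 0 := sub_ne_zero.2 hne.symm
  set d := ζ2 - ζ1 with hdd
  have hdn : 0 < ‖d‖ := norm_pos_iff.2 hd
  refine ⟨s * Complex.I * d / ‖d‖, ?_, ?_⟩
  · rw [norm_div, norm_mul, norm_mul, Complex.norm_I, Complex.norm_real, Complex.norm_real, norm_norm]
    rcases hs with rfl | rfl <;> simp [hd]
  · have hss : s * s = 1 := by rcases hs with rfl | rfl <;> norm_num
    have e : (s * Complex.I * d / ‖d‖ - ζ1) / d = ((s / ‖d‖ : ℝ) : ℂ) * Complex.I - ζ1 / d := by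
      have : (‖d‖ : ℂ) ≠ 0 := by exact_mod_cast hdn.ne'
      push_cast
      field_simp
    have hre : (ζ1 / d).re ≠ 0 := by
      intro h0
      have h3 : Complex.normSq (ζ1 / d + 1) = Complex.normSq (ζ1 / d) := by
        have : ζ1 / d + 1 = ζ2 / d := by field_simp; rw [hdd]; ring
        rw [this, Complex.normSq_eq_norm_sq, Complex.normSq_eq_norm_sq, norm_div, norm_div, h1, h2]
      rw [Complex.normSq_apply, Complex.normSq_apply] at h3
      simp [h0] at h3
    have h4 := Complex.abs_im_lt_norm.2 hre
    rw [norm_div, h1] at h4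
    have h5 : |s * (ζ1 / d).im| < 1 / ‖d‖ := by
      rw [abs_mul]; rcases hs with rfl | rfl <;> simpa using h4
    rw [e, Complex.sub_im, Complex.im_ofReal_mul, Complex.I_im, mul_one, mul_sub, ← mul_div_assoc,
      hss]
    linarith [(abs_lt.1 h5).2]

namespace RM
variable {J U : Set ℂ} {f : ℂ → ℂ} {F : ℂ → ℂ}

lemma ne_bd (h : RM J U f) (hFf : ∀ z ∈ ball (0:ℂ) 1, F z = f z) (hFJ : MapsTo F (sphere 0 1) J)
    {z w : ℂ} (hz : z ∈ closedBall (0:ℂ) 1) (hw : w ∈ ball (0:ℂ) 1) (hzw : F z = F w) : z = w := by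
  by_cases hzb : z ∈ ball (0:ℂ) 1
  · exact h.inj hzb hw (by rw [← hFf z hzb, hzw, hFf w hw])
  · have : z ∈ sphere (0:ℂ) 1 := by
      rw [← ball_union_sphere] at hz; exact hz.resolve_left hzb
    have h1 := hFJ this
    rw [hzw, hFf w hw] at h1
    exact absurd h1 (h.disj (h.mem hw))

lemma dsl (h : RM J U f) (hF : ContinuousOn F (closedBall 0 1))
    (hFf : ∀ z ∈ ball (0:ℂ) 1, F z = f z) (hFJ : MapsTo F (sphere 0 1) J) {z1 : ℂ}
    (hz1 : z1 ∈ ball (0:ℂ) 1) : ∃ g, HasLg g (closedBall 0 1) ∧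
      ∀ z, F z - F z1 = (z - z1) * g z := by
  have hnb : ball (0:ℂ) 1 ∈ 𝓝 z1 := isOpen_ball.mem_nhds hz1
  have hFd : DifferentiableOn ℂ F (ball 0 1) := h.df.congr hFf
  have hFz : DifferentiableAt ℂ F z1 := hFd.differentiableAt hnb
  have hFi : InjOn F (ball 0 1) := h.inj.congr fun z hz => (hFf z hz).symm
  refine ⟨dslope F z1, lg_closedBall ((continuousOn_dslope (mem_of_superset hnb
    ball_subset_closedBall)).2 ⟨hF, hFz⟩) fun z hz => ?_, fun z => ?_⟩
  · rcases eq_or_ne z z1 with rfl | hne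
    · rw [dslope_same]
      obtain ⟨k, hk, hk'⟩ := holo_inv isOpen_ball (convex_ball (0:ℂ) 1).isPreconnected hFd hFi
      have ho : F '' ball 0 1 ∈ 𝓝 (F z) := by
        rw [image_congr hFf, h.im, hFf z hz1]; exact h.opn.mem_nhds (h.mem hz1)
      have h1 := (hk.differentiableAt ho).hasDerivAt.comp z hFz.hasDerivAt
      have h2 : HasDerivAt (k ∘ F) 1 z := (hasDerivAt_id z).congr_of_eventuallyEq
        (by filter_upwards [hnb] with w hw; exact hk' w hw)
      intro h0
      have := h1.unique h2
      rw [h0, mul_zero] at this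
      exact zero_ne_one this
    · rw [dslope_of_ne _ hne, slope_def_field]
      exact div_ne_zero (sub_ne_zero.2 fun h' => hne (h.ne_bd hFf hFJ hz hz1 h')) (sub_ne_zero.2 hne)
  · have := sub_smul_dslope F z1 z
    rw [smul_eq_mul] at this; exact this.symm

lemma inj_sphere (h : RM J U f) (hF : ContinuousOn F (closedBall 0 1))
    (hFf : ∀ z ∈ ball (0:ℂ) 1, F z = f z) (hFJ : MapsTo F (sphere 0 1) J) :
    InjOn F (sphere 0 1) := by
  intro ζ1 hζ1 ζ2 hζ2 heq
  by_contra hne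
  have h1 : ‖ζ1‖ = 1 := by simpa using hζ1
  have h2 : ‖ζ2‖ = 1 := by simpa using hζ2
  have hd : ζ2 - ζ1 ≠ 0 := sub_ne_zero.2 (Ne.symm hne)
  have hFU : ∀ z ∈ ball (0:ℂ) 1, F z ∈ U := fun z hz => by rw [hFf z hz]; exact h.mem hz
  set p := F ζ1 with hp
  set ℓ : ℂ → ℝ := fun z => ((z - ζ1) / (ζ2 - ζ1)).im with hℓ
  have hℓc : Continuous ℓ := by fun_prop
  have hℓa : ∀ z w : ℂ, ∀ a b : ℝ, a + b = 1 → ℓ (a * z + b * w) = a * ℓ z + b * ℓ w := by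
    intro z w a b hab
    have : (a * z + b * w - ζ1) / (ζ2 - ζ1) = a * ((z - ζ1) / (ζ2 - ζ1)) + b * ((w - ζ1) / (ζ2 - ζ1)) := by
      have : (a : ℂ) + b = 1 := by exact_mod_cast hab
      field_simp
      linear_combination ζ1 * this
    simp only [hℓ]
    rw [this, Complex.add_im, Complex.im_ofReal_mul, Complex.im_ofReal_mul]
  set ch : Set ℂ := (fun l : ℝ => ζ1 + l * (ζ2 - ζ1)) '' Icc 0 1 with hch
  have hchc : IsCompact ch := isCompact_Icc.image (by fun_prop)
  have hchl : ∀ z ∈ ch, z = ζ1 ∨ z = ζ2 ∨ z ∈ ball (0:ℂ) 1 := by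
    rintro _ ⟨l, hl, rfl⟩
    rcases hl.1.eq_or_lt with rfl | h0
    · simp
    rcases hl.2.eq_or_lt with rfl | h0'
    · simp
    right; right
    have := (strictConvex_closedBall ℝ (0:ℂ) 1) (sphere_subset_closedBall hζ1)
      (sphere_subset_closedBall hζ2) hne (show 0 < 1 - l by linarith) h0 (by ring)
    rw [interior_closedBall _ one_ne_zero] at this
    convert this using 1
    simp only [Complex.real_smul]; push_cast; ring
  have hchb : ch ⊆ closedBall 0 1 := fun z hz => by
    rcases hchl z hz with rfl | rfl | h'
    · exact sphere_subset_closedBall hζ1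
    · exact sphere_subset_closedBall hζ2
    · exact ball_subset_closedBall h'
  set Γ := F '' ch with hΓ
  have hΓc : IsCompact Γ := hchc.image_of_continuousOn (hF.mono hchb)
  have hΓJ : Γ ∩ J = {p} := by
    apply Subset.antisymm
    · rintro _ ⟨⟨z, hz, rfl⟩, hzJ⟩
      rcases hchl z hz with rfl | rfl | h'
      · rfl
      · exact heq.symm
      · exact absurd hzJ (h.disj (hFU z h'))
    · rintro _ rfl
      exact ⟨⟨ζ1, ⟨0, by simp, by simp⟩, rfl⟩, hFJ hζ1⟩
  -- points off the chord map off Γ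
  have hoff : ∀ z ∈ ball (0:ℂ) 1, ℓ z ≠ 0 → F z ∉ Γ := by
    rintro z hz hl ⟨w, hw, hwz⟩
    have hwz' : w = z := h.ne_bd hFf hFJ (hchb hw) hz hwz
    subst hwz'
    obtain ⟨l, hl', rfl⟩ := hw
    apply hl
    simp [hℓ, hd]
  -- separation
  have hsep : ∀ z1 ∈ ball (0:ℂ) 1, ∀ z2 ∈ ball (0:ℂ) 1, ℓ z1 < 0 → 0 < ℓ z2 →
      F z2 ∉ connectedComponentIn Γᶜ (F z1) := by
    intro z1 hz1 z2 hz2 hl1 hl2 hmem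
    have l1 : HasLg (fun w => (w - F z1) / (w - F z2)) Γ := lg_of_conn hΓc.isClosed
      isPreconnected_connectedComponentIn (connectedComponentIn_subset _ _)
      (mem_connectedComponentIn (hoff z1 hz1 hl1.ne)) hmem
    have l2 : HasLg (fun w => (w - F z1) / (w - F z2)) J := lg_of_conn h.jord.compact.isClosed
      h.conn.isPreconnected h.disj (hFU z1 hz1) (hFU z2 hz2)
    obtain ⟨L, L1, L2⟩ := HasLg.glue hΓc.isClosed h.jord.compact.isClosed
      (by rw [hΓJ]; exact isPreconnected_singleton) l1 l2
    set X := ch ∪ sphere (0:ℂ) 1 with hX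
    have hXb : X ⊆ closedBall 0 1 := union_subset hchb sphere_subset_closedBall
    have hXc : IsCompact X := hchc.union (isCompact_sphere _ _)
    have l3 : HasLg (fun z => (F z - F z1) / (F z - F z2)) X :=
      have hm : MapsTo F X (Γ ∪ J) := by
        rintro z (hz | hz)
        · exact Or.inl ⟨z, hz, rfl⟩
        · exact Or.inr (hFJ hz)
      ⟨L ∘ F, L1.comp (hF.mono hXb) hm, fun z hz => L2 _ (hm hz)⟩
    obtain ⟨g1, g1l, g1e⟩ := h.dsl hF hFf hFJ hz1
    obtain ⟨g2, g2l, g2e⟩ := h.dsl hF hFf hFJ hz2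
    have hnX : ∀ z ∈ ball (0:ℂ) 1, ℓ z ≠ 0 → z ∉ X := by
      rintro z hz hl (hz' | hz')
      · exact hoff z hz hl ⟨z, hz', rfl⟩
      · simp only [mem_ball, mem_sphere] at hz hz'; linarith
    have n1 := hnX z1 hz1 hl1.ne
    have n2 := hnX z2 hz2 hl2.ne'
    have l4 : HasLg (fun z => (z - z1) / (z - z2)) X := by
      refine (l3.div ((g1l.mono hXb).div (g2l.mono hXb))).congr fun z hz => ?_
      have q1 : g1 z ≠ 0 := by
        obtain ⟨L, -, hL⟩ := g1l; rw [← hL z (hXb hz)]; exact Complex.exp_ne_zero _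
      have q2 : g2 z ≠ 0 := by
        obtain ⟨L, -, hL⟩ := g2l; rw [← hL z (hXb hz)]; exact Complex.exp_ne_zero _
      have q3 : z - z2 ≠ 0 := sub_ne_zero.2 fun h' => n2 (h' ▸ hz)
      simp only [g1e, g2e]
      field_simp
    have hc := lg_same_comp hXc n1 n2 l4
    set C := connectedComponentIn Xᶜ z1
    have hCp : IsPreconnected C := isPreconnected_connectedComponentIn
    have hCs : C ⊆ Xᶜ := connectedComponentIn_subset _ _
    have hCz1 : z1 ∈ C := mem_connectedComponentIn n1
    have hCb : C ⊆ ball 0 1 := precon_sub hCp (by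
      rw [frontier_ball _ one_ne_zero]
      exact fun x hx hxC => hCs hxC (Or.inr hx)) hCz1 hz1
    obtain ⟨w, hwC, hw⟩ := (hCp.image ℓ hℓc.continuousOn).ordConnected.out ⟨z1, hCz1, rfl⟩
      ⟨z2, hc, rfl⟩ (show (0:ℝ) ∈ Icc _ _ from ⟨hl1.le, hl2.le⟩)
    obtain ⟨l, l0, l1, hwl⟩ := chord_mem h1 h2 hne (by simpa using hCb hwC) hw
    exact hCs hwC (Or.inl ⟨l, ⟨l0.le, l1.le⟩, hwl.symm⟩)
  -- base points on both sides
  obtain ⟨ν1, hν1, hν1l⟩ := chord_sides h1 h2 hne (s := -1) (Or.inr rfl)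
  obtain ⟨ν2, hν2, hν2l⟩ := chord_sides h1 h2 hne (s := 1) (Or.inl rfl)
  rw [neg_one_mul, neg_pos] at hν1l
  rw [one_mul] at hν2l
  -- one side
  have side : ∀ s : ℝ, (s = 1 ∨ s = -1) → ∀ ν : ℂ, ‖ν‖ = 1 → 0 < s * ℓ ν →
      (∀ z1 ∈ ball (0:ℂ) 1, 0 < s * ℓ z1 → ∀ q ∈ J \ {p}, q ∉ connectedComponentIn Γᶜ (F z1)) →
      False := by
    intro s hs ν hν hνl hall
    have hs0 : s ≠ 0 := by rcases hs with rfl | rfl <;> norm_num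
    obtain ⟨η, hη, hηs⟩ := Metric.isOpen_iff.1 (isOpen_lt continuous_const (hℓc.const_mul s)) ν hνl
    have hc := const_arc hF (h.df.congr hFf) (p := p) hη hν (fun ζ hζ hζd => by
      by_contra hζp
      have hζs : ζ ∈ sphere (0:ℂ) 1 := by simpa using hζ
      have hζl : 0 < s * ℓ ζ := hηs hζd
      -- a sequence of points inside converging to ζ
      set S : Set ℂ := {z | z ∈ ball (0:ℂ) 1 ∧ 0 < s * ℓ z} with hS
      have hSconv : Convex ℝ S := by
        intro x hx y hy a b ha hb hab
        refine ⟨convex_ball _ _ hx.1 hy.1 ha hb hab, ?_⟩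
        simp only [Complex.real_smul]
        rw [hℓa x y a b hab, show s * (a * ℓ x + b * ℓ y) = a * (s * ℓ x) + b * (s * ℓ y) by ring]
        have hx2 := hx.2
        have hy2 := hy.2
        rcases ha.eq_or_lt with rfl | ha
        · rw [zero_add] at hab; subst hab; simpa using hy2
        · have := mul_pos ha hx2
          have := mul_nonneg hb hy2.le
          linarith
      have hζS : ζ ∈ closure S := by
        have : ζ ∈ closure (ball (0:ℂ) 1) := by
          rw [closure_ball _ one_ne_zero]; exact sphere_subset_closedBall hζs
        rw [mem_closure_iff_nhds] at this ⊢
        intro V hV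
        obtain ⟨x, hx, hx'⟩ := this _ (inter_mem hV
          ((isOpen_lt continuous_const (hℓc.const_mul s)).mem_nhds hζl))
        exact ⟨x, hx.1, hx', hx.2⟩
      obtain ⟨z1, hz1⟩ : S.Nonempty := closure_nonempty_iff.1 ⟨ζ, hζS⟩
      have hne' : ∀ z ∈ S, ℓ z ≠ 0 := fun z hz h0 => by have := hz.2; rw [h0, mul_zero] at this; exact lt_irrefl _ this
      set C := connectedComponentIn Γᶜ (F z1)
      have hSC : F '' S ⊆ C := (hSconv.isPreconnected.image F (hF.mono fun z hz =>
        ball_subset_closedBall hz.1)).subset_connectedComponentIn ⟨z1, hz1, rfl⟩ (by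
          rintro _ ⟨z, hz, rfl⟩; exact hoff z hz.1 (hne' z hz))
      have hFζ : F ζ ∈ closure C := by
        have h3 : ContinuousWithinAt F S ζ := (hF ζ (sphere_subset_closedBall hζs)).mono
          fun z hz => ball_subset_closedBall hz.1
        exact closure_mono hSC (h3.mem_closure_image hζS)
      have hFζΓ : F ζ ∉ Γ := fun h' => hζp (by
        have : F ζ ∈ Γ ∩ J := ⟨h', hFJ hζs⟩
        rwa [hΓJ] at this)
      have hfr := frontier_comp hΓc.isClosed (F z1)
      rw [closure_eq_self_union_frontier] at hFζ
      rcases hFζ with h' | h'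
      · exact hall z1 hz1.1 hz1.2 (F ζ) ⟨hFJ hζs, hζp⟩ h'
      · exact hFζΓ (hfr h'))
    have := hFU 0 (by simp)
    rw [hc] at this
    exact h.disj this (hFJ hζ1)
  by_cases hcase : ∃ z1 ∈ ball (0:ℂ) 1, 0 < (1:ℝ) * ℓ z1 ∧ ∃ q ∈ J \ {p}, q ∈ connectedComponentIn Γᶜ (F z1)
  · obtain ⟨z2, hz2, hl2, q, hq, hqC⟩ := hcase
    refine side (-1) (Or.inr rfl) ν1 hν1 (by rw [neg_one_mul, neg_pos]; exact hν1l) ?_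
    intro z1 hz1 hl1 q' hq' hq'C
    rw [neg_one_mul, neg_pos] at hl1
    rw [one_mul] at hl2
    apply hsep z1 hz1 z2 hz2 hl1 hl2
    have hJp : J \ {p} ⊆ connectedComponentIn Γᶜ q :=
      (h.jord.diff_conn p).subset_connectedComponentIn hq fun x hx hxΓ => hx.2 (by
        have : x ∈ Γ ∩ J := ⟨hxΓ, hx.1⟩
        rwa [hΓJ] at this)
    rw [connectedComponentIn_eq hq'C, ← connectedComponentIn_eq (hJp hq'), ← connectedComponentIn_eq hqC]
    exact mem_connectedComponentIn (hoff z2 hz2 hl2.ne')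
  · refine side 1 (Or.inl rfl) ν2 hν2 (by rw [one_mul]; exact hν2l) ?_
    intro z1 hz1 hl1 q hq hqC
    exact hcase ⟨z1, hz1, hl1, q, hq, hqC⟩

end RM

lemma RM.full {J U : Set ℂ} {f F : ℂ → ℂ} (h : RM J U f) (hF : ContinuousOn F (closedBall 0 1))
    (hFf : ∀ z ∈ ball (0:ℂ) 1, F z = f z) (hFJ : MapsTo F (sphere 0 1) J) :
    F '' sphere 0 1 = J := by
  refine Subset.antisymm (image_subset_iff.2 hFJ) fun q hq => ?_
  by_contra hqX
  have hXc : IsClosed (F '' sphere 0 1) :=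
    ((isCompact_sphere _ _).image_of_continuousOn (hF.mono sphere_subset_closedBall)).isClosed
  have hU : F '' ball 0 1 = U := by
    rw [← h.im]; exact image_congr hFf
  have hfr : frontier U ⊆ F '' sphere 0 1 := by
    intro z hz
    have h1 : closure U ⊆ F '' closedBall 0 1 := by
      refine closure_minimal ?_ ((isCompact_closedBall _ _).image_of_continuousOn hF).isClosed
      rw [← hU]; exact image_mono ball_subset_closedBall
    have h2 := h1 hz.1
    rw [← ball_union_sphere, image_union, hU] at h2
    refine h2.resolve_left fun hzU => ?_
    have := hz.2
    rw [h.opn.interior_eq] at this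
    exact this hzU
  obtain ⟨j, j1, j2, j3⟩ := h.jord
  rw [← j3] at hq
  obtain ⟨ζ, hζ, rfl⟩ := hq
  obtain ⟨s, -, rfl⟩ := sphere_param hζ 0
  have hec : Continuous fun t : ℝ => j (Complex.exp (t * Complex.I)) :=
    j1.comp_continuous (by fun_prop) sphere_expI
  have hn : (fun t : ℝ => j (Complex.exp (t * Complex.I))) ⁻¹' (F '' sphere 0 1)ᶜ ∈ 𝓝 s :=
    (hXc.isOpen_compl.preimage hec).mem_nhds hqX
  obtain ⟨η, hη, hb⟩ := Metric.mem_nhds_iff.1 hn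
  set d := min (η / 2) 1 with hd
  have hd0 : 0 < d := by positivity
  have hd1 : d ≤ 1 := min_le_right _ _
  have hd2 : d < η := by have := min_le_left (η/2) 1; linarith
  have hpi := Real.pi_gt_three
  have hA : IsPreconnected ((fun t : ℝ => j (Complex.exp (t * Complex.I))) '' Icc (s+d) (s+2*Real.pi-d))ᶜ := by
    refine arc_compl_conn (by linarith) hec.continuousOn fun a ha b hb hab => ?_
    refine expI_inj (u := s) ⟨by linarith [ha.1], by linarith [ha.2]⟩
      ⟨by linarith [hb.1], by linarith [hb.2]⟩ (j2 (sphere_expI _) (sphere_expI _) hab)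
  have hXA : F '' sphere 0 1 ⊆ (fun t : ℝ => j (Complex.exp (t * Complex.I))) '' Icc (s+d) (s+2*Real.pi-d) := by
    rintro _ ⟨z, hz, rfl⟩
    have hzJ := hFJ hz
    rw [← j3] at hzJ
    obtain ⟨w, hw, hwz⟩ := hzJ
    obtain ⟨t, ht, rfl⟩ := sphere_param hw s
    refine ⟨t, ⟨?_, ?_⟩, hwz⟩
    · by_contra hc
      exact hb (a := t) (by rw [mem_ball, Real.dist_eq, abs_lt]; constructor <;> linarith [ht.1]) ⟨z, hz, hwz.symm⟩
    · by_contra hc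
      refine hb (a := t - 2 * Real.pi) (by rw [mem_ball, Real.dist_eq, abs_lt]; constructor <;> linarith [ht.2]) ⟨z, hz, ?_⟩
      rw [← hwz]
      congr 1
      push_cast
      rw [sub_mul, Complex.exp_sub, Complex.exp_two_pi_mul_I, div_one]
  obtain ⟨u, hu⟩ := h.conn.nonempty
  have huA : u ∉ (fun t : ℝ => j (Complex.exp (t * Complex.I))) '' Icc (s+d) (s+2*Real.pi-d) := by
    rintro ⟨t, -, rfl⟩
    exact h.disj hu (j3 ▸ ⟨_, sphere_expI _, rfl⟩)
  have hsub := precon_sub hA (fun z hz hzA => hzA (hXA (hfr hz))) huA hu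
  have hb1 := h.bdd.subset hsub
  have hb2 : Bornology.IsBounded ((fun t : ℝ => j (Complex.exp (t * Complex.I))) '' Icc (s+d) (s+2*Real.pi-d)) :=
    (isCompact_Icc.image hec).isBounded
  have := hb1.union hb2
  rw [compl_union_self] at this
  exact NormedSpace.unbounded_univ ℝ ℂ this

def ins (J : Set ℂ) : Set ℂ := {w | w ∉ J ∧ ¬ HasLg (fun z => z - w) J}

lemma IsJord.exists_bdd {J : Set ℂ} (hJ : IsJord J) :
    ∃ a, a ∉ J ∧ Bornology.IsBounded (connectedComponentIn Jᶜ a) := by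
  by_contra hcon
  push Not at hcon
  have hcc : IsPreconnected Jᶜ := by
    refine isPreconnected_of_forall_pair fun a ha b hb => ?_
    refine ⟨connectedComponentIn Jᶜ a, connectedComponentIn_subset _ _, mem_connectedComponentIn ha,
      ?_, isPreconnected_connectedComponentIn⟩
    rw [unbdd_comp_eq hJ.compact (hcon a ha) (hcon b hb)]
    exact mem_connectedComponentIn hb
  have hJc := hJ.compact
  obtain ⟨j, j1, j2, rfl⟩ := hJ
  obtain ⟨k, k1, k2⟩ := compact_inv (isCompact_sphere (0:ℂ) 1) j1 j2
  obtain ⟨L, l1, l2⟩ := borsuk hJc hcc k1 (by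
    rintro _ ⟨x, hx, rfl⟩ h0
    rw [k2 x hx] at h0
    simp [h0] at hx)
  refine no_lg_circle one_pos 0 ⟨L ∘ j, l1.comp j1 (mapsTo_image _ _), fun z hz => ?_⟩
  rw [Function.comp, l2 _ ⟨z, hz, rfl⟩, k2 z hz]; exact (sub_zero z).symm

lemma IsJord.disc {J : Set ℂ} (hJ : IsJord J) : ∃ F : ℂ → ℂ, ContinuousOn F (closedBall 0 1) ∧
    InjOn F (closedBall 0 1) ∧ F '' sphere 0 1 = J ∧ F '' ball 0 1 = ins J ∧ IsOpen (ins J) := by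
  obtain ⟨a, ha, hab⟩ := hJ.exists_bdd
  obtain ⟨f, h⟩ := exists_RM hJ ha hab
  obtain ⟨F, h1, h2, h3⟩ := h.extend
  have hinj : InjOn F (closedBall 0 1) := by
    intro z hz w hw hzw
    by_cases hwb : w ∈ ball (0:ℂ) 1
    · exact h.ne_bd h2 h3 hz hwb hzw
    by_cases hzb : z ∈ ball (0:ℂ) 1
    · exact (h.ne_bd h2 h3 hw hzb hzw.symm).symm
    rw [← ball_union_sphere] at hz hw
    exact h.inj_sphere h1 h2 h3 (hz.resolve_left hzb) (hw.resolve_left hwb) hzw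
  have hfull := h.full h1 h2 h3
  have hU : F '' ball 0 1 = connectedComponentIn Jᶜ a := by
    rw [← h.im]; exact image_congr h2
  suffices hs : F '' ball 0 1 = ins J from ⟨F, h1, hinj, hfull, hs, by rw [← hs, hU]; exact h.opn⟩
  refine Subset.antisymm ?_ ?_
  · rw [hU]
    intro w hw
    have hwJ := h.disj hw
    refine ⟨hwJ, fun hl => ?_⟩
    obtain ⟨R, hR0, hR⟩ := (h.bdd.union hJ.compact.isBounded).subset_ball_lt 0 0
    have hRb : (R:ℂ) ∉ ball (0:ℂ) R := by simp [abs_of_pos hR0]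
    have := lg_same_comp hJ.compact hwJ (fun hx => hRb (hR (Or.inr hx)))
      (hl.div (lg_exterior (fun z hz => hR (Or.inr hz)) hRb))
    rw [← connectedComponentIn_eq hw] at this
    exact hRb (hR (Or.inl this))
  · rintro w ⟨hw1, hw2⟩
    by_contra hc
    have hwn : ∀ z ∈ closedBall (0:ℂ) 1, F z - w ≠ 0 := fun z hz h0 => by
      have h0 := sub_eq_zero.1 h0
      rw [← ball_union_sphere] at hz
      rcases hz with hz | hz
      · exact hc ⟨z, hz, h0⟩
      · exact hw1 (h0 ▸ h3 hz)
    obtain ⟨L, l1, l2⟩ := lg_closedBall (h1.sub continuousOn_const) hwn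
    obtain ⟨k, k1, k2⟩ := compact_inv (isCompact_sphere (0:ℂ) 1) (h1.mono sphere_subset_closedBall)
      (hinj.mono sphere_subset_closedBall)
    refine hw2 ⟨L ∘ k, ?_, ?_⟩
    · rw [← hfull]
      exact l1.comp k1 (by
        rintro _ ⟨x, hx, rfl⟩; rw [k2 x hx]; exact sphere_subset_closedBall hx)
    · rw [← hfull]
      rintro _ ⟨x, hx, rfl⟩
      simp only [Function.comp, k2 x hx, l2 x (sphere_subset_closedBall hx)]
      rfl

noncomputable def cone (m : ℂ → ℂ) (z : ℂ) : ℂ := ‖z‖ * m (z / ‖z‖)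

lemma unit_mem {z : ℂ} (hz : z ≠ 0) : z / ‖z‖ ∈ sphere (0:ℂ) 1 := by
  have : ‖z‖ ≠ 0 := norm_ne_zero_iff.2 hz
  simp [this]

lemma cone_norm {m : ℂ → ℂ} (hm : MapsTo m (sphere 0 1) (sphere 0 1)) (z : ℂ) : ‖cone m z‖ = ‖z‖ := by
  rcases eq_or_ne z 0 with rfl | hz
  · simp [cone]
  · have : ‖m (z / ‖z‖)‖ = 1 := by simpa using hm (unit_mem hz)
    simp [cone, this]

lemma cone_cont {m : ℂ → ℂ} (hm : MapsTo m (sphere 0 1) (sphere 0 1))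
    (hc : ContinuousOn m (sphere 0 1)) : Continuous (cone m) := by
  rw [continuous_iff_continuousAt]
  intro z
  rcases eq_or_ne z 0 with rfl | hz
  · have h0 : cone m 0 = 0 := by simp [cone]
    rw [ContinuousAt, h0, tendsto_zero_iff_norm_tendsto_zero]
    simp only [cone_norm hm]
    simpa using (continuous_norm (E := ℂ)).tendsto 0
  · have h1 : ContinuousOn (cone m) {z | z ≠ 0} := by
      refine ContinuousOn.mul (by fun_prop) (hc.comp (ContinuousOn.div (by fun_prop) (by fun_prop) ?_) ?_)
      · intro z hz; simpa using hz
      · intro z hz; exact unit_mem hz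
    exact h1.continuousAt (isOpen_ne.mem_nhds hz)

lemma cone_sphere {m : ℂ → ℂ} {z : ℂ} (hz : z ∈ sphere (0:ℂ) 1) : cone m z = m z := by
  have : ‖z‖ = 1 := by simpa using hz
  simp [cone, this]

lemma cone_cone {m m' : ℂ → ℂ} (hm : MapsTo m (sphere 0 1) (sphere 0 1))
    (h : ∀ z ∈ sphere (0:ℂ) 1, m' (m z) = z) (z : ℂ) : cone m' (cone m z) = z := by
  rcases eq_or_ne z 0 with rfl | hz
  · simp [cone]
  · have h2 : (‖z‖ : ℂ) ≠ 0 := by simpa using hz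
    have h1 : cone m z / ‖cone m z‖ = m (z / ‖z‖) := by
      rw [cone_norm hm, cone, mul_div_cancel_left₀ _ h2]
    rw [cone, h1, cone_norm hm, h _ (unit_mem hz), mul_div_cancel₀ _ h2]

lemma schoen {J J' : Set ℂ} (hJ : IsJord J) (hJ' : IsJord J') {ψ ψ' : ℂ → ℂ}
    (c : ContinuousOn ψ J) (c' : ContinuousOn ψ' J') (m : MapsTo ψ J J') (m' : MapsTo ψ' J' J)
    (i : ∀ z ∈ J, ψ' (ψ z) = z) (i' : ∀ z ∈ J', ψ (ψ' z) = z) :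
    ∃ G G' : ℂ → ℂ, ContinuousOn G (J ∪ ins J) ∧ ContinuousOn G' (J' ∪ ins J') ∧
      MapsTo G (ins J) (ins J') ∧ MapsTo G' (ins J') (ins J) ∧ EqOn G ψ J ∧ EqOn G' ψ' J' ∧
      (∀ z ∈ J ∪ ins J, G' (G z) = z) ∧ (∀ z ∈ J' ∪ ins J', G (G' z) = z) := by
  obtain ⟨F, f1, f2, f3, f4, -⟩ := hJ.disc
  obtain ⟨F', f1', f2', f3', f4', -⟩ := hJ'.disc
  obtain ⟨k, k1, k2⟩ := compact_inv (isCompact_closedBall (0:ℂ) 1) f1 f2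
  obtain ⟨k', k1', k2'⟩ := compact_inv (isCompact_closedBall (0:ℂ) 1) f1' f2'
  have f5 : F '' closedBall 0 1 = J ∪ ins J := by rw [← sphere_union_ball, image_union, f3, f4]
  have f5' : F' '' closedBall 0 1 = J' ∪ ins J' := by rw [← sphere_union_ball, image_union, f3', f4']
  rw [f5] at k1
  rw [f5'] at k1'
  have sS : sphere (0:ℂ) 1 ⊆ closedBall 0 1 := sphere_subset_closedBall
  have sB : ball (0:ℂ) 1 ⊆ closedBall 0 1 := ball_subset_closedBall
  have kb : MapsTo k (ins J) (ball 0 1) := by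
    rw [← f4]; rintro _ ⟨x, hx, rfl⟩; rwa [k2 x (sB hx)]
  have kb' : MapsTo k' (ins J') (ball 0 1) := by
    rw [← f4']; rintro _ ⟨x, hx, rfl⟩; rwa [k2' x (sB hx)]
  have ks : MapsTo k J (sphere 0 1) := by
    intro z hz; rw [← f3] at hz; obtain ⟨x, hx, rfl⟩ := hz; rwa [k2 x (sS hx)]
  have ks' : MapsTo k' J' (sphere 0 1) := by
    intro z hz; rw [← f3'] at hz; obtain ⟨x, hx, rfl⟩ := hz; rwa [k2' x (sS hx)]
  have Fs : MapsTo F (sphere 0 1) J := fun z hz => f3 ▸ ⟨z, hz, rfl⟩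
  have Fs' : MapsTo F' (sphere 0 1) J' := fun z hz => f3' ▸ ⟨z, hz, rfl⟩
  have Fb : MapsTo F (ball 0 1) (ins J) := fun z hz => f4 ▸ ⟨z, hz, rfl⟩
  have Fb' : MapsTo F' (ball 0 1) (ins J') := fun z hz => f4' ▸ ⟨z, hz, rfl⟩
  have kc : MapsTo k (J ∪ ins J) (closedBall 0 1) := fun z hz => hz.elim (fun h => sS (ks h)) fun h => sB (kb h)
  have kc' : MapsTo k' (J' ∪ ins J') (closedBall 0 1) := fun z hz => hz.elim (fun h => sS (ks' h)) fun h => sB (kb' h)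
  have Fk : ∀ z ∈ J ∪ ins J, F (k z) = z := by
    rw [← f5]; rintro _ ⟨x, hx, rfl⟩; rw [k2 x hx]
  have Fk' : ∀ z ∈ J' ∪ ins J', F' (k' z) = z := by
    rw [← f5']; rintro _ ⟨x, hx, rfl⟩; rw [k2' x hx]
  set n := k' ∘ ψ ∘ F with hn
  set n' := k ∘ ψ' ∘ F' with hn'
  have nm : MapsTo n (sphere 0 1) (sphere 0 1) := ks'.comp (m.comp Fs)
  have nm' : MapsTo n' (sphere 0 1) (sphere 0 1) := ks.comp (m'.comp Fs')
  have nc : ContinuousOn n (sphere 0 1) :=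
    (k1'.mono subset_union_left).comp (c.comp (f1.mono sS) Fs) (m.comp Fs)
  have nc' : ContinuousOn n' (sphere 0 1) :=
    (k1.mono subset_union_left).comp (c'.comp (f1'.mono sS) Fs') (m'.comp Fs')
  have ni : ∀ z ∈ sphere (0:ℂ) 1, n' (n z) = z := fun z hz => by
    simp only [hn, hn', Function.comp]
    rw [Fk' _ (Or.inl (m (Fs hz))), i _ (Fs hz), k2 _ (sS hz)]
  have ni' : ∀ z ∈ sphere (0:ℂ) 1, n (n' z) = z := fun z hz => by
    simp only [hn, hn', Function.comp]
    rw [Fk _ (Or.inl (m' (Fs' hz))), i' _ (Fs' hz), k2' _ (sS hz)]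
  have cc : MapsTo (cone n) (closedBall 0 1) (closedBall 0 1) := fun z hz => by
    simpa [cone_norm nm] using hz
  have cc' : MapsTo (cone n') (closedBall 0 1) (closedBall 0 1) := fun z hz => by
    simpa [cone_norm nm'] using hz
  have cb : MapsTo (cone n) (ball 0 1) (ball 0 1) := fun z hz => by
    simpa [cone_norm nm] using hz
  have cb' : MapsTo (cone n') (ball 0 1) (ball 0 1) := fun z hz => by
    simpa [cone_norm nm'] using hz
  refine ⟨F' ∘ cone n ∘ k, F ∘ cone n' ∘ k', f1'.comp ((cone_cont nm nc).comp_continuousOn k1) (cc.comp kc),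
    f1.comp ((cone_cont nm' nc').comp_continuousOn k1') (cc'.comp kc'), Fb'.comp (cb.comp kb),
    Fb.comp (cb'.comp kb'), ?_, ?_, ?_, ?_⟩
  · intro z hz
    simp only [Function.comp]
    rw [cone_sphere (ks hz)]
    simp only [hn, Function.comp]
    rw [Fk _ (Or.inl hz), Fk' _ (Or.inl (m hz))]
  · intro z hz
    simp only [Function.comp]
    rw [cone_sphere (ks' hz)]
    simp only [hn', Function.comp]
    rw [Fk' _ (Or.inl hz), Fk _ (Or.inl (m' hz))]
  · intro z hz
    simp only [Function.comp]
    rw [k2' _ (cc (kc hz)), cone_cone nm ni, Fk z hz]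
  · intro z hz
    simp only [Function.comp]
    rw [k2 _ (cc' (kc' hz)), cone_cone nm' ni', Fk' z hz]

lemma jord_arcs {e1 e2 : ℝ → ℂ} (c1 : ContinuousOn e1 (Icc 0 1)) (c2 : ContinuousOn e2 (Icc 0 1))
    (i1 : InjOn e1 (Icc 0 1)) (i2 : InjOn e2 (Icc 0 1)) (h0 : e1 0 = e2 0) (h1 : e1 1 = e2 1)
    (hd : ∀ s ∈ Icc (0:ℝ) 1, ∀ t ∈ Icc (0:ℝ) 1, e1 s = e2 t → s = t ∧ (s = 0 ∨ s = 1)) :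
    IsJord (e1 '' Icc 0 1 ∪ e2 '' Icc 0 1) := by
  set τ : ℂ → ℝ := fun z => (1 - z.re) / 2 with hτ
  have key : ∀ z ∈ sphere (0:ℂ) 1, z.re ^ 2 + z.im ^ 2 = 1 := fun z hz => by
    have h : ‖z‖ = 1 := by simpa using hz
    have := Complex.sq_norm z
    rw [h, Complex.normSq_apply] at this; linarith
  have tI : ∀ z ∈ sphere (0:ℂ) 1, τ z ∈ Icc (0:ℝ) 1 := fun z hz => by
    have := key z hz
    constructor <;> simp only [hτ] <;> nlinarith
  have hτc : Continuous τ := by fun_prop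
  set A : Set ℂ := sphere 0 1 ∩ {z | 0 ≤ z.im}
  set B : Set ℂ := sphere 0 1 ∩ {z | z.im ≤ 0}
  have hAc : IsClosed A := isClosed_sphere.inter (isClosed_le continuous_const Complex.continuous_im)
  have hBc : IsClosed B := isClosed_sphere.inter (isClosed_le Complex.continuous_im continuous_const)
  have hAB : A ∪ B = sphere 0 1 := by
    rw [← inter_union_distrib_left]
    exact inter_eq_left.2 fun z _ => le_total 0 z.im
  obtain ⟨j, j1, j2, j3⟩ := glue_cont hAc hBc (c1.comp hτc.continuousOn fun z hz => tI z hz.1)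
    (c2.comp hτc.continuousOn fun z hz => tI z hz.1) (by
      rintro z ⟨⟨hz, hz1⟩, -, hz2⟩
      have h3 : z.im = 0 := le_antisymm hz2 hz1
      have := key z hz
      rw [h3] at this
      have h4 : z.re = 1 ∨ z.re = -1 := by
        have h5 : (z.re - 1) * (z.re + 1) = 0 := by linarith
        rcases mul_eq_zero.1 h5 with h5 | h5
        · left; linarith
        · right; linarith
      rcases h4 with h4 | h4
      · simp [hτ, h4, h0]
      · simp [hτ, h4]; exact h1)
  rw [hAB] at j1
  have hsplit : ∀ z ∈ sphere (0:ℂ) 1, z ∈ A ∨ z ∈ B := fun z hz => by rwa [← hAB] at hz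
  have hre : ∀ z w : ℂ, τ z = τ w → z.re = w.re := fun z w h => by simp only [hτ] at h; linarith
  refine ⟨j, j1, ?_, Subset.antisymm ?_ ?_⟩
  · intro z hz w hw hzw
    have kz := key z hz
    have kw := key w hw
    have fin : τ z = τ w → z.im * w.im ≥ 0 → z = w := fun h h' => by
      have hr := hre z w h
      refine Complex.ext hr ?_
      have : z.im ^ 2 = w.im ^ 2 := by rw [hr] at kz; linarith
      rcases sq_eq_sq_iff_eq_or_eq_neg.1 this with h | h
      · exact h
      · rw [h] at h' ⊢; nlinarith
    have fin2 : τ z = τ w → (τ z = 0 ∨ τ z = 1) → z = w := fun h h' => by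
      refine fin h ?_
      have : z.im = 0 := by
        have : z.re ^ 2 = 1 := by
          rcases h' with h' | h' <;> simp only [hτ] at h'
          · rw [show z.re = 1 by linarith]; norm_num
          · rw [show z.re = -1 by linarith]; norm_num
        nlinarith
      rw [this]; simp
    rcases hsplit z hz with hA | hB <;> rcases hsplit w hw with hA' | hB'
    · rw [j2 hA, j2 hA'] at hzw
      exact fin (i1 (tI z hz) (tI w hw) hzw) (mul_nonneg hA.2 hA'.2)
    · rw [j2 hA, j3 hB'] at hzw
      have := hd _ (tI z hz) _ (tI w hw) hzw
      exact fin2 this.1 this.2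
    · rw [j3 hB, j2 hA'] at hzw
      have := hd _ (tI w hw) _ (tI z hz) hzw.symm
      exact fin2 this.1.symm (this.1 ▸ this.2)
    · rw [j3 hB, j3 hB'] at hzw
      exact fin (i2 (tI z hz) (tI w hw) hzw) (mul_nonneg_of_nonpos_of_nonpos hB.2 hB'.2)
  · rintro _ ⟨z, hz, rfl⟩
    rcases hsplit z hz with hA | hB
    · rw [j2 hA]; exact Or.inl ⟨_, tI z hz, rfl⟩
    · rw [j3 hB]; exact Or.inr ⟨_, tI z hz, rfl⟩
  · have hp : ∀ t ∈ Icc (0:ℝ) 1, ∀ s : ℝ, s ^ 2 = 1 - (1 - 2 * t) ^ 2 →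
        (⟨1 - 2 * t, s⟩ : ℂ) ∈ sphere (0:ℂ) 1 ∧ τ ⟨1 - 2 * t, s⟩ = t := fun t ht s hs => by
      constructor
      · rw [mem_sphere, dist_zero_right, ← sq_eq_sq₀ (norm_nonneg _) zero_le_one, Complex.sq_norm,
          Complex.normSq_apply]
        simp only; nlinarith
      · simp only [hτ]; ring
    have hpos : ∀ t ∈ Icc (0:ℝ) 1, 0 ≤ 1 - (1 - 2 * t) ^ 2 := fun t ht => by nlinarith [ht.1, ht.2]
    rintro _ (⟨t, ht, rfl⟩ | ⟨t, ht, rfl⟩)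
    · obtain ⟨h3, h4⟩ := hp t ht _ (Real.sq_sqrt (hpos t ht))
      refine ⟨_, h3, ?_⟩
      rw [j2 ⟨h3, Real.sqrt_nonneg _⟩]
      simp only [Function.comp, h4]
    · obtain ⟨h3, h4⟩ := hp t ht (-√(1 - (1 - 2 * t) ^ 2)) (by rw [neg_sq]; exact Real.sq_sqrt (hpos t ht))
      refine ⟨_, h3, ?_⟩
      rw [j3 ⟨h3, neg_nonpos.2 (Real.sqrt_nonneg _)⟩]
      simp only [Function.comp, h4]

structure Cut (C : Set ℂ) (e : ℝ → ℂ) : Prop where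
  c : ContinuousOn e (Icc 0 1)
  i : InjOn e (Icc 0 1)
  f0 : e 0 ∈ frontier C
  f1 : e 1 ∈ frontier C
  int : ∀ t ∈ Ioo (0:ℝ) 1, e t ∈ interior C

lemma i01 {t : ℝ} (ht : t ∈ Icc (0:ℝ) 1) : t = 0 ∨ t = 1 ∨ t ∈ Ioo (0:ℝ) 1 := by
  rcases eq_or_lt_of_le ht.1 with h | h
  · exact Or.inl h.symm
  rcases eq_or_lt_of_le ht.2 with h' | h'
  · exact Or.inr (Or.inl h')
  · exact Or.inr (Or.inr ⟨h, h'⟩)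

lemma z01 : (0:ℝ) ∈ Icc (0:ℝ) 1 := ⟨le_rfl, zero_le_one⟩
lemma o01 : (1:ℝ) ∈ Icc (0:ℝ) 1 := ⟨zero_le_one, le_rfl⟩

lemma lg_out {X : Set ℂ} (hX : X ⊆ closedBall 0 1) {w : ℂ} (hw : 1 ≤ ‖w‖) (hwX : w ∉ X) :
    HasLg (fun z => z - w) X := by
  have hw0 : w ≠ 0 := by rintro rfl; simp at hw; linarith
  refine ((HasLg.slit (g := fun z => 1 - z / w) (by fun_prop) fun z hz => ?_).mul
    (HasLg.const (neg_ne_zero.2 hw0) X)).congr fun z hz => ?_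
  · have h1 : ‖z / w‖ ≤ 1 := by
      rw [norm_div]; exact div_le_one_of_le₀ ((by simpa using hX hz : ‖z‖ ≤ 1).trans hw) (norm_nonneg _)
    have h2 : z / w ≠ 1 := fun h => hwX (by rw [div_eq_one_iff_eq hw0] at h; exact h ▸ hz)
    left
    simp only [Complex.sub_re, Complex.one_re, sub_pos]
    refine lt_of_le_of_ne ((Complex.re_le_norm _).trans h1) fun h3 => h2 ?_
    have h4 := Complex.sq_norm (z / w)
    rw [Complex.normSq_apply, h3] at h4
    refine Complex.ext h3 ?_
    have : ‖z / w‖ ^ 2 ≤ 1 := by nlinarith [norm_nonneg (z / w)]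
    rw [Complex.one_im]
    nlinarith
  · simp only; field_simp; ring

lemma no_lg_ball {w : ℂ} (hw : ‖w‖ < 1) : ¬ HasLg (fun z => z - w) (sphere 0 1) := by
  intro h
  have h1 : HasLg (fun z => (z - 0) / (z - w)) (sphere (0:ℂ) 1) :=
    lg_of_conn isClosed_sphere (convex_ball (0:ℂ) 1).isPreconnected
      (fun z hz hz' => by simp at hz hz'; linarith) (by simp) (by simpa using hw)
  refine no_lg_circle one_pos 0 ((h1.mul h).congr fun z hz => div_mul_cancel₀ _ ?_)
  rw [sub_ne_zero]; rintro rfl; simp at hz; linarith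

lemma IsJord.facts {J : Set ℂ} (hJ : IsJord J) : IsCompact (J ∪ ins J) ∧ IsPreconnected (ins J) ∧
    IsOpen (ins J) ∧ J ⊆ closure (ins J) ∧ frontier (ins J) ⊆ J ∧ (ins J).Nonempty := by
  obtain ⟨F, f1, f2, f3, f4, f5⟩ := hJ.disc
  have hK : IsCompact (J ∪ ins J) := by
    rw [← f4, ← f3, ← image_union, sphere_union_ball]
    exact (isCompact_closedBall _ _).image_of_continuousOn f1
  refine ⟨hK, ?_, f5, ?_, ?_, ?_⟩
  · rw [← f4]
    exact (convex_ball (0:ℂ) 1).isPreconnected.image _ (f1.mono ball_subset_closedBall)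
  · rw [← f4, ← f3]
    refine (image_mono sphere_subset_closedBall).trans ?_
    rw [← closure_ball (0:ℂ) one_ne_zero] at f1 ⊢
    exact f1.image_closure
  · intro z hz
    have h1 : z ∈ J ∪ ins J := closure_minimal subset_union_right hK.isClosed hz.1
    refine h1.resolve_right fun h => hz.2 ?_
    rwa [f5.interior_eq]
  · rw [← f4]; exact ⟨_, 0, by simp, rfl⟩

lemma circ_arcs {p q : ℂ} (hp : p ∈ sphere (0:ℂ) 1) (hq : q ∈ sphere (0:ℂ) 1) (hpq : p ≠ q) :
    ∃ α β : ℝ → ℂ, Continuous α ∧ Continuous β ∧ InjOn α (Icc 0 1) ∧ InjOn β (Icc 0 1) ∧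
      α 0 = p ∧ α 1 = q ∧ β 0 = p ∧ β 1 = q ∧ α '' Icc 0 1 ∪ β '' Icc 0 1 = sphere 0 1 ∧
      ∀ s ∈ Icc (0:ℝ) 1, ∀ t ∈ Icc (0:ℝ) 1, α s = β t → s = t ∧ (s = 0 ∨ s = 1) := by
  obtain ⟨s, -, rfl⟩ := sphere_param hp 0
  obtain ⟨t, ht, rfl⟩ := sphere_param hq s
  have hst : s < t := lt_of_le_of_ne ht.1 (by rintro rfl; exact hpq rfl)
  have ht2 := ht.2
  have hper : Complex.exp (((s + 2 * Real.pi : ℝ) : ℂ) * Complex.I) = Complex.exp (s * Complex.I) := by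
    push_cast; rw [add_mul, Complex.exp_add, Complex.exp_two_pi_mul_I, mul_one]
  have hinj : ∀ a ∈ Ioc s (s + 2 * Real.pi), ∀ b ∈ Ioc s (s + 2 * Real.pi),
      Complex.exp (a * Complex.I) = Complex.exp (b * Complex.I) → a = b := fun a ha b hb hab => by
    have hneg : ∀ x : ℝ, Complex.exp (((-x : ℝ) : ℂ) * Complex.I) = (Complex.exp (x * Complex.I))⁻¹ := fun x => by
      rw [← Complex.exp_neg]; push_cast; ring_nf
    have := expI_inj (s := -a) (t := -b) (u := -(s + 2 * Real.pi)) ⟨by linarith [ha.2], by linarith [ha.1]⟩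
      ⟨by linarith [hb.2], by linarith [hb.1]⟩ (by rw [hneg, hneg, hab])
    linarith
  have hpi := Real.pi_pos
  refine ⟨fun x => Complex.exp ((s + x * (t - s) : ℝ) * Complex.I),
    fun x => Complex.exp ((s + 2 * Real.pi - x * (s + 2 * Real.pi - t) : ℝ) * Complex.I), by fun_prop, by fun_prop,
    ?_, ?_, by simp, by simp, ?_, by simp, Subset.antisymm ?_ ?_, ?_⟩
  · intro x hx y hy hxy
    have := expI_inj (u := s) ⟨by nlinarith [hx.1], by nlinarith [hx.2]⟩ ⟨by nlinarith [hy.1], by nlinarith [hy.2]⟩ hxy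
    exact mul_right_cancel₀ (sub_ne_zero.2 hst.ne') (by linarith)
  · intro x hx y hy hxy
    have := hinj _ ⟨by nlinarith [hx.2], by nlinarith [hx.1]⟩ _ ⟨by nlinarith [hy.2], by nlinarith [hy.1]⟩ hxy
    exact mul_right_cancel₀ (sub_ne_zero.2 ht2.ne') (by linarith)
  · simp only [zero_mul, sub_zero]; exact hper
  · rintro _ (⟨x, -, rfl⟩ | ⟨x, -, rfl⟩) <;> exact sphere_expI _
  · intro z hz
    obtain ⟨u, hu, rfl⟩ := sphere_param hz s
    rcases le_total u t with h | h
    · refine Or.inl ⟨(u - s) / (t - s), ⟨div_nonneg (by linarith [hu.1]) (by linarith), div_le_one_of_le₀ (by linarith) (by linarith)⟩, ?_⟩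
      simp only; rw [div_mul_cancel₀ _ (by linarith)]; congr 3; ring
    · refine Or.inr ⟨(s + 2 * Real.pi - u) / (s + 2 * Real.pi - t), ⟨div_nonneg (by linarith [hu.2]) (by linarith), div_le_one_of_le₀ (by linarith) (by linarith)⟩, ?_⟩
      simp only; rw [div_mul_cancel₀ _ (by linarith)]; congr 3; ring
  · intro x hx y hy hxy
    simp only at hxy
    rcases eq_or_lt_of_le hx.1 with h | h
    · subst h
      have : Complex.exp (((s + 2 * Real.pi : ℝ) : ℂ) * Complex.I) = Complex.exp ((s + 2 * Real.pi - y * (s + 2 * Real.pi - t) : ℝ) * Complex.I) := by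
        rw [← hxy, hper]; simp
      have := hinj _ ⟨by linarith, by linarith⟩ _ ⟨by nlinarith [hy.2], by nlinarith [hy.1]⟩ this
      have h2 : y * (s + 2 * Real.pi - t) = 0 := by linarith
      rcases mul_eq_zero.1 h2 with h2 | h2
      · exact ⟨h2.symm, Or.inl rfl⟩
      · linarith
    · have := hinj _ ⟨by nlinarith, by nlinarith [hx.2]⟩ _ ⟨by nlinarith [hy.2], by nlinarith [hy.1]⟩ hxy
      have h1 : x * (t - s) ≤ t - s := by nlinarith [hx.2]
      have h2 : y * (s + 2 * Real.pi - t) ≤ s + 2 * Real.pi - t := by nlinarith [hy.2]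
      have h3 : x * (t - s) = 1 * (t - s) := by linarith
      have h4 : y * (s + 2 * Real.pi - t) = 1 * (s + 2 * Real.pi - t) := by linarith
      have h5 := mul_right_cancel₀ (by linarith) h3
      have h6 := mul_right_cancel₀ (by linarith) h4
      exact ⟨h5.trans h6.symm, Or.inr h5⟩

lemma Cut.sph {e : ℝ → ℂ} (h : Cut (closedBall 0 1) e) {t : ℝ} (ht : t ∈ Icc (0:ℝ) 1)
    (hs : e t ∈ sphere (0:ℂ) 1) : t = 0 ∨ t = 1 := by
  rcases i01 ht with h0 | h0 | h0
  · exact Or.inl h0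
  · exact Or.inr h0
  · have := h.int t h0
    rw [interior_closedBall _ one_ne_zero] at this
    simp at hs this; linarith

lemma Cut.sub {e : ℝ → ℂ} (h : Cut (closedBall 0 1) e) : e '' Icc 0 1 ⊆ closedBall 0 1 := by
  rintro _ ⟨t, ht, rfl⟩
  rcases i01 ht with rfl | rfl | h0
  · exact isClosed_closedBall.frontier_subset h.f0
  · exact isClosed_closedBall.frontier_subset h.f1
  · exact interior_subset (h.int t h0)

lemma theta_one {e α : ℝ → ℂ} (h : Cut (closedBall 0 1) e) (ac : Continuous α) (ai : InjOn α (Icc 0 1))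
    (a0 : α 0 = e 0) (a1 : α 1 = e 1) (as : α '' Icc 0 1 ⊆ sphere 0 1) :
    IsJord (α '' Icc 0 1 ∪ e '' Icc 0 1) ∧ α '' Icc 0 1 ∪ e '' Icc 0 1 ⊆ closedBall 0 1 ∧
    ins (α '' Icc 0 1 ∪ e '' Icc 0 1) ⊆ ball 0 1 := by
  have hsub : α '' Icc 0 1 ∪ e '' Icc 0 1 ⊆ closedBall 0 1 :=
    union_subset (as.trans sphere_subset_closedBall) h.sub
  refine ⟨jord_arcs ac.continuousOn h.c ai h.i a0 a1 ?_, hsub, ?_⟩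
  · intro s hs t ht hst
    have h1 : e t ∈ sphere (0:ℂ) 1 := hst ▸ as ⟨s, hs, rfl⟩
    rcases h.sph ht h1 with rfl | rfl
    · have := ai hs z01 (hst.trans a0.symm); exact ⟨this, Or.inl this⟩
    · have := ai hs o01 (hst.trans a1.symm); exact ⟨this, Or.inr this⟩
  · rintro w ⟨hw1, hw2⟩
    by_contra hc
    exact hw2 (lg_out hsub (by simpa using hc) hw1)

lemma theta {e α β : ℝ → ℂ} (h : Cut (closedBall 0 1) e) (ac : Continuous α) (bc : Continuous β)
    (ai : InjOn α (Icc 0 1)) (bi : InjOn β (Icc 0 1)) (a0 : α 0 = e 0) (a1 : α 1 = e 1)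
    (b0 : β 0 = e 0) (b1 : β 1 = e 1) (ab : α '' Icc 0 1 ∪ β '' Icc 0 1 = sphere 0 1)
    (hd : ∀ s ∈ Icc (0:ℝ) 1, ∀ t ∈ Icc (0:ℝ) 1, α s = β t → s = t ∧ (s = 0 ∨ s = 1))
    {J1 J2 : Set ℂ} (hJ1 : J1 = α '' Icc 0 1 ∪ e '' Icc 0 1) (hJ2 : J2 = β '' Icc 0 1 ∪ e '' Icc 0 1) :
    IsJord J1 ∧ IsJord J2 ∧ closedBall 0 1 = (J1 ∪ ins J1) ∪ (J2 ∪ ins J2) ∧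
    (J1 ∪ ins J1) ∩ (J2 ∪ ins J2) ⊆ e '' Icc 0 1 := by
  have as : α '' Icc 0 1 ⊆ sphere 0 1 := ab ▸ subset_union_left
  have bs : β '' Icc 0 1 ⊆ sphere 0 1 := ab ▸ subset_union_right
  obtain ⟨j1, s1, n1⟩ := theta_one h ac ai a0 a1 as
  obtain ⟨j2, s2, n2⟩ := theta_one h bc bi b0 b1 bs
  rw [← hJ1] at j1 s1 n1
  rw [← hJ2] at j2 s2 n2
  have hJJ : J1 ∩ J2 = e '' Icc 0 1 := by
    rw [hJ1, hJ2, ← inter_union_distrib_right]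
    refine union_eq_right.2 ?_
    rintro z ⟨⟨s, hs, rfl⟩, t, ht, hst⟩
    rcases (hd s hs t ht hst.symm).2 with rfl | rfl
    · exact a0 ▸ ⟨0, z01, rfl⟩
    · exact a1 ▸ ⟨1, o01, rfl⟩
  have hsph : sphere (0:ℂ) 1 ⊆ J1 ∪ J2 := by
    rw [← ab, hJ1, hJ2]; exact union_subset_union subset_union_left subset_union_left
  have hse1 : ∀ z ∈ J1, z ∈ ball (0:ℂ) 1 → z ∈ e '' Icc 0 1 := fun z hz hb => by
    rw [hJ1] at hz
    refine hz.resolve_left fun h' => ?_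
    have := as h'; simp at hb this; linarith
  have hse2 : ∀ z ∈ J2, z ∈ ball (0:ℂ) 1 → z ∈ e '' Icc 0 1 := fun z hz hb => by
    rw [hJ2] at hz
    refine hz.resolve_left fun h' => ?_
    have := bs h'; simp at hb this; linarith
  have hor : ∀ w ∈ ball (0:ℂ) 1, w ∉ e '' Icc 0 1 → w ∈ ins J1 ∨ w ∈ ins J2 := by
    intro w hw hwe
    by_contra hc
    push Not at hc
    have l1 : HasLg (fun z => z - w) J1 := by
      by_contra h'; exact hc.1 ⟨fun h'' => hwe (hse1 w h'' hw), h'⟩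
    have l2 : HasLg (fun z => z - w) J2 := by
      by_contra h'; exact hc.2 ⟨fun h'' => hwe (hse2 w h'' hw), h'⟩
    refine no_lg_ball (by simpa using hw)
      ((HasLg.glue j1.compact.isClosed j2.compact.isClosed ?_ l1 l2).mono hsph)
    rw [hJJ]
    exact isPreconnected_Icc.image _ h.c
  obtain ⟨p1, p2, p3, p4, p5, p6⟩ := j1.facts
  obtain ⟨q1, q2, q3, q4, q5, q6⟩ := j2.facts
  have e1 : e '' Icc 0 1 ⊆ J1 := hJ1 ▸ subset_union_right
  have e2 : e '' Icc 0 1 ⊆ J2 := hJ2 ▸ subset_union_right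
  have hdis : ∀ w ∈ ins J1, w ∉ ins J2 := by
    intro w hw1 hw2
    have h12 : ins J1 ⊆ ins J2 := precon_sub p2 (fun z hz hz1 =>
      hz1.1 (e1 (hse2 z (q5 hz) (n1 hz1)))) hw1 hw2
    have hm : α (1/2) ∈ J2 ∪ ins J2 := by
      refine closure_minimal (h12.trans subset_union_right) q1.isClosed (p4 ?_)
      rw [hJ1]; exact Or.inl ⟨1/2, by norm_num, rfl⟩
    have hms : α (1/2) ∈ sphere (0:ℂ) 1 := as ⟨1/2, by norm_num, rfl⟩
    rcases hm with hm | hm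
    · rw [hJ2] at hm
      rcases hm with ⟨t, ht, hte⟩ | ⟨t, ht, hte⟩
      · have := (hd (1/2) (by norm_num) t ht hte.symm).2; norm_num at this
      · rcases h.sph ht (hte ▸ hms) with rfl | rfl
        · have := ai z01 (by norm_num) (a0.trans hte); norm_num at this
        · have := ai o01 (by norm_num) (a1.trans hte); norm_num at this
    · have := n2 hm; simp at hms this; linarith
  refine ⟨j1, j2, Subset.antisymm ?_ ?_, ?_⟩
  · intro z hz
    rw [← ball_union_sphere] at hz
    rcases hz with hz | hz
    · by_cases hze : z ∈ e '' Icc 0 1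
      · exact Or.inl (Or.inl (e1 hze))
      · exact (hor z hz hze).imp Or.inr Or.inr
    · exact (hsph hz).imp Or.inl Or.inl
  · exact union_subset (union_subset s1 (n1.trans ball_subset_closedBall))
      (union_subset s2 (n2.trans ball_subset_closedBall))
  · rintro z ⟨h1 | h1, h2 | h2⟩
    · rw [← hJJ]; exact ⟨h1, h2⟩
    · exact hse1 z h1 (n2 h2)
    · exact hse2 z h2 (n1 h1)
    · exact absurd h2 (hdis z h1)

lemma theta_map {e e' : ℝ → ℂ} (h : Cut (closedBall 0 1) e) (h' : Cut (closedBall 0 1) e')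
    (h0 : e 0 = e' 0) (h1 : e 1 = e' 1) :
    ∃ ψ : ℂ → ℂ, ContinuousOn ψ (sphere 0 1 ∪ e '' Icc 0 1) ∧ (∀ z ∈ sphere (0:ℂ) 1, ψ z = z) ∧
      ∀ t ∈ Icc (0:ℝ) 1, ψ (e t) = e' t := by
  obtain ⟨k, k1, k2⟩ := compact_inv isCompact_Icc h.c h.i
  obtain ⟨M, m1, m2, m3⟩ := glue_cont (A := sphere (0:ℂ) 1) (B := e '' Icc 0 1) (L := id) (L' := e' ∘ k)
    isClosed_sphere (arc_compact h.c).isClosed continuousOn_id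
    (h'.c.comp k1 (by rintro _ ⟨t, ht, rfl⟩; rwa [k2 t ht])) (by
      rintro _ ⟨hz, t, ht, rfl⟩
      simp only [id, Function.comp, k2 t ht]
      rcases h.sph ht hz with rfl | rfl <;> assumption)
  refine ⟨M, m1, fun z hz => m2 hz, fun t ht => ?_⟩
  rw [m3 ⟨t, ht, rfl⟩, Function.comp, k2 t ht]

lemma T_disc_aux {e e' : ℝ → ℂ} (h : Cut (closedBall 0 1) e) (h' : Cut (closedBall 0 1) e')
    (h0 : e 0 = e' 0) (h1 : e 1 = e' 1) :
    ∃ M M' : ℂ → ℂ, ContinuousOn M (closedBall 0 1) ∧ ContinuousOn M' (closedBall 0 1) ∧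
      MapsTo M (closedBall 0 1) (closedBall 0 1) ∧ MapsTo M' (closedBall 0 1) (closedBall 0 1) ∧
      (∀ z ∈ sphere (0:ℂ) 1, M z = z) ∧ (∀ z ∈ sphere (0:ℂ) 1, M' z = z) ∧
      (∀ z ∈ closedBall (0:ℂ) 1, M' (M z) = z) ∧ (∀ z ∈ closedBall (0:ℂ) 1, M (M' z) = z) ∧
      ∀ t ∈ Icc (0:ℝ) 1, M (e t) = e' t := by
  have hf0 := h.f0
  have hf1 := h.f1
  rw [frontier_closedBall _ one_ne_zero] at hf0 hf1
  obtain ⟨α, β, ac, bc, ai, bi, a0, a1, b0, b1, ab, hd⟩ := circ_arcs hf0 hf1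
    (fun hc => by have := h.i z01 o01 hc; norm_num at this)
  have as : α '' Icc 0 1 ⊆ sphere 0 1 := ab ▸ subset_union_left
  have bs : β '' Icc 0 1 ⊆ sphere 0 1 := ab ▸ subset_union_right
  obtain ⟨j1, j2, hcb, hin⟩ := theta h ac bc ai bi a0 a1 b0 b1 ab hd rfl rfl
  obtain ⟨j1', j2', hcb', hin'⟩ := theta h' ac bc ai bi (a0.trans h0) (a1.trans h1) (b0.trans h0)
    (b1.trans h1) ab hd rfl rfl
  obtain ⟨ψ, c, cs, ce⟩ := theta_map h h' h0 h1
  obtain ⟨ψ', c', cs', ce'⟩ := theta_map h' h h0.symm h1.symm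
  have side : ∀ γ : Set ℂ, γ ⊆ sphere 0 1 → IsJord (γ ∪ e '' Icc 0 1) → IsJord (γ ∪ e' '' Icc 0 1) →
      ∃ G G' : ℂ → ℂ, ContinuousOn G ((γ ∪ e '' Icc 0 1) ∪ ins (γ ∪ e '' Icc 0 1)) ∧
        ContinuousOn G' ((γ ∪ e' '' Icc 0 1) ∪ ins (γ ∪ e' '' Icc 0 1)) ∧
        MapsTo G ((γ ∪ e '' Icc 0 1) ∪ ins (γ ∪ e '' Icc 0 1)) ((γ ∪ e' '' Icc 0 1) ∪ ins (γ ∪ e' '' Icc 0 1)) ∧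
        MapsTo G' ((γ ∪ e' '' Icc 0 1) ∪ ins (γ ∪ e' '' Icc 0 1)) ((γ ∪ e '' Icc 0 1) ∪ ins (γ ∪ e '' Icc 0 1)) ∧
        EqOn G ψ (γ ∪ e '' Icc 0 1) ∧ EqOn G' ψ' (γ ∪ e' '' Icc 0 1) ∧
        (∀ z ∈ (γ ∪ e '' Icc 0 1) ∪ ins (γ ∪ e '' Icc 0 1), G' (G z) = z) ∧
        (∀ z ∈ (γ ∪ e' '' Icc 0 1) ∪ ins (γ ∪ e' '' Icc 0 1), G (G' z) = z) := by
    intro γ hγ j j'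
    have m : MapsTo ψ (γ ∪ e '' Icc 0 1) (γ ∪ e' '' Icc 0 1) := by
      rintro _ (hz | ⟨t, ht, rfl⟩)
      · rw [cs _ (hγ hz)]; exact Or.inl hz
      · rw [ce t ht]; exact Or.inr ⟨t, ht, rfl⟩
    have m' : MapsTo ψ' (γ ∪ e' '' Icc 0 1) (γ ∪ e '' Icc 0 1) := by
      rintro _ (hz | ⟨t, ht, rfl⟩)
      · rw [cs' _ (hγ hz)]; exact Or.inl hz
      · rw [ce' t ht]; exact Or.inr ⟨t, ht, rfl⟩
    obtain ⟨G, G', g1, g2, g3, g4, g5, g6, g7, g8⟩ := schoen j j' (c.mono (union_subset_union_left _ hγ))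
      (c'.mono (union_subset_union_left _ hγ)) m m' (by
        rintro _ (hz | ⟨t, ht, rfl⟩)
        · rw [cs _ (hγ hz), cs' _ (hγ hz)]
        · rw [ce t ht, ce' t ht]) (by
        rintro _ (hz | ⟨t, ht, rfl⟩)
        · rw [cs' _ (hγ hz), cs _ (hγ hz)]
        · rw [ce' t ht, ce t ht])
    refine ⟨G, G', g1, g2, ?_, ?_, g5, g6, g7, g8⟩
    · rintro z (hz | hz)
      · rw [g5 hz]; exact Or.inl (m hz)
      · exact Or.inr (g3 hz)
    · rintro z (hz | hz)
      · rw [g6 hz]; exact Or.inl (m' hz)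
      · exact Or.inr (g4 hz)
  obtain ⟨G, G', g1, g2, g3, g4, g5, g6, g7, g8⟩ := side _ as j1 j1'
  obtain ⟨H, H', k1, k2, k3, k4, k5, k6, k7, k8⟩ := side _ bs j2 j2'
  set K1 := (α '' Icc 0 1 ∪ e '' Icc 0 1) ∪ ins (α '' Icc 0 1 ∪ e '' Icc 0 1)
  set K2 := (β '' Icc 0 1 ∪ e '' Icc 0 1) ∪ ins (β '' Icc 0 1 ∪ e '' Icc 0 1)
  set K1' := (α '' Icc 0 1 ∪ e' '' Icc 0 1) ∪ ins (α '' Icc 0 1 ∪ e' '' Icc 0 1)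
  set K2' := (β '' Icc 0 1 ∪ e' '' Icc 0 1) ∪ ins (β '' Icc 0 1 ∪ e' '' Icc 0 1)
  obtain ⟨M, m1, m2, m3⟩ := glue_cont j1.facts.1.isClosed j2.facts.1.isClosed g1 k1
    (fun z hz => by rw [g5 (Or.inr (hin hz)), k5 (Or.inr (hin hz))])
  obtain ⟨M', m1', m2', m3'⟩ := glue_cont j1'.facts.1.isClosed j2'.facts.1.isClosed g2 k2
    (fun z hz => by rw [g6 (Or.inr (hin' hz)), k6 (Or.inr (hin' hz))])
  have sp : ∀ z ∈ sphere (0:ℂ) 1, z ∈ α '' Icc 0 1 ∨ z ∈ β '' Icc 0 1 := fun z hz => by rwa [← ab] at hz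
  have hK : ∀ z ∈ closedBall (0:ℂ) 1, z ∈ K1 ∨ z ∈ K2 := fun z hz => by rwa [hcb] at hz
  have hK' : ∀ z ∈ closedBall (0:ℂ) 1, z ∈ K1' ∨ z ∈ K2' := fun z hz => by rwa [hcb'] at hz
  refine ⟨M, M', hcb ▸ m1, hcb' ▸ m1', ?_, ?_, ?_, ?_, ?_, ?_, ?_⟩
  · intro z hz
    rw [hcb']
    rcases hK z hz with hz | hz
    · rw [m2 hz]; exact Or.inl (g3 hz)
    · rw [m3 hz]; exact Or.inr (k3 hz)
  · intro z hz
    rw [hcb]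
    rcases hK' z hz with hz | hz
    · rw [m2' hz]; exact Or.inl (g4 hz)
    · rw [m3' hz]; exact Or.inr (k4 hz)
  · intro z hz
    rcases sp z hz with h | h
    · rw [m2 (Or.inl (Or.inl h)), g5 (Or.inl h), cs z hz]
    · rw [m3 (Or.inl (Or.inl h)), k5 (Or.inl h), cs z hz]
  · intro z hz
    rcases sp z hz with h | h
    · rw [m2' (Or.inl (Or.inl h)), g6 (Or.inl h), cs' z hz]
    · rw [m3' (Or.inl (Or.inl h)), k6 (Or.inl h), cs' z hz]
  · intro z hz
    rcases hK z hz with hz | hz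
    · rw [m2 hz, m2' (g3 hz), g7 z hz]
    · rw [m3 hz, m3' (k3 hz), k7 z hz]
  · intro z hz
    rcases hK' z hz with hz | hz
    · rw [m2' hz, m2 (g4 hz), g8 z hz]
    · rw [m3' hz, m3 (k4 hz), k8 z hz]
  · intro t ht
    have : e t ∈ α '' Icc 0 1 ∪ e '' Icc 0 1 := Or.inr ⟨t, ht, rfl⟩
    rw [m2 (Or.inl this), g5 this, ce t ht]

lemma T_disc {e e' : ℝ → ℂ} (h : Cut (closedBall 0 1) e) (h' : Cut (closedBall 0 1) e')
    (h0 : e 0 = e' 0) (h1 : e 1 = e' 1) :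
    ∃ f : ℂ ≃ₜ ℂ, (∀ z ∉ ball (0:ℂ) 1, f z = z) ∧ ∀ t ∈ Icc (0:ℝ) 1, f (e t) = e' t := by
  obtain ⟨M, M', c, c', m, m', s, s', i, i', ht⟩ := T_disc_aux h h' h0 h1
  have ext : ∀ M : ℂ → ℂ, ContinuousOn M (closedBall 0 1) → (∀ z ∈ sphere (0:ℂ) 1, M z = z) →
      ∃ N : ℂ → ℂ, Continuous N ∧ (∀ z ∈ closedBall (0:ℂ) 1, N z = M z) ∧ ∀ z ∉ ball (0:ℂ) 1, N z = z := by
    intro M c s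
    obtain ⟨N, n1, n2, n3⟩ := glue_cont (L' := id) isClosed_closedBall (isOpen_ball (x := (0:ℂ)) (ε := 1)).isClosed_compl c
      continuousOn_id (fun z hz => s z (by
        have h1 := hz.1; have h2 := hz.2; rw [← ball_union_sphere] at h1; exact h1.resolve_left h2))
    have : closedBall (0:ℂ) 1 ∪ (ball 0 1)ᶜ = univ := by
      rw [eq_univ_iff_forall]; intro z; by_cases hz : z ∈ ball (0:ℂ) 1
      · exact Or.inl (ball_subset_closedBall hz)
      · exact Or.inr hz
    rw [this, continuousOn_univ] at n1
    exact ⟨N, n1, n2, n3⟩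
  obtain ⟨N, n1, n2, n3⟩ := ext M c s
  obtain ⟨N', n1', n2', n3'⟩ := ext M' c' s'
  refine ⟨⟨⟨N, N', fun z => ?_, fun z => ?_⟩, n1, n1'⟩, n3, fun t htt => ?_⟩
  · by_cases hz : z ∈ ball (0:ℂ) 1
    · have hz := ball_subset_closedBall hz
      rw [n2 z hz, n2' _ (m hz), i z hz]
    · rw [n3 z hz, n3' z hz]
  · by_cases hz : z ∈ ball (0:ℂ) 1
    · have hz := ball_subset_closedBall hz
      rw [n2' z hz, n2 _ (m' hz), i' z hz]
    · rw [n3' z hz, n3 z hz]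
  · change N (e t) = e' t
    rw [n2 _ (h.sub ⟨t, htt, rfl⟩), ht t htt]

theorem T_conv {C : Set ℂ} (hC : Convex ℝ C) (hcp : IsCompact C) (hne : (interior C).Nonempty)
    {e e' : ℝ → ℂ} (h : Cut C e) (h' : Cut C e') (h0 : e 0 = e' 0) (h1 : e 1 = e' 1) :
    ∃ f : ℂ ≃ₜ ℂ, (∀ z ∉ interior C, f z = z) ∧ ∀ t ∈ Icc (0:ℝ) 1, f (e t) = e' t := by
  obtain ⟨g, g1, g2, g3⟩ := exists_homeomorph_image_interior_closure_frontier_eq_unitBall hC hne hcp.isBounded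
  have cut : ∀ e : ℝ → ℂ, Cut C e → Cut (closedBall 0 1) (g ∘ e) := fun e h =>
    ⟨g.continuous.comp_continuousOn h.c, g.injective.comp_injOn h.i, by
      rw [frontier_closedBall _ one_ne_zero, ← g3]; exact ⟨_, h.f0, rfl⟩, by
      rw [frontier_closedBall _ one_ne_zero, ← g3]; exact ⟨_, h.f1, rfl⟩, fun t ht => by
      rw [interior_closedBall _ one_ne_zero, ← g1]; exact ⟨_, h.int t ht, rfl⟩⟩
  obtain ⟨f, f1, f2⟩ := T_disc (cut e h) (cut e' h') (by simp [h0]) (by simp [h1])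
  refine ⟨(g.trans f).trans g.symm, fun z hz => ?_, fun t ht => ?_⟩
  · have : g z ∉ ball (0:ℂ) 1 := by
      rw [← g1]; rintro ⟨w, hw, hwz⟩; exact hz (g.injective hwz ▸ hw)
    simp [f1 _ this]
  · have := f2 t ht
    simp only [Function.comp] at this
    simp [this]

lemma glue_cont' {α β : Type*} [TopologicalSpace α] [TopologicalSpace β] {L L' : α → β} {A B : Set α}
    (hA : IsClosed A) (hB : IsClosed B)
    (h : ContinuousOn L A) (h' : ContinuousOn L' B) (he : ∀ z ∈ A ∩ B, L z = L' z) :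
    ∃ M, ContinuousOn M (A ∪ B) ∧ EqOn M L A ∧ EqOn M L' B := by
  classical
  have e1 : EqOn (A.piecewise L L') L A := fun z hz => by simp [hz]
  have e2 : EqOn (A.piecewise L L') L' B := fun z hz => by
    by_cases hzA : z ∈ A
    · simp [hzA, he z ⟨hzA, hz⟩]
    · simp [hzA]
  exact ⟨A.piecewise L L', (h.congr e1).union_of_isClosed (h'.congr e2) hA hB, e1, e2⟩

structure Good (s s2 : ℝ) (h : ℂ ≃ₜ ℂ) : Prop where
  lo : ∀ z : ℂ, z.im ≤ s → h z = z
  hi : ∀ z : ℂ, s2 ≤ z.im → h z = z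
  l : ∀ z : ℂ, z.re ≤ 0 → (h z).re = z.re
  r : ∀ z : ℂ, 1 ≤ z.re → (h z).re = z.re
  m : ∀ z : ℂ, 0 < z.re → z.re < 1 → 0 < (h z).re ∧ (h z).re < 1
  ml : ∀ z w : ℂ, z.re = 0 → w.re = 0 → z.im < w.im → (h z).im < (h w).im
  mr : ∀ z w : ℂ, z.re = 1 → w.re = 1 → z.im < w.im → (h z).im < (h w).im

namespace Good
variable {s s2 : ℝ} {h g : ℂ ≃ₜ ℂ}

lemma im (H : Good s s2 h) {z : ℂ} (h1 : s < z.im) (h2 : z.im < s2) : s < (h z).im ∧ (h z).im < s2 := by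
  constructor
  · by_contra hc
    have := h.injective (H.lo (h z) (by linarith))
    rw [this] at hc; exact hc h1
  · by_contra hc
    have := h.injective (H.hi (h z) (by linarith))
    rw [this] at hc; exact hc h2

lemma trans (H : Good s s2 h) (G : Good s s2 g) : Good s s2 (h.trans g) := by
  refine ⟨fun z hz => ?_, fun z hz => ?_, fun z hz => ?_, fun z hz => ?_, fun z h1 h2 => ?_,
    fun z w hz hw hzw => ?_, fun z w hz hw hzw => ?_⟩ <;> simp only [Homeomorph.trans_apply]
  · rw [H.lo z hz, G.lo z hz]
  · rw [H.hi z hz, G.hi z hz]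
  · rw [G.l _ (by rwa [H.l z hz]), H.l z hz]
  · rw [G.r _ (by rwa [H.r z hz]), H.r z hz]
  · have := H.m z h1 h2; exact G.m _ this.1 this.2
  · exact G.ml _ _ (by rw [H.l z hz.le, hz]) (by rw [H.l w hw.le, hw]) (H.ml z w hz hw hzw)
  · exact G.mr _ _ (by rw [H.r z hz.ge, hz]) (by rw [H.r w hw.ge, hw]) (H.mr z w hz hw hzw)

lemma mono {a b : ℝ} (H : Good s s2 h) (ha : a ≤ s) (hb : s2 ≤ b) : Good a b h :=
  ⟨fun z hz => H.lo z (hz.trans ha), fun z hz => H.hi z (hb.trans hz), H.l, H.r, H.m, H.ml, H.mr⟩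

lemma of_id (h : ℂ ≃ₜ ℂ) (hid : ∀ z : ℂ, ¬ (0 < z.re ∧ z.re < 1 ∧ s < z.im ∧ z.im < s2) → h z = z) :
    Good s s2 h := by
  refine ⟨fun z hz => hid z fun hc => by linarith [hc.2.2.1], fun z hz => hid z fun hc => by linarith [hc.2.2.2],
    fun z hz => by rw [hid z fun hc => by linarith [hc.1]], fun z hz => by rw [hid z fun hc => by linarith [hc.2.1]], fun z h1 h2 => ?_,
    fun z w hz hw hzw => ?_, fun z w hz hw hzw => ?_⟩
  · by_cases hc : h z = z
    · rw [hc]; exact ⟨h1, h2⟩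
    · by_contra hc2
      exact hc (h.injective (hid (h z) fun hc3 => hc2 ⟨hc3.1, hc3.2.1⟩))
  · rwa [hid z fun hc => by linarith [hc.1], hid w fun hc => by linarith [hc.1]]
  · rwa [hid z fun hc => by linarith [hc.2.1], hid w fun hc => by linarith [hc.2.1]]

end Good

noncomputable def mu (k c : ℝ) : ℝ := k * c / (1 + (k - 1) * c)

lemma mu_den {k c : ℝ} (hk : 0 < k) (h0 : 0 ≤ c) (h1 : c ≤ 1) : 0 < 1 + (k - 1) * c := by
  rcases eq_or_lt_of_le h0 with rfl | h
  · simp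
  · nlinarith [mul_pos hk h]

lemma mu_mem {k c : ℝ} (hk : 0 < k) (hc : c ∈ Icc (0:ℝ) 1) : mu k c ∈ Icc (0:ℝ) 1 := by
  have := mu_den hk hc.1 hc.2
  refine ⟨div_nonneg (mul_nonneg hk.le hc.1) this.le, (div_le_one this).2 ?_⟩
  nlinarith [hc.2]

lemma mu_lt {k c d : ℝ} (hk : 0 < k) (hc : c ∈ Icc (0:ℝ) 1) (hd : d ∈ Icc (0:ℝ) 1) (h : c < d) :
    mu k c < mu k d := by
  rw [mu, mu, div_lt_div_iff₀ (mu_den hk hc.1 hc.2) (mu_den hk hd.1 hd.2)]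
  nlinarith [mul_pos hk (sub_pos.2 h)]

lemma mu_mu {k c : ℝ} (hk : 0 < k) (hc : c ∈ Icc (0:ℝ) 1) : mu k⁻¹ (mu k c) = c := by
  have h1 := (mu_den hk hc.1 hc.2).ne'
  have h2 := (mu_den (inv_pos.2 hk) (mu_mem hk hc).1 (mu_mem hk hc).2).ne'
  have h3 : mu k c * (1 + (k - 1) * c) = k * c := div_mul_cancel₀ _ h1
  rw [mu, div_eq_iff h2]
  field_simp
  linear_combination h3

lemma mu_ex {c d : ℝ} (hc : c ∈ Ioo (0:ℝ) 1) (hd : d ∈ Ioo (0:ℝ) 1) : ∃ k > 0, mu k c = d := by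
  obtain ⟨c0, c1⟩ := hc
  obtain ⟨d0, d1⟩ := hd
  have hk : 0 < d * (1 - c) / (c * (1 - d)) :=
    div_pos (mul_pos d0 (by linarith)) (mul_pos c0 (by linarith))
  refine ⟨_, hk, ?_⟩
  rw [mu, div_eq_iff (mu_den hk c0.le c1.le).ne']
  have : (1 - d) ≠ 0 := by linarith
  field_simp
  ring

noncomputable def cl (x : ℝ) : ℝ := max 0 (min x 1)

lemma cl_mem (x : ℝ) : cl x ∈ Icc (0:ℝ) 1 := ⟨le_max_left _ _, max_le zero_le_one (min_le_right _ _)⟩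
lemma cl_of {x : ℝ} (h : x ∈ Icc (0:ℝ) 1) : cl x = x := by rw [cl, min_eq_left h.2, max_eq_right h.1]
lemma cl_neg {x : ℝ} (h : x ≤ 0) : cl x = 0 := by rw [cl, min_eq_left (by linarith), max_eq_left h]
lemma cl_one {x : ℝ} (h : 1 ≤ x) : cl x = 1 := by rw [cl, min_eq_right h, max_eq_right zero_le_one]

lemma mu_zero (k : ℝ) : mu k 0 = 0 := by simp [mu]
lemma mu_one {k : ℝ} (hk : 0 < k) : mu k 1 = 1 := by simp [mu, hk.ne']

noncomputable def nu (k x : ℝ) : ℝ := x + (mu k (cl x) - cl x)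

lemma nu_nu {k : ℝ} (hk : 0 < k) (x : ℝ) : nu k⁻¹ (nu k x) = x := by
  rcases le_total x 0 with h | h
  · have : nu k x = x := by rw [nu, cl_neg h, mu_zero]; ring
    rw [this, nu, cl_neg h, mu_zero]; ring
  rcases le_total 1 x with h' | h'
  · have : nu k x = x := by rw [nu, cl_one h', mu_one hk]; ring
    rw [this, nu, cl_one h', mu_one (inv_pos.2 hk)]; ring
  · have : nu k x = mu k x := by rw [nu, cl_of ⟨h, h'⟩]; ring
    rw [this, nu, cl_of (mu_mem hk ⟨h, h'⟩), mu_mu hk ⟨h, h'⟩]; ring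

lemma nu_lt {k x y : ℝ} (hk : 0 < k) (h : x < y) : nu k x < nu k y := by
  have h1 : cl x ≤ cl y := max_le_max le_rfl (min_le_min h.le le_rfl)
  have h2 : x - cl x ≤ y - cl y := by
    rcases le_total x 0 with a | a
    · rw [cl_neg a]
      rcases le_total y 0 with b | b
      · rw [cl_neg b]; linarith
      rcases le_total 1 y with b' | b'
      · rw [cl_one b']; linarith
      · rw [cl_of ⟨b, b'⟩]; linarith
    rcases le_total 1 x with a' | a'
    · rw [cl_one a', cl_one (a'.trans h.le)]; linarith
    · rw [cl_of ⟨a, a'⟩]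
      rcases le_total 1 y with b' | b'
      · rw [cl_one b']; linarith
      · rw [cl_of ⟨a.trans h.le, b'⟩]; linarith
  unfold nu
  rcases eq_or_lt_of_le h1 with h3 | h3
  · rw [h3]; linarith
  · linarith [mu_lt hk (cl_mem x) (cl_mem y) h3]

lemma lam_ex {s s2 b t y y' : ℝ} (hb : b ∈ Ioo s s2) (ht : t ∈ Ioo s s2) (hy : y ∈ Ioo s s2) (hy' : y' ∈ Ioo s s2) :
    ∃ g : ℂ ≃ₜ ℂ, Good s s2 g ∧ (∀ z, (g z).re = z.re) ∧ g ⟨0, b⟩ = ⟨0, y⟩ ∧ g ⟨1, t⟩ = ⟨1, y'⟩ := by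
  have hW : 0 < s2 - s := by linarith [hb.1, hb.2]
  set c : ℝ → ℝ := fun v => (v - s) / (s2 - s) with hc
  have hcm : ∀ v ∈ Ioo s s2, c v ∈ Ioo (0:ℝ) 1 := fun v hv =>
    ⟨div_pos (by linarith [hv.1]) hW, (div_lt_one hW).2 (by linarith [hv.2])⟩
  have hcs : ∀ v, s + (s2 - s) * c v = v := fun v => by simp only [hc]; field_simp; ring
  have hsc : ∀ v, c (s + (s2 - s) * v) = v := fun v => by simp only [hc]; field_simp; ring
  obtain ⟨k0, k0p, hk0⟩ := mu_ex (hcm b hb) (hcm y hy)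
  obtain ⟨k1, k1p, hk1⟩ := mu_ex (hcm t ht) (hcm y' hy')
  set K : ℝ → ℝ := fun x => Real.exp (Real.log k0 + x * (Real.log k1 - Real.log k0)) with hK
  have hKp : ∀ x, 0 < K x := fun x => Real.exp_pos _
  have hKc : Continuous K := by fun_prop
  have hclc : Continuous cl := by unfold cl; fun_prop
  have hnG : ∀ K : ℝ → ℝ, Continuous K → (∀ x, 0 < K x) → Continuous fun p : ℝ × ℝ => nu (K p.1) p.2 := by
    intro K hKc hKp
    unfold nu mu
    refine continuous_snd.add (Continuous.sub (Continuous.div (by fun_prop) (by fun_prop) fun p => ?_) (by fun_prop))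
    exact (mu_den (hKp _) (cl_mem _).1 (cl_mem _).2).ne'
  have hnc := hnG K hKc hKp
  have hnc' := hnG (fun x => (K x)⁻¹) (hKc.inv₀ fun x => (hKp x).ne') fun x => inv_pos.2 (hKp x)
  have mk : ∀ u : ℝ × ℝ → ℝ, Continuous u → Continuous fun z : ℂ => (⟨z.re, s + (s2 - s) * u (z.re, c z.im)⟩ : ℂ) := by
    intro u hu
    have h1 : Continuous fun z : ℂ => u (z.re, c z.im) := hu.comp (by simp only [hc]; fun_prop)
    have : (fun z : ℂ => (⟨z.re, s + (s2 - s) * u (z.re, c z.im)⟩ : ℂ)) =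
        fun z : ℂ => (z.re : ℂ) + ((s + (s2 - s) * u (z.re, c z.im) : ℝ) : ℂ) * Complex.I := by
      ext z; exact (Complex.re_add_im _).symm
    rw [this]
    fun_prop
  let g : ℂ ≃ₜ ℂ := {
    toFun := fun z => ⟨z.re, s + (s2 - s) * nu (K z.re) (c z.im)⟩
    invFun := fun z => ⟨z.re, s + (s2 - s) * nu (K z.re)⁻¹ (c z.im)⟩
    left_inv := fun z => by
      simp only [hsc, nu_nu (hKp z.re), hcs]
    right_inv := fun z => by
      have := nu_nu (inv_pos.2 (hKp z.re)) (c z.im)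
      rw [inv_inv] at this
      simp only [hsc, this, hcs]
    continuous_toFun := mk _ hnc
    continuous_invFun := mk _ hnc' }
  have hg : ∀ z, g z = ⟨z.re, s + (s2 - s) * nu (K z.re) (c z.im)⟩ := fun z => rfl
  have hre : ∀ z, (g z).re = z.re := fun z => rfl
  have hcm' : ∀ v v', v < v' → c v < c v' := fun v v' h => by
    simp only [hc]; exact div_lt_div_of_pos_right (by linarith) hW
  have hmono : ∀ z w : ℂ, z.re = w.re → z.im < w.im → (g z).im < (g w).im := fun z w h h' => by
    simp only [hg, h]
    have := mul_lt_mul_of_pos_left (nu_lt (hKp w.re) (hcm' _ _ h')) hW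
    linarith
  have key : ∀ v k, 0 < k → v ∈ Ioo s s2 → nu k (c v) = mu k (c v) := fun v k _ hv => by
    rw [nu, cl_of (Ioo_subset_Icc_self (hcm v hv))]; ring
  refine ⟨g, ⟨fun z hz => ?_, fun z hz => ?_, fun z _ => rfl, fun z _ => rfl, fun z h1 h2 => ⟨h1, h2⟩,
    fun z w h1 h2 => hmono z w (h1.trans h2.symm), fun z w h1 h2 => hmono z w (h1.trans h2.symm)⟩, hre, ?_, ?_⟩
  · have : c z.im ≤ 0 := div_nonpos_of_nonpos_of_nonneg (by linarith) hW.le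
    rw [hg, nu, cl_neg this, mu_zero, sub_self, add_zero, hcs]
  · have : 1 ≤ c z.im := (one_le_div hW).2 (by linarith)
    rw [hg, nu, cl_one this, mu_one (hKp _), sub_self, add_zero, hcs]
  · have : K 0 = k0 := by simp [hK, Real.exp_log k0p]
    rw [hg]; simp only [this, key b k0 k0p hb, hk0, hcs]
  · have : K 1 = k1 := by simp [hK, Real.exp_log k1p]
    rw [hg]; simp only [this, key t k1 k1p ht, hk1, hcs]

structure RArc (s s2 : ℝ) (f : ℝ → ℂ) : Prop where
  c : ContinuousOn f (Icc 0 1)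
  i : InjOn f (Icc 0 1)
  f0 : (f 0).re = 0
  f1 : (f 1).re = 1
  m : ∀ t ∈ Ioo (0:ℝ) 1, 0 < (f t).re ∧ (f t).re < 1
  im : ∀ t ∈ Icc (0:ℝ) 1, s < (f t).im ∧ (f t).im < s2

lemma Good.rarc {s s2 : ℝ} {h : ℂ ≃ₜ ℂ} (H : Good s s2 h) {f : ℝ → ℂ} (F : RArc s s2 f) :
    RArc s s2 (fun t => h (f t)) :=
  ⟨h.continuous.comp_continuousOn F.c, fun t ht u hu e => F.i ht hu (h.injective e),
    by rw [H.l _ F.f0.le, F.f0], by rw [H.r _ F.f1.ge, F.f1],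
    fun t ht => H.m _ (F.m t ht).1 (F.m t ht).2, fun t ht => H.im (F.im t ht).1 (F.im t ht).2⟩

lemma RArc.re_mem {s s2 : ℝ} {f : ℝ → ℂ} (F : RArc s s2 f) {t : ℝ} (ht : t ∈ Icc (0:ℝ) 1) :
    (f t).re ∈ Icc (0:ℝ) 1 := by
  rcases i01 ht with rfl | rfl | h
  · rw [F.f0]; exact ⟨le_rfl, zero_le_one⟩
  · rw [F.f1]; exact ⟨zero_le_one, le_rfl⟩
  · exact ⟨(F.m t h).1.le, (F.m t h).2.le⟩

def rect (s s2 : ℝ) : Set ℂ := Icc (0:ℝ) 1 ×ℂ Icc s s2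

lemma rect_conv (s s2 : ℝ) : Convex ℝ (rect s s2) :=
  ((convex_Icc (0:ℝ) 1).linear_preimage Complex.reLm).inter ((convex_Icc s s2).linear_preimage Complex.imLm)
lemma rect_cpt (s s2 : ℝ) : IsCompact (rect s s2) := isCompact_Icc.reProdIm isCompact_Icc
lemma rect_int (s s2 : ℝ) : interior (rect s s2) = Ioo (0:ℝ) 1 ×ℂ Ioo s s2 := by
  rw [rect, Complex.interior_reProdIm, interior_Icc, interior_Icc]
lemma mem_rect {s s2 : ℝ} {z : ℂ} : z ∈ rect s s2 ↔ z.re ∈ Icc (0:ℝ) 1 ∧ z.im ∈ Icc s s2 := Iff.rfl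
lemma mem_rect_int {s s2 : ℝ} {z : ℂ} : z ∈ interior (rect s s2) ↔ z.re ∈ Ioo (0:ℝ) 1 ∧ z.im ∈ Ioo s s2 := by
  rw [rect_int]; rfl

lemma rect_ne {s s2 : ℝ} (h : s < s2) : (interior (rect s s2)).Nonempty :=
  ⟨⟨1/2, (s+s2)/2⟩, mem_rect_int.2 ⟨⟨by norm_num, by norm_num⟩, by constructor <;> simp only <;> linarith⟩⟩

lemma RArc.cut {s s2 : ℝ} {f : ℝ → ℂ} (F : RArc s s2 f) : Cut (rect s s2) f := by
  have hfr : ∀ z ∈ rect s s2, z ∉ interior (rect s s2) → z ∈ frontier (rect s s2) := fun z h1 h2 =>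
    ⟨subset_closure h1, h2⟩
  refine ⟨F.c, F.i, hfr _ ?_ ?_, hfr _ ?_ ?_, fun t ht => ?_⟩
  · have := F.im 0 z01
    exact ⟨F.re_mem z01, this.1.le, this.2.le⟩
  · intro h; have := (mem_rect_int.1 h).1.1; rw [F.f0] at this; exact lt_irrefl _ this
  · have := F.im 1 o01
    exact ⟨F.re_mem o01, this.1.le, this.2.le⟩
  · intro h; have := (mem_rect_int.1 h).1.2; rw [F.f1] at this; exact lt_irrefl _ this
  · exact mem_rect_int.2 ⟨F.m t ht, F.im t (Ioo_subset_Icc_self ht)⟩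

lemma line_rarc {s s2 y : ℝ} (hy : y ∈ Ioo s s2) : RArc s s2 (fun t => (⟨t, y⟩ : ℂ)) := by
  refine ⟨?_, fun t _ u _ e => by simpa using congrArg Complex.re e, rfl, rfl, fun t ht => ht, fun t _ => hy⟩
  have : (fun t : ℝ => (⟨t, y⟩ : ℂ)) = fun t : ℝ => (t : ℂ) + (y : ℂ) * Complex.I := by
    ext t; exact (Complex.re_add_im _).symm
  rw [this]; fun_prop

lemma T_rect {s s2 : ℝ} {f g : ℝ → ℂ} (F : RArc s s2 f) (G : RArc s s2 g) (h0 : f 0 = g 0) (h1 : f 1 = g 1) :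
    ∃ h : ℂ ≃ₜ ℂ, Good s s2 h ∧ ∀ t ∈ Icc (0:ℝ) 1, h (f t) = g t := by
  have hs : s < s2 := (F.im 0 z01).1.trans (F.im 0 z01).2
  obtain ⟨h, hid, he⟩ := T_conv (rect_conv s s2) (rect_cpt s s2) (rect_ne hs) F.cut G.cut h0 h1
  exact ⟨h, Good.of_id h fun z hz => hid z fun hc => hz (by
    have := mem_rect_int.1 hc; exact ⟨this.1.1, this.1.2, this.2.1, this.2.2⟩), he⟩

lemma RArc.str {s s2 y : ℝ} {f : ℝ → ℂ} (F : RArc s s2 f) (hy : y ∈ Ioo s s2) :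
    ∃ h : ℂ ≃ₜ ℂ, Good s s2 h ∧ ∀ t ∈ Icc (0:ℝ) 1, h (f t) = ⟨t, y⟩ := by
  obtain ⟨g, hg, -, g0, g1⟩ := lam_ex (F.im 0 z01) (F.im 1 o01) hy hy
  have e0 : g (f 0) = ⟨0, y⟩ := by rw [← g0]; congr 1; exact Complex.ext F.f0 rfl
  have e1 : g (f 1) = ⟨1, y⟩ := by rw [← g1]; congr 1; exact Complex.ext F.f1 rfl
  obtain ⟨h, hh, he⟩ := T_rect (hg.rarc F) (line_rarc hy) e0 e1
  exact ⟨g.trans h, hg.trans hh, fun t ht => he t ht⟩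

lemma RArc.above {s s2 y : ℝ} {g : ℝ → ℂ} (G : RArc s s2 g)
    (hd : ∀ t ∈ Icc (0:ℝ) 1, ∀ u ∈ Icc (0:ℝ) 1, g t ≠ ⟨u, y⟩) (h0 : y < (g 0).im) : RArc y s2 g := by
  refine ⟨G.c, G.i, G.f0, G.f1, G.m, fun t ht => ⟨?_, (G.im t ht).2⟩⟩
  by_contra hc
  push Not at hc
  have hcn : ContinuousOn (fun t => (g t).im) (Icc 0 1) := Complex.continuous_im.comp_continuousOn G.c
  have := isPreconnected_Icc.intermediate_value ht z01 hcn (show y ∈ Icc _ _ from ⟨hc, h0.le⟩)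
  obtain ⟨u, hu, e⟩ := this
  exact hd u hu _ (G.re_mem hu) (Complex.ext rfl e)

lemma St {κ : Type*} {s2 : ℝ} (n : ℕ) : ∀ (s : ℝ) (_ : s < s2) (S : Finset κ) (_ : S.card = n) (f : κ → ℝ → ℂ)
    (_ : ∀ i ∈ S, RArc s s2 (f i))
    (_ : ∀ i ∈ S, ∀ j ∈ S, i ≠ j → ∀ t ∈ Icc (0:ℝ) 1, ∀ u ∈ Icc (0:ℝ) 1, f i t ≠ f j u),
    ∃ h : ℂ ≃ₜ ℂ, Good s s2 h ∧ ∃ σ : κ → ℕ, InjOn σ S ∧ (∀ i ∈ S, 1 ≤ σ i ∧ σ i ≤ n) ∧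
      ∀ i ∈ S, ∀ t ∈ Icc (0:ℝ) 1, h (f i t) = ⟨t, s + (s2 - s) * σ i / (n + 1)⟩ := by
  classical
  induction n with
  | zero =>
    intro s hs S hS f F D
    rw [Finset.card_eq_zero] at hS; subst hS
    exact ⟨Homeomorph.refl ℂ, Good.of_id _ fun z _ => rfl, fun _ => 0, by simp, by simp, by simp⟩
  | succ n ih =>
    intro s hs S hS f F D
    have hne : S.Nonempty := by rw [← Finset.card_pos]; omega
    obtain ⟨i0, hi0, hmin⟩ := S.exists_min_image (fun i => (f i 0).im) hne
    set y : ℝ := s + (s2 - s) / (n + 2) with hy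
    have hn : (0:ℝ) < n + 2 := by positivity
    have hyI : y ∈ Ioo s s2 := by
      have h1 : 0 < (s2 - s) / (n + 2) := div_pos (by linarith) hn
      have h2 : (s2 - s) / (n + 2) < s2 - s := div_lt_self (by linarith) (by linarith [n.cast_nonneg (α := ℝ)])
      constructor <;> linarith
    obtain ⟨h1, H1, e1⟩ := (F i0 hi0).str hyI
    have key : ∀ i ∈ S.erase i0, RArc y s2 (fun t => h1 (f i t)) := by
      intro i hi
      obtain ⟨hne, hiS⟩ := Finset.mem_erase.1 hi
      refine (H1.rarc (F i hiS)).above (fun t ht u hu e => ?_) ?_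
      · rw [← e1 u hu] at e
        exact D i hiS i0 hi0 hne t ht u hu (h1.injective e)
      · have hlt : (f i0 0).im < (f i 0).im := by
          refine lt_of_le_of_ne (hmin i hiS) fun e => D i0 hi0 i hiS hne.symm 0 z01 0 z01 ?_
          exact Complex.ext ((F i0 hi0).f0.trans (F i hiS).f0.symm) e
        have := H1.ml _ _ (F i0 hi0).f0 (F i hiS).f0 hlt
        rwa [e1 0 z01] at this
    obtain ⟨h2, H2, σ, s1, s2', s3⟩ := ih y hyI.2 (S.erase i0) (by rw [Finset.card_erase_of_mem hi0, hS]; rfl)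
      (fun i t => h1 (f i t)) key (fun i hi j hj hij t ht u hu e =>
        D i (Finset.mem_of_mem_erase hi) j (Finset.mem_of_mem_erase hj) hij t ht u hu (h1.injective e))
    refine ⟨h1.trans h2, H1.trans (H2.mono hyI.1.le le_rfl), fun i => if i = i0 then 1 else σ i + 1, ?_, ?_, ?_⟩
    · intro i hi j hj e
      have hi : i ∈ S := hi
      have hj : j ∈ S := hj
      by_cases a : i = i0 <;> by_cases b : j = i0 <;> simp only [a, b, if_true, if_false] at e ⊢
      · have := (s2' j (Finset.mem_erase.2 ⟨b, hj⟩)).1; omega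
      · have := (s2' i (Finset.mem_erase.2 ⟨a, hi⟩)).1; omega
      · exact s1 (Finset.mem_coe.2 (Finset.mem_erase.2 ⟨a, hi⟩)) (Finset.mem_coe.2 (Finset.mem_erase.2 ⟨b, hj⟩)) (by omega)
    · intro i hi
      by_cases a : i = i0
      · simp [a]
      · have := s2' i (Finset.mem_erase.2 ⟨a, hi⟩)
        simp only [a, if_false]; omega
    · intro i hi t ht
      by_cases a : i = i0
      · subst a
        simp only [Homeomorph.trans_apply, if_true]
        rw [e1 t ht, H2.lo _ le_rfl]
        congr 1
        rw [hy]; push_cast; ring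
      · simp only [Homeomorph.trans_apply, a, if_false]
        rw [s3 i (Finset.mem_erase.2 ⟨a, hi⟩) t ht]
        congr 1
        rw [hy]; push_cast
        have hn1 : (n:ℝ) + 1 ≠ 0 := by positivity
        have hn2 : (n:ℝ) + 2 ≠ 0 := by positivity
        have hn3 : (n:ℝ) + 1 + 1 ≠ 0 := by positivity
        field_simp
        ring

lemma pt_cont {X : Type*} [TopologicalSpace X] {u v : X → ℝ} {A : Set X} (hu : ContinuousOn u A) (hv : ContinuousOn v A) :
    ContinuousOn (fun x => (⟨u x, v x⟩ : ℂ)) A := by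
  have : (fun x => (⟨u x, v x⟩ : ℂ)) = fun x => (u x : ℂ) + (v x : ℂ) * Complex.I := by
    ext t; exact (Complex.re_add_im _).symm
  rw [this]
  exact (Complex.continuous_ofReal.comp_continuousOn hu).add ((Complex.continuous_ofReal.comp_continuousOn hv).mul continuousOn_const)

lemma half_int {C : Set ℂ} {a b : ℝ} {z : ℂ} (hz : z ∈ interior (C ∩ {z : ℂ | b ≤ z.im + a * z.re})) :
    z ∈ interior C ∧ b < z.im + a * z.re := by
  refine ⟨interior_mono inter_subset_left hz, ?_⟩
  have h1 : ∀ᶠ e : ℝ in 𝓝 0, z - (e : ℂ) * Complex.I ∈ interior (C ∩ {z : ℂ | b ≤ z.im + a * z.re}) := by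
    have : Continuous fun e : ℝ => z - (e : ℂ) * Complex.I := by fun_prop
    exact this.continuousAt.eventually_mem (isOpen_interior.mem_nhds (by simpa using hz))
  obtain ⟨e, he, h⟩ := Metric.eventually_nhds_iff.1 h1
  have := (interior_subset (h (y := e/2) (by rw [Real.dist_eq, sub_zero, abs_of_pos (by linarith)]; linarith))).2
  simp only [mem_ofPred_eq, Complex.sub_im, Complex.mul_im, Complex.ofReal_re, Complex.I_im, Complex.ofReal_im, Complex.I_re,
    Complex.sub_re, Complex.mul_re] at this
  linarith

lemma half_int' {C : Set ℂ} {a b : ℝ} {z : ℂ} (hz : z ∈ interior C) (h : b < z.im + a * z.re) :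
    z ∈ interior (C ∩ {z : ℂ | b ≤ z.im + a * z.re}) := by
  rw [interior_inter]
  refine ⟨hz, ?_⟩
  have ho : IsOpen {z : ℂ | b < z.im + a * z.re} := isOpen_lt continuous_const (by fun_prop)
  have hs : {z : ℂ | b < z.im + a * z.re} ⊆ {z : ℂ | b ≤ z.im + a * z.re} := fun w (hw : b < w.im + a * w.re) => hw.le
  exact interior_maximal hs ho h

lemma half_conv {C : Set ℂ} (hC : Convex ℝ C) (a b : ℝ) : Convex ℝ (C ∩ {z : ℂ | b ≤ z.im + a * z.re}) := by
  refine hC.inter ?_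
  intro z hz w hw p q hp hq hpq
  simp only [mem_ofPred_eq, Complex.add_im, Complex.add_re, Complex.real_smul, Complex.mul_im, Complex.mul_re, Complex.ofReal_re,
    Complex.ofReal_im, zero_mul, add_zero, sub_zero] at hz hw ⊢
  have h1 := mul_le_mul_of_nonneg_left hz hp
  have h2 := mul_le_mul_of_nonneg_left hw hq
  have : b = p * b + q * b := by rw [← add_mul, hpq, one_mul]
  nlinarith

lemma Cut.mk' {C : Set ℂ} {e : ℝ → ℂ} (hc : ContinuousOn e (Icc 0 1)) (hi : InjOn e (Icc 0 1))
    (h0 : e 0 ∈ C) (h0' : e 0 ∉ interior C) (h1 : e 1 ∈ C) (h1' : e 1 ∉ interior C)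
    (h : ∀ t ∈ Ioo (0:ℝ) 1, e t ∈ interior C) : Cut C e :=
  ⟨hc, hi, ⟨subset_closure h0, h0'⟩, ⟨subset_closure h1, h1'⟩, h⟩

lemma slot {y1 y2 : ℝ} {g : ℝ → ℂ} (hc : ContinuousOn g (Icc 0 1)) (hi : InjOn g (Icc 0 1))
    (h0 : (g 0).re = 0) (h1 : (g 1).re = 1) (hh : g (1/2) = ⟨1/2, y1⟩)
    (hm : ∀ t ∈ Ioo (0:ℝ) 1, 0 < (g t).re ∧ (g t).re < 1)
    (him : ∀ t ∈ Icc (0:ℝ) 1, t ≠ 1/2 → y1 < (g t).im ∧ (g t).im < y2) :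
    ∃ h : ℂ ≃ₜ ℂ, Good y1 y2 h ∧ ∀ t ∈ Icc (0:ℝ) 1, h (g t) = ⟨t, y1 + (y2 - y1) / 2 * |2 * t - 1|⟩ := by
  have i0 := him 0 z01 (by norm_num)
  have i1 := him 1 o01 (by norm_num)
  have hy : y1 < y2 := i0.1.trans i0.2
  set m : ℝ := (y1 + y2) / 2 with hmd
  have hmI : m ∈ Ioo y1 y2 := by constructor <;> simp only [hmd] <;> linarith
  obtain ⟨k, hk, -, k0, k1⟩ := lam_ex i0 i1 hmI hmI
  -- the straight vee
  set V : ℝ → ℂ := fun t => ⟨t, y1 + (y2 - y1) / 2 * |2 * t - 1|⟩ with hV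
  have Vc : Continuous V := by
    rw [← continuousOn_univ]; exact pt_cont (by fun_prop) (by fun_prop)
  have Vi : ∀ t u, V t = V u → t = u := fun t u e => congrArg Complex.re e
  have Vint : ∀ t ∈ Ioo (0:ℝ) 1, t ≠ 1/2 → V t ∈ interior (rect y1 y2) := by
    intro t ht hne
    have a0 : 0 < |2 * t - 1| := abs_pos.2 fun h => hne (by linarith)
    have a1 : |2 * t - 1| < 1 := abs_lt.2 ⟨by linarith [ht.1], by linarith [ht.2]⟩
    refine mem_rect_int.2 ⟨ht, ?_, ?_⟩ <;> simp only [hV] <;> nlinarith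
  have V0 : V 0 = ⟨0, m⟩ := by simp only [hV, hmd]; congr 1; norm_num; ring
  have V1 : V 1 = ⟨1, m⟩ := by simp only [hV, hmd]; congr 1; norm_num; ring
  have Vh : V (1/2) = ⟨1/2, y1⟩ := by simp only [hV]; congr 1; norm_num
  -- after lam
  set g2 : ℝ → ℂ := fun t => k (g t) with hg2
  have g2c : ContinuousOn g2 (Icc 0 1) := k.continuous.comp_continuousOn hc
  have g2i : InjOn g2 (Icc 0 1) := fun t ht u hu e => hi ht hu (k.injective e)
  have g20 : g2 0 = V 0 := by
    rw [V0, ← k0]; exact congrArg k (Complex.ext h0 rfl)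
  have g21 : g2 1 = V 1 := by
    rw [V1, ← k1]; exact congrArg k (Complex.ext h1 rfl)
  have g2h : g2 (1/2) = V (1/2) := by
    rw [Vh]; simp only [hg2]; rw [hh]; exact hk.lo _ le_rfl
  have g2int : ∀ t ∈ Ioo (0:ℝ) 1, t ≠ 1/2 → g2 t ∈ interior (rect y1 y2) := by
    intro t ht hne
    have a := hm t ht
    have b := him t (Ioo_subset_Icc_self ht) hne
    exact mem_rect_int.2 ⟨hk.m _ a.1 a.2, hk.im b.1 b.2⟩
  have VR : ∀ t ∈ Icc (0:ℝ) 1, V t ∈ rect y1 y2 := fun t ht => by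
    have a1 : |2 * t - 1| ≤ 1 := abs_le.2 ⟨by linarith [ht.1], by linarith [ht.2]⟩
    have a0 := abs_nonneg (2 * t - 1)
    refine ⟨ht, ?_, ?_⟩ <;> simp only [hV] <;> nlinarith
  have n0 : V 0 ∉ interior (rect y1 y2) := fun h => by
    have := (mem_rect_int.1 h).1.1; rw [V0] at this; exact lt_irrefl _ this
  have n1 : V 1 ∉ interior (rect y1 y2) := fun h => by
    have := (mem_rect_int.1 h).1.2; rw [V1] at this; exact lt_irrefl _ this
  have nh : V (1/2) ∉ interior (rect y1 y2) := fun h => by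
    have := (mem_rect_int.1 h).2.1; rw [Vh] at this; exact lt_irrefl _ this
  have hIh : (1/2 : ℝ) ∈ Icc (0:ℝ) 1 := by norm_num
  have mL : ∀ t ∈ Icc (0:ℝ) 1, t / 2 ∈ Icc (0:ℝ) 1 := fun t ht => ⟨by linarith [ht.1], by linarith [ht.2]⟩
  have mR : ∀ t ∈ Icc (0:ℝ) 1, 1/2 + t / 2 ∈ Icc (0:ℝ) 1 := fun t ht => ⟨by linarith [ht.1], by linarith [ht.2]⟩
  -- generic cuts
  have cutL : ∀ e : ℝ → ℂ, ContinuousOn e (Icc 0 1) → InjOn e (Icc 0 1) → e 0 = V 0 → e (1/2) = V (1/2) →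
      (∀ t ∈ Ioo (0:ℝ) 1, t ≠ 1/2 → e t ∈ interior (rect y1 y2)) → Cut (rect y1 y2) (fun t => e (t/2)) := by
    intro e ec ei e0 eh eint
    refine Cut.mk' (ec.comp (by fun_prop) mL) (fun t ht u hu h => ?_) ?_ ?_ ?_ ?_ fun t ht => ?_
    · have := ei (mL t ht) (mL u hu) h; linarith
    · simp only [zero_div, e0]; exact VR 0 z01
    · simp only [zero_div, e0]; exact n0
    · simp only [eh]; exact VR _ hIh
    · simp only [eh]; exact nh
    · exact eint _ ⟨by linarith [ht.1], by linarith [ht.2]⟩ (by linarith [ht.2])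
  obtain ⟨h3, id3, e3⟩ := T_conv (rect_conv y1 y2) (rect_cpt y1 y2) (rect_ne hy)
    (cutL g2 g2c g2i g20 g2h g2int) (cutL V Vc.continuousOn (fun t _ u _ => Vi t u) rfl rfl Vint)
    (by simp only [zero_div, g20]) (by simp only [g2h])
  have Good3 : Good y1 y2 h3 := Good.of_id h3 fun z hz => id3 z fun hc => hz (by
    have := mem_rect_int.1 hc; exact ⟨this.1.1, this.1.2, this.2.1, this.2.2⟩)
  have e3' : ∀ t ∈ Icc (0:ℝ) (1/2), h3 (g2 t) = V t := fun t ht => by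
    have := e3 (2 * t) ⟨by linarith [ht.1], by linarith [ht.2]⟩
    simpa using this
  set g3 : ℝ → ℂ := fun t => h3 (g2 t) with hg3
  have g3c : ContinuousOn g3 (Icc 0 1) := h3.continuous.comp_continuousOn g2c
  have g3i : InjOn g3 (Icc 0 1) := fun t ht u hu e => g2i ht hu (h3.injective e)
  have g3int : ∀ t ∈ Ioo (0:ℝ) 1, t ≠ 1/2 → g3 t ∈ interior (rect y1 y2) := by
    intro t ht hne
    have := mem_rect_int.1 (g2int t ht hne)
    exact mem_rect_int.2 ⟨Good3.m _ this.1.1 this.1.2, Good3.im this.2.1 this.2.2⟩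
  have g3h : g3 (1/2) = V (1/2) := e3' _ (by norm_num)
  have g31 : g3 1 = V 1 := by simp only [hg3, g21]; exact id3 _ n1
  -- the half plane
  set C : Set ℂ := rect y1 y2 ∩ {z : ℂ | m ≤ z.im + (y2 - y1) * z.re} with hC
  have VL : ∀ z : ℂ, z ∈ rect y1 y2 → z.im + (y2 - y1) * z.re = m → ∃ t ∈ Icc (0:ℝ) (1/2), z = V t := by
    intro z hz e
    have hz1 := hz.1; have hz2 := hz.2
    simp only [mem_preimage, mem_Icc] at hz1 hz2
    have : z.re ≤ 1/2 := by
      by_contra hcon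
      push Not at hcon
      simp only [hmd] at e
      nlinarith
    refine ⟨z.re, ⟨hz1.1, this⟩, Complex.ext rfl ?_⟩
    simp only [hV]
    rw [abs_of_nonpos (by linarith)]
    simp only [hmd] at e
    linarith
  have VLe : ∀ t ∈ Icc (0:ℝ) (1/2), (V t).im + (y2 - y1) * (V t).re = m := fun t ht => by
    simp only [hV]; rw [abs_of_nonpos (by linarith [ht.2])]; simp only [hmd]; ring
  have VRp : ∀ t : ℝ, 1/2 < t → m < (V t).im + (y2 - y1) * (V t).re := fun t ht => by
    simp only [hV]; rw [abs_of_nonneg (by linarith)]; simp only [hmd]; nlinarith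
  have g3R : ∀ t ∈ Icc (0:ℝ) 1, g3 t ∈ rect y1 y2 := fun t ht => by
    rcases le_total t (1/2) with h | h
    · simp only [hg3]; rw [e3' t ⟨ht.1, h⟩]; exact VR t ht
    rcases eq_or_lt_of_le ht.2 with rfl | h'
    · rw [g31]; exact VR _ o01
    rcases eq_or_lt_of_le h with rfl | h
    · rw [g3h]; exact VR _ hIh
    · exact interior_subset (g3int t ⟨by linarith, h'⟩ h.ne')
  have g3P : ∀ t : ℝ, t ∈ Ioc (1/2 : ℝ) 1 → m < (g3 t).im + (y2 - y1) * (g3 t).re := by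
    intro t ht
    by_contra hcon
    push Not at hcon
    have hsub : Icc t 1 ⊆ Icc (0:ℝ) 1 := Icc_subset_Icc_left (by linarith [ht.1])
    have hcn : ContinuousOn (fun t => (g3 t).im + (y2 - y1) * (g3 t).re) (Icc t 1) :=
      ((Complex.continuous_im.comp_continuousOn g3c).add
        (continuousOn_const.mul (Complex.continuous_re.comp_continuousOn g3c))).mono hsub
    have h1 := VRp 1 (by norm_num)
    rw [← g31] at h1
    obtain ⟨u, hu, e⟩ := isPreconnected_Icc.intermediate_value (left_mem_Icc.2 ht.2) (right_mem_Icc.2 ht.2) hcn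
      (show m ∈ Icc _ _ from ⟨hcon, h1.le⟩)
    obtain ⟨v, hv, e'⟩ := VL _ (g3R u (hsub hu)) e
    rw [← e3' v hv] at e'
    have := g3i (hsub hu) ⟨hv.1, by linarith [hv.2]⟩ e'
    linarith [hu.1, ht.1, hv.2]
  have Ccpt : IsCompact C := (rect_cpt y1 y2).inter_right (isClosed_le continuous_const (by fun_prop))
  have Cne : (interior C).Nonempty := by
    refine ⟨V (3/4), half_int' (Vint _ (by norm_num) (by norm_num)) (VRp _ (by norm_num))⟩
  have cutR : ∀ e : ℝ → ℂ, ContinuousOn e (Icc 0 1) → InjOn e (Icc 0 1) → e (1/2) = V (1/2) → e 1 = V 1 →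
      (∀ t ∈ Ioo (0:ℝ) 1, t ≠ 1/2 → e t ∈ interior (rect y1 y2)) →
      (∀ t : ℝ, t ∈ Ioc (1/2 : ℝ) 1 → m < (e t).im + (y2 - y1) * (e t).re) → Cut C (fun t => e (1/2 + t/2)) := by
    intro e ec ei eh e1 eint eP
    have r1 : (1/2 + 1/2 : ℝ) = 1 := by norm_num
    refine Cut.mk' (ec.comp (by fun_prop) mR) (fun t ht u hu h => ?_) ?_ ?_ ?_ ?_ fun t ht => ?_
    · have := ei (mR t ht) (mR u hu) h; linarith
    · simp only [zero_div, add_zero, eh]; exact ⟨VR _ hIh, (VLe _ (by norm_num)).ge⟩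
    · simp only [zero_div, add_zero, eh]; exact fun h => nh (half_int h).1
    · simp only [r1, e1]; exact ⟨VR _ o01, (VRp _ (by norm_num)).le⟩
    · simp only [r1, e1]; exact fun h => n1 (half_int h).1
    · exact half_int' (eint _ ⟨by linarith [ht.1], by linarith [ht.2]⟩ (by linarith [ht.1])) (eP _ ⟨by linarith [ht.1], by linarith [ht.2]⟩)
  obtain ⟨h4, id4, e4⟩ := T_conv (half_conv (rect_conv y1 y2) _ _) Ccpt Cne
    (cutR g3 g3c g3i g3h g31 g3int g3P) (cutR V Vc.continuousOn (fun t _ u _ => Vi t u) rfl rfl Vint fun t ht => VRp t ht.1)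
    (by simp only [zero_div, add_zero, g3h]) (by simp only [show (1/2 + 1/2 : ℝ) = 1 by norm_num, g31])
  have Good4 : Good y1 y2 h4 := Good.of_id h4 fun z hz => id4 z fun hc => hz (by
    have := mem_rect_int.1 (half_int hc).1; exact ⟨this.1.1, this.1.2, this.2.1, this.2.2⟩)
  refine ⟨(k.trans h3).trans h4, (hk.trans Good3).trans Good4, fun t ht => ?_⟩
  show h4 (g3 t) = V t
  rcases le_total t (1/2) with h | h
  · have : g3 t = V t := e3' t ⟨ht.1, h⟩
    rw [this]
    exact id4 _ fun hc => (half_int hc).2.ne' (VLe t ⟨ht.1, h⟩)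
  · have := e4 (2 * t - 1) ⟨by linarith, by linarith [ht.2]⟩
    simp only [show 1/2 + (2 * t - 1)/2 = t by ring] at this
    exact this

def XP (f g : ℝ → ℂ) : Prop := f (1/2) = g (1/2) ∧ ∀ t ∈ Icc (0:ℝ) 1, ∀ u ∈ Icc (0:ℝ) 1, f t = g u → t = 1/2 ∧ u = 1/2

def Dj (f g : ℝ → ℂ) : Prop := ∀ t ∈ Icc (0:ℝ) 1, ∀ u ∈ Icc (0:ℝ) 1, f t ≠ g u

lemma hf01 : (1/2 : ℝ) ∈ Icc (0:ℝ) 1 := by norm_num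

def XNF {κ : Type*} (S : Finset κ) (f : κ → ℝ → ℂ) (e e' : ℝ → ℂ) (s2 : ℝ) (h : ℂ ≃ₜ ℂ) (σ : κ → ℕ) (j0 : ℕ) : Prop :=
  (1 ≤ j0 ∧ j0 ≤ S.card + 1) ∧ (∀ i ∈ S, 1 ≤ σ i ∧ σ i ≤ S.card + 1 ∧ σ i ≠ j0) ∧
  (∀ j, 1 ≤ j → j ≤ S.card + 1 → j ≠ j0 → ∃ i ∈ S, σ i = j) ∧
  (∀ i ∈ S, ∀ t ∈ Icc (0:ℝ) 1, h (f i t) = ⟨t, s2 * σ i / (S.card + 2)⟩) ∧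
  (∀ t ∈ Icc (0:ℝ) 1, h (e t) = ⟨t, s2 * j0 / (S.card + 2)⟩) ∧
  (∀ t ∈ Icc (0:ℝ) 1, h (e' t) = ⟨t, s2 * j0 / (S.card + 2) + s2 / (S.card + 2) / 2 * |2 * t - 1|⟩)

lemma X0 {κ : Type*} {s2 : ℝ} (hs : 0 < s2) (S : Finset κ) (f : κ → ℝ → ℂ) (F : ∀ i ∈ S, RArc 0 s2 (f i))
    (D : ∀ i ∈ S, ∀ j ∈ S, i ≠ j → Dj (f i) (f j)) {e e' : ℝ → ℂ} (E : RArc 0 s2 e) (E' : RArc 0 s2 e')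
    (hx : XP e e') (De : ∀ i ∈ S, Dj (f i) e) (De' : ∀ i ∈ S, Dj (f i) e')
    (o0 : (e 0).im < (e' 0).im) (o1 : (e 1).im < (e' 1).im) :
    ∃ h : ℂ ≃ₜ ℂ, Good 0 s2 h ∧ ∃ σ j0, XNF S f e e' s2 h σ j0 := by
  classical
  set f' : Option κ → ℝ → ℂ := fun o => o.elim e f with hf'
  obtain ⟨h1, H1, σ, si, sr, sl⟩ := St (S.card + 1) 0 hs (Finset.insertNone S) (Finset.card_insertNone S) f'
    (by
      rintro (_ | i) hi
      · exact E
      · exact F i (Finset.some_mem_insertNone.1 hi))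
    (by
      rintro (_ | i) hi (_ | j) hj hij t ht u hu
      · exact absurd rfl hij
      · exact fun h => De j (Finset.some_mem_insertNone.1 hj) u hu t ht h.symm
      · exact De i (Finset.some_mem_insertNone.1 hi) t ht u hu
      · exact D i (Finset.some_mem_insertNone.1 hi) j (Finset.some_mem_insertNone.1 hj) (fun h => hij (by rw [h])) t ht u hu)
  have hNone : (none : Option κ) ∈ Finset.insertNone S := Finset.none_mem_insertNone
  have hSome : ∀ i ∈ S, some i ∈ Finset.insertNone S := fun i hi => Finset.some_mem_insertNone.2 hi
  have surj : ∀ j, 1 ≤ j → j ≤ S.card + 1 → ∃ o ∈ Finset.insertNone S, σ o = j := by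
    have : (Finset.insertNone S).image σ = Finset.Icc 1 (S.card + 1) := by
      refine Finset.eq_of_subset_of_card_le (fun x hx => ?_) ?_
      · obtain ⟨o, ho, rfl⟩ := Finset.mem_image.1 hx
        exact Finset.mem_Icc.2 (sr o ho)
      · rw [Finset.card_image_of_injOn si, Finset.card_insertNone]; simp
    intro j h1 h2
    have : j ∈ (Finset.insertNone S).image σ := by rw [this]; exact Finset.mem_Icc.2 ⟨h1, h2⟩
    exact Finset.mem_image.1 this
  set j0 := σ none with hj0
  have N0 : (0:ℝ) < S.card + 2 := by positivity
  set Y : ℕ → ℝ := fun j => s2 * j / (S.card + 2) with hY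
  have Ylt : ∀ i j : ℕ, i < j → Y i < Y j := fun i j h => by
    simp only [hY]
    have : (i:ℝ) < j := by exact_mod_cast h
    gcongr
  have sl' : ∀ o ∈ Finset.insertNone S, ∀ t ∈ Icc (0:ℝ) 1, h1 (f' o t) = ⟨t, Y (σ o)⟩ := by
    intro o ho t ht
    rw [sl o ho t ht]
    congr 1
    simp only [hY]; push_cast; rw [zero_add, sub_zero, add_assoc]; norm_num
  have e1 : ∀ t ∈ Icc (0:ℝ) 1, h1 (e t) = ⟨t, Y j0⟩ := fun t ht => sl' none hNone t ht
  have G := H1.rarc E'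
  set g : ℝ → ℂ := fun t => h1 (e' t) with hg
  have gh : g (1/2) = ⟨1/2, Y j0⟩ := by simp only [hg]; rw [← hx.1, e1 _ hf01]
  have gim : ContinuousOn (fun t => (g t).im) (Icc 0 1) := Complex.continuous_im.comp_continuousOn G.c
  have gl : ∀ t ∈ Icc (0:ℝ) 1, (g t).im = Y j0 → t = 1/2 := by
    intro t ht h
    have : g t = h1 (e (g t).re) := by rw [e1 _ (G.re_mem ht)]; exact Complex.ext rfl h
    exact (hx.2 _ (G.re_mem ht) t ht (h1.injective this.symm)).2
  have g0 : Y j0 < (g 0).im := by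
    have := H1.ml _ _ E.f0 E'.f0 o0; rwa [e1 0 z01] at this
  have g1 : Y j0 < (g 1).im := by
    have := H1.mr _ _ E.f1 E'.f1 o1; rwa [e1 1 o01] at this
  have lower : ∀ t ∈ Icc (0:ℝ) 1, t ≠ 1/2 → Y j0 < (g t).im := by
    intro t ht hne
    by_contra hc
    push Not at hc
    rcases lt_or_gt_of_ne hne with h | h
    · obtain ⟨u, hu, e⟩ := isPreconnected_Icc.intermediate_value (right_mem_Icc.2 ht.1) (left_mem_Icc.2 ht.1)
        (gim.mono (Icc_subset_Icc_right ht.2)) (show Y j0 ∈ Icc _ _ from ⟨hc, g0.le⟩)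
      have := gl u ⟨hu.1, hu.2.trans ht.2⟩ e
      linarith [hu.2]
    · obtain ⟨u, hu, e⟩ := isPreconnected_Icc.intermediate_value (left_mem_Icc.2 ht.2) (right_mem_Icc.2 ht.2)
        (gim.mono (Icc_subset_Icc_left ht.1)) (show Y j0 ∈ Icc _ _ from ⟨hc, g1.le⟩)
      have := gl u ⟨ht.1.trans hu.1, hu.2⟩ e
      linarith [hu.1]
  have upper : ∀ t ∈ Icc (0:ℝ) 1, (g t).im < Y (j0 + 1) := by
    intro t ht
    rcases Nat.lt_or_ge (S.card + 1) (j0 + 1) with h | h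
    · have hj : j0 = S.card + 1 := by have := (sr none hNone).2; omega
      have : Y (j0 + 1) = s2 := by simp only [hY, hj]; push_cast; field_simp; ring
      rw [this]; exact (G.im t ht).2
    · obtain ⟨o, ho, hoj⟩ := surj (j0 + 1) (by omega) h
      rcases o with _ | i
      · omega
      by_contra hc
      push Not at hc
      have hlt : (g (1/2)).im ≤ Y (j0 + 1) := by rw [gh]; exact (Ylt _ _ (Nat.lt_succ_self _)).le
      obtain ⟨u, hu, e⟩ := isPreconnected_Icc.intermediate_value hf01 ht gim (show Y (j0+1) ∈ Icc _ _ from ⟨hlt, hc⟩)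
      have h2 : h1 (f' (some i) (g u).re) = g u := by
        rw [sl' _ ho _ (G.re_mem hu), hoj]; exact Complex.ext rfl e.symm
      exact De' i (Finset.some_mem_insertNone.1 ho) _ (G.re_mem hu) u hu (h1.injective h2)
  obtain ⟨h2, H2, v2⟩ := slot G.c G.i G.f0 G.f1 gh G.m (fun t ht hne => ⟨lower t ht hne, upper t ht⟩)
  have hYn : ∀ j : ℕ, j ≤ S.card + 2 → Y j ≤ s2 := fun j hj => by
    have : (j:ℝ) ≤ S.card + 2 := by exact_mod_cast hj
    simp only [hY]; rw [div_le_iff₀ N0]; nlinarith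
  have hY0 : ∀ j, 0 ≤ Y j := fun j => by simp only [hY]; positivity
  have sn := sr none hNone
  refine ⟨h1.trans h2, H1.trans (H2.mono (hY0 _) (hYn _ (by omega))), fun i => σ (some i), j0, sn, ?_, ?_, ?_, ?_, ?_⟩
  · intro i hi
    have := sr _ (hSome i hi)
    refine ⟨this.1, this.2, fun h => ?_⟩
    have := si (hSome i hi) hNone h
    simp at this
  · intro j a b hne
    obtain ⟨o, ho, hoj⟩ := surj j a b
    rcases o with _ | i
    · exact absurd hoj.symm hne
    · exact ⟨i, Finset.some_mem_insertNone.1 ho, hoj⟩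
  · intro i hi t ht
    have h3 : h1 (f i t) = ⟨t, Y (σ (some i))⟩ := sl' _ (hSome i hi) t ht
    rw [Homeomorph.trans_apply, h3]
    have hne : σ (some i) ≠ j0 := fun h => by
      have := si (hSome i hi) hNone h
      simp at this
    rcases lt_or_gt_of_ne hne with h | h
    · exact H2.lo _ (Ylt _ _ h).le
    · refine H2.hi _ ?_
      rcases eq_or_lt_of_le (Nat.succ_le_of_lt h) with h' | h'
      · rw [← h']
      · exact (Ylt _ _ h').le
  · intro t ht
    rw [Homeomorph.trans_apply, e1 t ht]; exact H2.lo _ le_rfl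
  · intro t ht
    rw [Homeomorph.trans_apply]
    have := v2 t ht
    simp only [hg] at this
    rw [this]
    congr 1
    simp only [hY]; push_cast; field_simp; ring

lemma RArc.tail {s s2 : ℝ} {e e' : ℝ → ℂ} (E : RArc s s2 e) (E' : RArc s s2 e') (hx : XP e e') :
    ∃ g, RArc s s2 g ∧ EqOn g e (Icc 0 (1/2)) ∧ EqOn g e' (Icc (1/2) 1) := by
  have hs1 : Icc (0:ℝ) (1/2) ⊆ Icc 0 1 := Icc_subset_Icc_right (by norm_num)
  have hs2 : Icc (1/2:ℝ) 1 ⊆ Icc 0 1 := Icc_subset_Icc_left (by norm_num)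
  obtain ⟨g, gc, g1, g2⟩ := glue_cont' isClosed_Icc isClosed_Icc (E.c.mono hs1) (E'.c.mono hs2)
    (fun z hz => by have : z = 1/2 := le_antisymm hz.1.2 hz.2.1
                    rw [this]; exact hx.1)
  rw [Icc_union_Icc_eq_Icc (by norm_num) (by norm_num)] at gc
  have sp : ∀ t ∈ Icc (0:ℝ) 1, t ∈ Icc (0:ℝ) (1/2) ∨ t ∈ Icc (1/2:ℝ) 1 := fun t ht =>
    (le_total t (1/2)).imp (fun h => ⟨ht.1, h⟩) (fun h => ⟨h, ht.2⟩)
  refine ⟨g, ⟨gc, ?_, ?_, ?_, ?_, ?_⟩, g1, g2⟩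
  · intro t ht u hu h
    rcases sp t ht with a | a <;> rcases sp u hu with b | b
    · rw [g1 a, g1 b] at h; exact E.i ht hu h
    · rw [g1 a, g2 b] at h; have := hx.2 t ht u hu h; rw [this.1, this.2]
    · rw [g2 a, g1 b] at h; have := hx.2 u hu t ht h.symm; rw [this.1, this.2]
    · rw [g2 a, g2 b] at h; exact E'.i ht hu h
  · rw [g1 (by norm_num)]; exact E.f0
  · rw [g2 (by norm_num)]; exact E'.f1
  · intro t ht
    rcases sp t (Ioo_subset_Icc_self ht) with a | a
    · rw [g1 a]; exact E.m t ht
    · rw [g2 a]; exact E'.m t ht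
  · intro t ht
    rcases sp t ht with a | a
    · rw [g1 a]; exact E.im t ht
    · rw [g2 a]; exact E'.im t ht

lemma XP.symm {f g : ℝ → ℂ} (h : XP f g) : XP g f :=
  ⟨h.1.symm, fun t ht u hu e => (h.2 u hu t ht e.symm).symm⟩

lemma repair {s s2 : ℝ} {e e' : ℝ → ℂ} (E : RArc s s2 e) (E' : RArc s s2 e') (hx : XP e e') :
    ∃ g g', RArc s s2 g ∧ RArc s s2 g' ∧ XP g g' ∧ (g 0).im < (g' 0).im ∧ (g 1).im < (g' 1).im ∧
      g '' Icc 0 1 ∪ g' '' Icc 0 1 = e '' Icc 0 1 ∪ e' '' Icc 0 1 := by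
  have n0 : ∀ {e e' : ℝ → ℂ}, RArc s s2 e → RArc s s2 e' → XP e e' → (e 0).im ≠ (e' 0).im := fun E E' hx h => by
    have := (hx.2 0 z01 0 z01 (Complex.ext (E.f0.trans E'.f0.symm) h)).1; norm_num at this
  have n1 : ∀ {e e' : ℝ → ℂ}, RArc s s2 e → RArc s s2 e' → XP e e' → (e 1).im ≠ (e' 1).im := fun E E' hx h => by
    have := (hx.2 1 o01 1 o01 (Complex.ext (E.f1.trans E'.f1.symm) h)).1; norm_num at this
  have key : ∀ {e e' : ℝ → ℂ}, RArc s s2 e → RArc s s2 e' → XP e e' → (e 0).im < (e' 0).im →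
      ∃ g g', RArc s s2 g ∧ RArc s s2 g' ∧ XP g g' ∧ (g 0).im < (g' 0).im ∧ (g 1).im < (g' 1).im ∧
      g '' Icc 0 1 ∪ g' '' Icc 0 1 = e '' Icc 0 1 ∪ e' '' Icc 0 1 := by
    intro e e' E E' hx h0
    rcases lt_or_gt_of_ne (n1 E E' hx) with h1 | h1
    · exact ⟨e, e', E, E', hx, h0, h1, rfl⟩
    obtain ⟨g, G, g1, g2⟩ := E.tail E' hx
    obtain ⟨g', G', g1', g2'⟩ := E'.tail E hx.symm
    have sp : Icc (0:ℝ) 1 = Icc (0:ℝ) (1/2) ∪ Icc (1/2:ℝ) 1 := (Icc_union_Icc_eq_Icc (by norm_num) (by norm_num)).symm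
    have sp' : ∀ t ∈ Icc (0:ℝ) 1, t ∈ Icc (0:ℝ) (1/2) ∨ t ∈ Icc (1/2:ℝ) 1 := fun t ht => by rw [sp] at ht; exact ht
    refine ⟨g, g', G, G', ⟨?_, ?_⟩, ?_, ?_, ?_⟩
    · rw [g1 (by norm_num), g1' (by norm_num)]; exact hx.1
    · intro t ht u hu h
      rcases sp' t ht with a | a <;> rcases sp' u hu with b | b
      · rw [g1 a, g1' b] at h; exact hx.2 t ht u hu h
      · rw [g1 a, g2' b] at h; have := E.i ht hu h
        constructor <;> linarith [a.2, b.1]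
      · rw [g2 a, g1' b] at h; have := E'.i ht hu h
        constructor <;> linarith [a.1, b.2]
      · rw [g2 a, g2' b] at h; exact (hx.2 u hu t ht h.symm).symm
    · rw [g1 (by norm_num), g1' (by norm_num)]; exact h0
    · rw [g2 (by norm_num), g2' (by norm_num)]; exact h1
    · rw [sp]
      simp only [image_union, g1.image_eq, g2.image_eq, g1'.image_eq, g2'.image_eq]
      ext z; simp only [mem_union]; tauto
  rcases lt_or_gt_of_ne (n0 E E' hx) with h | h
  · exact key E E' hx h
  · obtain ⟨g, g', a, b, c, d, e, k⟩ := key E' E hx.symm h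
    exact ⟨g, g', a, b, c, d, e, k.trans (union_comm _ _)⟩

lemma mu_cont {k : ℝ} (hk : 0 < k) : ContinuousOn (mu k) (Icc 0 1) := by
  unfold mu
  exact ContinuousOn.div (by fun_prop) (by fun_prop) fun x hx => (mu_den hk hx.1 hx.2).ne'

lemma RArc.reparam {s s2 : ℝ} {e : ℝ → ℂ} (E : RArc s s2 e) {t0 : ℝ} (h0 : t0 ∈ Ioo (0:ℝ) 1) :
    ∃ g, RArc s s2 g ∧ g (1/2) = e t0 ∧ (∀ t ∈ Icc (0:ℝ) 1, ∃ u ∈ Icc (0:ℝ) 1, g t = e u ∧ (u = t0 → t = 1/2)) ∧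
      g '' Icc 0 1 = e '' Icc 0 1 := by
  obtain ⟨k, hk, hkt⟩ := mu_ex (c := 1/2) (by norm_num) h0
  have inj : InjOn (mu k) (Icc 0 1) := fun t ht u hu h => by rw [← mu_mu hk ht, h, mu_mu hk hu]
  have maps : MapsTo (mu k) (Icc 0 1) (Icc 0 1) := fun t ht => mu_mem hk ht
  have im : mu k '' Icc 0 1 = Icc 0 1 := by
    refine subset_antisymm maps.image_subset fun c hc => ⟨mu k⁻¹ c, mu_mem (inv_pos.2 hk) hc, ?_⟩
    have := mu_mu (inv_pos.2 hk) hc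
    rwa [inv_inv] at this
  refine ⟨fun t => e (mu k t), ⟨E.c.comp (mu_cont hk) maps, fun t ht u hu h => inj ht hu (E.i (maps ht) (maps hu) h), ?_, ?_, ?_, ?_⟩,
    by simp only [hkt], fun t ht => ⟨mu k t, maps ht, rfl, fun h => inj ht hf01 (h.trans hkt.symm)⟩, ?_⟩
  · rw [mu_zero]; exact E.f0
  · rw [mu_one hk]; exact E.f1
  · intro t ht
    refine E.m _ ⟨?_, ?_⟩
    · have := mu_lt hk z01 (Ioo_subset_Icc_self ht) ht.1; rwa [mu_zero] at this
    · have := mu_lt hk (Ioo_subset_Icc_self ht) o01 ht.2; rwa [mu_one hk] at this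
  · exact fun t ht => E.im _ (maps ht)
  · conv_rhs => rw [← im, image_image]

lemma Dj_iff {f g : ℝ → ℂ} : Dj f g ↔ Disjoint (f '' Icc 0 1) (g '' Icc 0 1) := by
  rw [Set.disjoint_left]
  constructor
  · rintro h z ⟨t, ht, rfl⟩ ⟨u, hu, e⟩; exact h t ht u hu e.symm
  · intro h t ht u hu e; exact h ⟨t, ht, rfl⟩ ⟨u, hu, e.symm⟩

lemma X1 {κ : Type*} {s2 : ℝ} (hs : 0 < s2) (S : Finset κ) (f : κ → ℝ → ℂ) (F : ∀ i ∈ S, RArc 0 s2 (f i))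
    (D : ∀ i ∈ S, ∀ j ∈ S, i ≠ j → Dj (f i) (f j)) {e e' : ℝ → ℂ} (E : RArc 0 s2 e) (E' : RArc 0 s2 e')
    {t0 t1 : ℝ} (h0 : t0 ∈ Ioo (0:ℝ) 1) (h1 : t1 ∈ Ioo (0:ℝ) 1) (hx : e t0 = e' t1)
    (hx' : ∀ t ∈ Icc (0:ℝ) 1, ∀ u ∈ Icc (0:ℝ) 1, e t = e' u → t = t0 ∧ u = t1)
    (De : ∀ i ∈ S, Dj (f i) e) (De' : ∀ i ∈ S, Dj (f i) e') :
    ∃ h : ℂ ≃ₜ ℂ, Good 0 s2 h ∧ ∃ g g' σ j0, XNF S f g g' s2 h σ j0 ∧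
      g '' Icc 0 1 ∪ g' '' Icc 0 1 = e '' Icc 0 1 ∪ e' '' Icc 0 1 := by
  obtain ⟨a, A, ah, au, ai⟩ := E.reparam h0
  obtain ⟨a', A', ah', au', ai'⟩ := E'.reparam h1
  have hxp : XP a a' := by
    refine ⟨by rw [ah, ah', hx], fun t ht u hu h => ?_⟩
    obtain ⟨v, hv, p, q⟩ := au t ht
    obtain ⟨w, hw, p', q'⟩ := au' u hu
    rw [p, p'] at h
    have := hx' v hv w hw h
    exact ⟨q this.1, q' this.2⟩
  obtain ⟨g, g', G, G', gx, o0, o1, gi⟩ := repair A A' hxp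
  rw [ai, ai'] at gi
  have dj : ∀ i ∈ S, Disjoint (f i '' Icc 0 1) (g '' Icc 0 1 ∪ g' '' Icc 0 1) := fun i hi => by
    rw [gi, disjoint_union_right]; exact ⟨Dj_iff.1 (De i hi), Dj_iff.1 (De' i hi)⟩
  obtain ⟨h, H, σ, j0, hh⟩ := X0 hs S f F D G G' gx (fun i hi => Dj_iff.2 (disjoint_union_right.1 (dj i hi)).1)
    (fun i hi => Dj_iff.2 (disjoint_union_right.1 (dj i hi)).2) o0 o1
  exact ⟨h, H, g, g', σ, j0, hh, gi⟩

structure Pres (f : ℂ ≃ₜ ℂ) : Prop where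
  a : ∀ z, ‖z‖ < 1 → ‖f z‖ < 1
  b : ∀ z, ‖z‖ = 1 → ‖f z‖ = 1
  c : ∀ z, 1 < ‖z‖ → ‖z‖ < 2 → 1 < ‖f z‖ ∧ ‖f z‖ < 2
  d : ∀ z, ‖z‖ = 2 → ‖f z‖ = 2
  e : ∀ z, 2 < ‖z‖ → 2 < ‖f z‖

lemma tri (r : ℝ) : r < 1 ∨ r = 1 ∨ (1 < r ∧ r < 2) ∨ r = 2 ∨ 2 < r := by
  rcases lt_trichotomy r 1 with h | h | h
  · exact Or.inl h
  · exact Or.inr (Or.inl h)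
  · rcases lt_trichotomy r 2 with h' | h' | h'
    · exact Or.inr (Or.inr (Or.inl ⟨h, h'⟩))
    · exact Or.inr (Or.inr (Or.inr (Or.inl h')))
    · exact Or.inr (Or.inr (Or.inr (Or.inr h')))

namespace Pres
variable {f g : ℂ ≃ₜ ℂ}

lemma trans (F : Pres f) (G : Pres g) : Pres (f.trans g) :=
  ⟨fun z h => G.a _ (F.a z h), fun z h => G.b _ (F.b z h), fun z h h' => G.c _ (F.c z h h').1 (F.c z h h').2,
    fun z h => G.d _ (F.d z h), fun z h => G.e _ (F.e z h)⟩

lemma symm (F : Pres f) : Pres f.symm := by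
  have key : ∀ z, (‖f.symm z‖ < 1 ∧ ‖z‖ < 1) ∨ (‖f.symm z‖ = 1 ∧ ‖z‖ = 1) ∨
      ((1 < ‖f.symm z‖ ∧ ‖f.symm z‖ < 2) ∧ (1 < ‖z‖ ∧ ‖z‖ < 2)) ∨ (‖f.symm z‖ = 2 ∧ ‖z‖ = 2) ∨ (2 < ‖f.symm z‖ ∧ 2 < ‖z‖) := by
    intro z
    have e : f (f.symm z) = z := f.apply_symm_apply z
    rcases tri ‖f.symm z‖ with h | h | h | h | h
    · have := F.a _ h; rw [e] at this; tauto
    · have := F.b _ h; rw [e] at this; tauto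
    · have := F.c _ h.1 h.2; rw [e] at this; tauto
    · have := F.d _ h; rw [e] at this; tauto
    · have := F.e _ h; rw [e] at this; tauto
  refine ⟨fun z h => ?_, fun z h => ?_, fun z h h' => ?_, fun z h => ?_, fun z h => ?_⟩ <;>
  rcases key z with k | k | k | k | k <;>
  first
    | exact k.1
    | (exfalso; linarith [k.2])

lemma of_norm (f : ℂ ≃ₜ ℂ) (h : ∀ z, ‖f z‖ = ‖z‖) : Pres f :=
  ⟨fun z hz => by rwa [h], fun z hz => by rwa [h], fun z h1 h2 => by rw [h]; exact ⟨h1, h2⟩, fun z hz => by rwa [h], fun z hz => by rwa [h]⟩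

end Pres

noncomputable def E (w : ℂ) : ℂ := Complex.exp (⟨Real.log 2 * w.re, w.im⟩ : ℂ)
noncomputable def ell (z : ℂ) : ℂ := ⟨(Complex.log z).re / Real.log 2, (Complex.log z).im⟩
noncomputable def L (z : ℂ) : ℂ := ell (-z) + Real.pi * Complex.I

lemma l2p : 0 < Real.log 2 := Real.log_pos (by norm_num)

lemma E_norm (w : ℂ) : ‖E w‖ = Real.exp (Real.log 2 * w.re) := by rw [E, Complex.norm_exp]

lemma E_ne (w : ℂ) : E w ≠ 0 := Complex.exp_ne_zero _

lemma E_cont : Continuous E := by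
  unfold E
  refine Complex.continuous_exp.comp ?_
  rw [← continuousOn_univ]
  exact pt_cont (by fun_prop) (by fun_prop)

lemma E_pi (w : ℂ) : E (w + Real.pi * Complex.I) = - E w := by
  have : (⟨Real.log 2 * (w + Real.pi * Complex.I).re, (w + Real.pi * Complex.I).im⟩ : ℂ) =
      (⟨Real.log 2 * w.re, w.im⟩ : ℂ) + Real.pi * Complex.I := by
    apply Complex.ext <;> simp
  rw [E, this, Complex.exp_add, Complex.exp_pi_mul_I, E]; ring

lemma E_2pi (w : ℂ) : E (w + 2 * Real.pi * Complex.I) = E w := by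
  have : w + 2 * Real.pi * Complex.I = (w + Real.pi * Complex.I) + Real.pi * Complex.I := by ring
  rw [this, E_pi, E_pi, neg_neg]

lemma E_ell {z : ℂ} (hz : z ≠ 0) : E (ell z) = z := by
  have : (⟨Real.log 2 * (ell z).re, (ell z).im⟩ : ℂ) = Complex.log z := by
    apply Complex.ext
    · simp only [ell]; field_simp [l2p.ne']
    · rfl
  rw [E, this, Complex.exp_log hz]

lemma ell_E {w : ℂ} (h1 : -Real.pi < w.im) (h2 : w.im ≤ Real.pi) : ell (E w) = w := by
  have := Complex.log_exp (x := ⟨Real.log 2 * w.re, w.im⟩) h1 h2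
  rw [ell, E, this]
  apply Complex.ext
  · simp only; field_simp [l2p.ne']
  · rfl

lemma L_im (z : ℂ) : 0 < (L z).im ∧ (L z).im ≤ 2 * Real.pi := by
  have h1 := Complex.neg_pi_lt_log_im (-z)
  have h2 := Complex.log_im_le_pi (-z)
  have : (L z).im = (Complex.log (-z)).im + Real.pi := by simp [L, ell]
  rw [this]; constructor <;> linarith

lemma E_L {z : ℂ} (hz : z ≠ 0) : E (L z) = z := by
  rw [L, E_pi, E_ell (neg_ne_zero.2 hz), neg_neg]

lemma L_E {w : ℂ} (h1 : 0 < w.im) (h2 : w.im ≤ 2 * Real.pi) : L (E w) = w := by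
  have e : - E w = E (w - Real.pi * Complex.I) := by
    have := E_pi (w - Real.pi * Complex.I)
    rw [sub_add_cancel] at this
    rw [this, neg_neg]
  have im : (w - Real.pi * Complex.I).im = w.im - Real.pi := by simp
  rw [L, e, ell_E (by rw [im]; linarith) (by rw [im]; linarith)]; ring

lemma ell_cont {z : ℂ} (hz : z ∈ Complex.slitPlane) : ContinuousAt ell z := by
  have h1 : ContinuousAt Complex.log z := continuousAt_clog hz
  have h2 : Continuous fun w : ℂ => (⟨w.re / Real.log 2, w.im⟩ : ℂ) := by
    rw [← continuousOn_univ]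
    exact pt_cont (by fun_prop) (by fun_prop)
  exact h2.continuousAt.comp h1

noncomputable def tr (h : ℂ → ℂ) (z : ℂ) : ℂ := open Classical in if z = 0 then 0 else E (h (L z))

lemma tr_E {h : ℂ → ℂ} (lo : ∀ z : ℂ, z.im ≤ 0 → h z = z) (hi : ∀ z : ℂ, 2 * Real.pi ≤ z.im → h z = z)
    {w : ℂ} (h1 : 0 ≤ w.im) (h2 : w.im ≤ 2 * Real.pi) : tr h (E w) = E (h w) := by
  rw [tr, if_neg (E_ne w)]
  rcases eq_or_lt_of_le h1 with h0 | h0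
  · have im : (w + 2 * Real.pi * Complex.I).im = w.im + 2 * Real.pi := by simp
    rw [← E_2pi w, L_E (by rw [im]; linarith [Real.pi_pos]) (by rw [im]; linarith), hi _ (by rw [im]; linarith), E_2pi,
      lo w h0.symm.le]
  · rw [L_E h0 h2]

lemma E_norm_eq {w w' : ℂ} (h : w.re = w'.re) : ‖E w‖ = ‖E w'‖ := by rw [E_norm, E_norm, h]

lemma E_norm_lt {w w' : ℂ} (h : w.re < w'.re) : ‖E w‖ < ‖E w'‖ := by
  rw [E_norm, E_norm]; exact Real.exp_lt_exp.2 (mul_lt_mul_of_pos_left h l2p)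

lemma E_norm_one {w : ℂ} : ‖E w‖ = 1 ↔ w.re = 0 := by
  rw [E_norm, Real.exp_eq_one_iff, mul_eq_zero]; simp [l2p.ne']

lemma E_norm_two {w : ℂ} : ‖E w‖ = 2 ↔ w.re = 1 := by
  have : (2:ℝ) = Real.exp (Real.log 2 * 1) := by rw [mul_one, Real.exp_log (by norm_num)]
  rw [E_norm]
  constructor
  · intro h
    rw [this, Real.log_exp, mul_one] at h
    have := Real.exp_injective h
    have h2 := l2p.ne'
    field_simp at this
    linarith
  · intro h; rw [h]; exact this.symm

lemma E_one_lt {w : ℂ} : 1 < ‖E w‖ ↔ 0 < w.re := by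
  rw [E_norm, Real.one_lt_exp_iff]; exact mul_pos_iff_of_pos_left l2p

lemma E_lt_two {w : ℂ} : ‖E w‖ < 2 ↔ w.re < 1 := by
  have : (2:ℝ) = Real.exp (Real.log 2 * 1) := by rw [mul_one, Real.exp_log (by norm_num)]
  rw [E_norm]
  conv_lhs => rhs; rw [this]
  rw [Real.exp_lt_exp]; exact mul_lt_mul_iff_right₀ l2p

lemma tr_cont {h : ℂ → ℂ} (hc : Continuous h) (lo : ∀ z : ℂ, z.im ≤ 0 → h z = z) (hi : ∀ z : ℂ, 2 * Real.pi ≤ z.im → h z = z)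
    (l : ∀ z : ℂ, z.re ≤ 0 → (h z).re = z.re) : Continuous (tr h) := by
  rw [continuous_iff_continuousAt]
  intro z
  by_cases hz : z = 0
  · subst hz
    have h0 : tr h 0 = 0 := by simp [tr]
    rw [ContinuousAt, h0, tendsto_zero_iff_norm_tendsto_zero]
    have : Tendsto (fun z : ℂ => ‖z‖) (𝓝 0) (𝓝 0) := by simpa using (continuous_norm.tendsto (0:ℂ))
    refine this.congr' ?_
    have hb : ball (0:ℂ) 1 ∈ 𝓝 (0:ℂ) := ball_mem_nhds _ one_pos
    filter_upwards [hb] with w hw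
    rw [mem_ball_zero_iff] at hw
    by_cases h2 : w = 0
    · subst h2; rw [h0]
    · have e := E_L h2
      rw [← e] at hw
      have : (L w).re ≤ 0 := by
        by_contra hcon; push Not at hcon
        linarith [E_one_lt.2 hcon]
      rw [tr, if_neg h2]
      conv_lhs => rw [← e]
      exact E_norm_eq (l _ this).symm
  by_cases hs : -z ∈ Complex.slitPlane
  · have h1 : ContinuousAt L z := ((ell_cont hs).comp continuous_neg.continuousAt).add continuousAt_const
    have h2 : ContinuousAt (fun z => E (h (L z))) z := (E_cont.comp hc).continuousAt.comp h1
    refine h2.congr ?_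
    filter_upwards [isOpen_ne.mem_nhds hz] with w hw
    rw [tr, if_neg hw]
  · have hs' : z ∈ Complex.slitPlane := by
      rw [Complex.mem_slitPlane_iff] at hs ⊢
      simp only [Complex.neg_re, Complex.neg_im] at hs
      push Not at hs
      rcases eq_or_lt_of_le hs.1 with h1 | h1
      · exact absurd (Complex.ext (by simp; linarith) (by simpa using hs.2)) hz
      · left; linarith
    have hu : Continuous fun w => h w + h (w + 2 * Real.pi * Complex.I) - w - 2 * Real.pi * Complex.I := by fun_prop
    have h2 : ContinuousAt (fun z => E (h (ell z) + h (ell z + 2 * Real.pi * Complex.I) - ell z - 2 * Real.pi * Complex.I)) z :=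
      (E_cont.comp hu).continuousAt.comp (ell_cont hs')
    refine h2.congr ?_
    filter_upwards [isOpen_ne.mem_nhds hz] with w hw
    have i1 := Complex.neg_pi_lt_log_im w
    have i2 := Complex.log_im_le_pi w
    change -Real.pi < (ell w).im at i1
    change (ell w).im ≤ Real.pi at i2
    have im : (ell w + 2 * Real.pi * Complex.I).im = (ell w).im + 2 * Real.pi := by simp
    rcases le_total 0 (ell w).im with h3 | h3
    · rw [hi (ell w + 2 * Real.pi * Complex.I) (by rw [im]; linarith)]
      have : h (ell w) + (ell w + 2 * Real.pi * Complex.I) - ell w - 2 * Real.pi * Complex.I = h (ell w) := by ring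
      rw [this, ← tr_E lo hi h3 (by linarith [Real.pi_pos]), E_ell hw]
    · rw [lo (ell w) h3]
      have : ell w + h (ell w + 2 * Real.pi * Complex.I) - ell w - 2 * Real.pi * Complex.I =
        h (ell w + 2 * Real.pi * Complex.I) - 2 * Real.pi * Complex.I := by ring
      rw [this, ← E_2pi, sub_add_cancel, ← tr_E lo hi (by rw [im]; linarith [Real.pi_pos]) (by rw [im]; linarith), E_2pi, E_ell hw]

lemma transfer {h : ℂ ≃ₜ ℂ} (H : Good 0 (2 * Real.pi) h) :
    ∃ F : ℂ ≃ₜ ℂ, Pres F ∧ ∀ w : ℂ, 0 ≤ w.im → w.im ≤ 2 * Real.pi → F (E w) = E (h w) := by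
  have lo' : ∀ z : ℂ, z.im ≤ 0 → h.symm z = z := fun z hz => by rw [h.symm_apply_eq, H.lo z hz]
  have hi' : ∀ z : ℂ, 2 * Real.pi ≤ z.im → h.symm z = z := fun z hz => by rw [h.symm_apply_eq, H.hi z hz]
  have re' : ∀ z : ℂ, z.re ≤ 0 → (h.symm z).re = z.re := fun z hz => by
    have e := h.apply_symm_apply z
    rcases le_or_gt (h.symm z).re 0 with h1 | h1
    · rw [← H.l _ h1, e]
    rcases lt_or_ge (h.symm z).re 1 with h2 | h2
    · have := (H.m _ h1 h2).1; rw [e] at this; linarith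
    · have := H.r _ h2; rw [e] at this; linarith
  have st : ∀ {h : ℂ ≃ₜ ℂ}, (∀ z : ℂ, z.im ≤ 0 → h z = z) → (∀ z : ℂ, 2 * Real.pi ≤ z.im → h z = z) →
      ∀ w : ℂ, 0 ≤ w.im → w.im ≤ 2 * Real.pi → 0 ≤ (h w).im ∧ (h w).im ≤ 2 * Real.pi := by
    intro h lo hi w h1 h2
    constructor
    · by_contra hc; push Not at hc
      have := h.injective (lo _ hc.le); rw [this] at hc; linarith
    · by_contra hc; push Not at hc
      have := h.injective (hi _ hc.le); rw [this] at hc; linarith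
  have inv : ∀ {h : ℂ ≃ₜ ℂ}, (∀ z : ℂ, z.im ≤ 0 → h z = z) → (∀ z : ℂ, 2 * Real.pi ≤ z.im → h z = z) →
      (∀ z : ℂ, z.im ≤ 0 → h.symm z = z) → (∀ z : ℂ, 2 * Real.pi ≤ z.im → h.symm z = z) →
      ∀ z, tr h.symm (tr h z) = z := by
    intro h lo hi lo' hi' z
    by_cases hz : z = 0
    · simp [tr, hz]
    · have a := L_im z
      have b := st lo hi (L z) a.1.le a.2
      conv_lhs => rw [← E_L hz]
      rw [tr_E lo hi a.1.le a.2, tr_E lo' hi' b.1 b.2, h.symm_apply_apply, E_L hz]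
  let F : ℂ ≃ₜ ℂ := {
    toFun := tr h
    invFun := tr h.symm
    left_inv := inv H.lo H.hi lo' hi'
    right_inv := inv (h := h.symm) lo' hi' H.lo H.hi
    continuous_toFun := tr_cont h.continuous H.lo H.hi H.l
    continuous_invFun := tr_cont h.symm.continuous lo' hi' re' }
  have FE : ∀ w : ℂ, 0 ≤ w.im → w.im ≤ 2 * Real.pi → F (E w) = E (h w) := fun w h1 h2 => tr_E H.lo H.hi h1 h2
  have F0 : F 0 = 0 := by show tr h 0 = 0; simp [tr]
  have rep : ∀ z : ℂ, z ≠ 0 → ∃ w : ℂ, z = E w ∧ F z = E (h w) := fun z hz => by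
    have a := L_im z
    refine ⟨L z, (E_L hz).symm, ?_⟩
    rw [← FE _ a.1.le a.2, E_L hz]
  have nz : ∀ z : ℂ, 1 ≤ ‖z‖ → z ≠ 0 := fun z h1 h2 => by rw [h2, norm_zero] at h1; linarith
  refine ⟨F, ⟨fun z hz => ?_, fun z hz => ?_, fun z h1 h2 => ?_, fun z hz => ?_, fun z hz => ?_⟩, FE⟩
  · by_cases h0 : z = 0
    · rw [h0, F0]; simp
    · obtain ⟨w, e, e'⟩ := rep z h0
      have : w.re ≤ 0 := by
        by_contra hcon; push Not at hcon
        have := E_one_lt.2 hcon; rw [← e] at this; linarith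
      rw [e', E_norm_eq (H.l _ this), ← e]; exact hz
  · obtain ⟨w, e, e'⟩ := rep z (nz z hz.ge)
    rw [e, E_norm_one] at hz
    rw [e', E_norm_one, H.l _ hz.le, hz]
  · obtain ⟨w, e, e'⟩ := rep z (nz z h1.le)
    rw [e, E_one_lt] at h1
    rw [e, E_lt_two] at h2
    rw [e', E_one_lt, E_lt_two]; exact H.m _ h1 h2
  · obtain ⟨w, e, e'⟩ := rep z (nz z (by linarith))
    rw [e, E_norm_two] at hz
    rw [e', E_norm_two, H.r _ hz.ge, hz]
  · obtain ⟨w, e, e'⟩ := rep z (nz z (by linarith))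
    have : 1 ≤ w.re := by
      by_contra hcon; push Not at hcon
      have := E_lt_two.2 hcon; rw [← e] at this; linarith
    rw [e', E_norm_eq (H.r _ this), ← e]; exact hz

open ComplexConjugate

noncomputable def mb (c : ℝ) (w : ℂ) : ℂ := (w + c) / (1 + c * w)

lemma mb_den {c : ℝ} (hc : |c| < 1) {w : ℂ} (hw : w ∈ sphere (0:ℂ) 1) : 1 + (c:ℂ) * w ≠ 0 := by
  intro h
  have h1 : ‖(c:ℂ) * w‖ = 1 := by
    have : (c:ℂ) * w = -1 := by linear_combination h
    rw [this]; simp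
  have hw : ‖w‖ = 1 := by simpa using hw
  rw [norm_mul, hw, mul_one, Complex.norm_real, Real.norm_eq_abs] at h1
  linarith

lemma mb_maps {c : ℝ} (hc : |c| < 1) : MapsTo (mb c) (sphere 0 1) (sphere 0 1) := by
  intro w hw
  have h1 := mb_den hc hw
  have hw' : ‖w‖ = 1 := by simpa using hw
  have e : w + c = w * conj (1 + (c:ℂ) * w) := by
    have : w * conj w = 1 := by rw [Complex.mul_conj, Complex.normSq_eq_norm_sq, hw']; simp
    simp only [map_add, map_mul, map_one, Complex.conj_ofReal]
    linear_combination -(c:ℂ) * this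
  rw [mem_sphere_zero_iff_norm, mb, norm_div, e, norm_mul, hw', one_mul, Complex.norm_conj, div_self (norm_ne_zero_iff.2 h1)]

lemma mb_cont {c : ℝ} (hc : |c| < 1) : ContinuousOn (mb c) (sphere 0 1) :=
  ContinuousOn.div (by fun_prop) (by fun_prop) fun w hw => mb_den hc hw

lemma mb_mb {c : ℝ} (hc : |c| < 1) {w : ℂ} (hw : w ∈ sphere (0:ℂ) 1) : mb (-c) (mb c w) = w := by
  have h1 := mb_den hc hw
  have h2 := mb_den (c := -c) (by rwa [abs_neg]) (mb_maps hc hw)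
  rw [mb, div_eq_iff h2]
  have h3 : mb c w * (1 + c * w) = w + c := div_mul_cancel₀ _ h1
  push_cast
  linear_combination h3

noncomputable def mbH {c : ℝ} (hc : |c| < 1) : ℂ ≃ₜ ℂ where
  toFun := cone (mb c)
  invFun := cone (mb (-c))
  left_inv := cone_cone (mb_maps hc) fun z hz => mb_mb hc hz
  right_inv := cone_cone (mb_maps (by rwa [abs_neg])) fun z hz => by
    have := mb_mb (c := -c) (by rwa [abs_neg]) hz
    rwa [neg_neg] at this
  continuous_toFun := cone_cont (mb_maps hc) (mb_cont hc)
  continuous_invFun := cone_cont (mb_maps (by rwa [abs_neg])) (mb_cont (by rwa [abs_neg]))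

noncomputable def rotH (u : ℂ) (hu : ‖u‖ = 1) : ℂ ≃ₜ ℂ := Homeomorph.mulLeft₀ u (fun h => by rw [h] at hu; simp at hu)

lemma rotH_apply {u : ℂ} (hu : ‖u‖ = 1) (z : ℂ) : rotH u hu z = u * z := rfl

lemma mob2 {p q : ℂ} (hp : ‖p‖ = 2) (hq : ‖q‖ = 2) (hpq : p ≠ q) :
    ∃ g : ℂ ≃ₜ ℂ, (∀ z, ‖g z‖ = ‖z‖) ∧ g p = 2 ∧ g q = -2 := by
  have hpq0 : p * q ≠ 0 := mul_ne_zero (fun h => by rw [h] at hp; simp at hp) (fun h => by rw [h] at hq; simp at hq)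
  obtain ⟨u, hu, hy⟩ : ∃ u : ℂ, u ^ 2 = 4 / (p * q) ∧ 0 ≤ (u * p).im := by
    obtain ⟨u, hu⟩ := IsAlgClosed.exists_pow_nat_eq (4 / (p * q)) (n := 2) (by norm_num)
    rcases le_total 0 (u * p).im with h | h
    · exact ⟨u, hu, h⟩
    · exact ⟨-u, by rw [neg_sq, hu], by rw [neg_mul, Complex.neg_im]; linarith⟩
  have hun : ‖u‖ = 1 := by
    have := congrArg norm hu
    rw [norm_pow, norm_div, norm_mul, hp, hq] at this
    norm_num at this
    rcases this with h | h
    · exact h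
    · linarith [norm_nonneg u]
  set P := u * p / 2 with hP
  have hPn : ‖P‖ = 1 := by rw [hP, norm_div, norm_mul, hun, hp]; norm_num
  have hPc : P * conj P = 1 := by rw [Complex.mul_conj, Complex.normSq_eq_norm_sq, hPn]; simp
  have hP0 : P ≠ 0 := fun h => by rw [h] at hPn; simp at hPn
  have huq : u * q / 2 = conj P := by
    have : P * (u * q / 2) = P * conj P := by
      rw [hPc, hP]
      have : u * p / 2 * (u * q / 2) = u ^ 2 * (p * q) / 4 := by ring
      rw [this, hu, div_mul_cancel₀ _ hpq0]; norm_num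
    exact mul_left_cancel₀ hP0 this
  have hPim : 0 < P.im := by
    have h1 : P.im = (u * p).im / 2 := by rw [hP, Complex.div_ofNat_im]
    refine lt_of_le_of_ne (by rw [h1]; linarith) fun h => hpq ?_
    have : conj P = P := Complex.conj_eq_iff_im.2 h.symm
    rw [this, hP] at huq
    have hu0 : u ≠ 0 := fun h => by rw [h] at hun; simp at hun
    have h3 : u * q = u * p := by linear_combination 2 * huq
    exact (mul_left_cancel₀ hu0 h3).symm
  have hsq : P.re ^ 2 + P.im ^ 2 = 1 := by
    have := Complex.sq_norm P
    rw [hPn, Complex.normSq_apply] at this; nlinarith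
  set c : ℝ := -P.re / (1 + P.im) with hcd
  have hy1 : 0 < 1 + P.im := by linarith
  have hc : |c| < 1 := by
    rw [hcd, abs_div, abs_neg, abs_of_pos hy1, div_lt_one hy1]
    have : |P.re| ≤ 1 := abs_le_one_iff_mul_self_le_one.2 (by nlinarith)
    linarith
  have hcm : c * (1 + P.im) = -P.re := by rw [hcd]; field_simp
  have hPs : P ∈ sphere (0:ℂ) 1 := by simpa using hPn
  have hPs' : conj P ∈ sphere (0:ℂ) 1 := by simpa using hPn
  have m1 : mb c P = Complex.I := by
    rw [mb, div_eq_iff (mb_den hc hPs)]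
    apply Complex.ext
    · simp; linarith
    · simp
      have : (1 + P.im) * (1 + c * P.re - P.im) = 0 := by linear_combination P.re * hcm - hsq
      rcases mul_eq_zero.1 this with h | h <;> linarith
  have m2 : mb c (conj P) = -Complex.I := by
    have : mb c (conj P) = conj (mb c P) := by simp [mb]
    rw [this, m1, Complex.conj_I]
  have cn : ∀ z : ℂ, ‖z‖ = 1 → cone (mb c) (2 * z) = 2 * mb c z := by
    intro z hz
    have : ‖2 * z‖ = 2 := by rw [norm_mul, hz]; norm_num
    rw [cone, this]
    congr 2
    push_cast
    field_simp
  refine ⟨((rotH u hun).trans (mbH hc)).trans (rotH (-Complex.I) (by simp)), fun z => ?_, ?_, ?_⟩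
  · simp only [Homeomorph.trans_apply, rotH_apply]
    rw [norm_mul]
    change ‖-Complex.I‖ * ‖cone (mb c) (u * z)‖ = _
    rw [cone_norm (mb_maps hc), norm_mul, hun]; simp
  · simp only [Homeomorph.trans_apply, rotH_apply]
    change -Complex.I * cone (mb c) (u * p) = _
    have : u * p = 2 * P := by rw [hP]; ring
    rw [this, cn P hPn, m1]
    linear_combination -2 * Complex.I_mul_I
  · simp only [Homeomorph.trans_apply, rotH_apply]
    change -Complex.I * cone (mb c) (u * q) = _
    have : u * q = 2 * conj P := by rw [← huq]; ring
    rw [this, cn _ (by rw [Complex.norm_conj, hPn]), m2]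
    linear_combination 2 * Complex.I_mul_I

structure Arc (a : ℝ → ℂ) : Prop where
  c : ContinuousOn a (Icc 0 1)
  i : InjOn a (Icc 0 1)
  n0 : ‖a 0‖ = 1
  n1 : ‖a 1‖ = 2
  m : ∀ t ∈ Ioo (0:ℝ) 1, 1 < ‖a t‖ ∧ ‖a t‖ < 2

lemma Pres.arc {f : ℂ ≃ₜ ℂ} (F : Pres f) {a : ℝ → ℂ} (A : Arc a) : Arc (fun t => f (a t)) :=
  ⟨f.continuous.comp_continuousOn A.c, fun _ ht _ hu e => A.i ht hu (f.injective e), F.b _ A.n0, F.d _ A.n1,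
    fun t ht => F.c _ (A.m t ht).1 (A.m t ht).2⟩

lemma Arc.norm_mem {a : ℝ → ℂ} (A : Arc a) {t : ℝ} (ht : t ∈ Icc (0:ℝ) 1) : 1 ≤ ‖a t‖ ∧ ‖a t‖ ≤ 2 := by
  rcases i01 ht with rfl | rfl | h
  · rw [A.n0]; norm_num
  · rw [A.n1]; norm_num
  · exact ⟨(A.m t h).1.le, (A.m t h).2.le⟩

noncomputable def hat (a : ℝ → ℂ) (r : ℝ) : ℂ := (min r 1 : ℝ) * a (max (r - 1) 0)

lemma hat_cont {a : ℝ → ℂ} (A : Arc a) : ContinuousOn (hat a) (Icc 0 2) := by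
  unfold hat
  refine ContinuousOn.mul (by fun_prop) (A.c.comp (by fun_prop) fun r hr => ?_)
  exact ⟨le_max_right _ _, max_le (by linarith [hr.2]) zero_le_one⟩

lemma hat_lo {a : ℝ → ℂ} {r : ℝ} (h : r ≤ 1) : hat a r = r * a 0 := by
  rw [hat, min_eq_left h, max_eq_right (by linarith)]

lemma hat_hi {a : ℝ → ℂ} {r : ℝ} (h : 1 ≤ r) : hat a r = a (r - 1) := by
  rw [hat, min_eq_right h, max_eq_left (by linarith)]; simp

lemma hat_zero (a : ℝ → ℂ) : hat a 0 = 0 := by rw [hat_lo (by norm_num)]; simp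

lemma hat_norm_lo {a : ℝ → ℂ} (A : Arc a) {r : ℝ} (h0 : 0 ≤ r) (h : r ≤ 1) : ‖hat a r‖ = r := by
  rw [hat_lo h, norm_mul, A.n0, mul_one, Complex.norm_real, Real.norm_eq_abs, abs_of_nonneg h0]

lemma hat_norm_hi {a : ℝ → ℂ} (A : Arc a) {r : ℝ} (h : 1 < r) (h2 : r < 2) : 1 < ‖hat a r‖ ∧ ‖hat a r‖ < 2 := by
  rw [hat_hi h.le]; exact A.m _ ⟨by linarith, by linarith⟩

lemma hat_two {a : ℝ → ℂ} : hat a 2 = a 1 := by rw [hat_hi (by norm_num)]; norm_num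

lemma hat_lt {a : ℝ → ℂ} (A : Arc a) {r : ℝ} (h0 : 0 ≤ r) (h2 : r < 2) : ‖hat a r‖ < 2 := by
  rcases le_or_gt r 1 with h | h
  · rw [hat_norm_lo A h0 h]; linarith
  · exact (hat_norm_hi A h h2).2

lemma hat_gt {a : ℝ → ℂ} (A : Arc a) {r : ℝ} (h : 1 < r) (h2 : r ≤ 2) : 1 < ‖hat a r‖ := by
  rcases eq_or_lt_of_le h2 with rfl | h2
  · rw [hat_two, A.n1]; norm_num
  · exact (hat_norm_hi A h h2).1

lemma hat_hat {a b : ℝ → ℂ} (A : Arc a) (B : Arc b) (h : ∀ t ∈ Icc (0:ℝ) 1, ∀ u ∈ Icc (0:ℝ) 1, a t = b u → t = u)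
    {r s : ℝ} (hr : r ∈ Icc (0:ℝ) 2) (hs : s ∈ Icc (0:ℝ) 2) (e : hat a r = hat b s) : r = s := by
  rcases le_or_gt r 1 with h1 | h1 <;> rcases le_or_gt s 1 with h2 | h2
  · rw [← hat_norm_lo A hr.1 h1, ← hat_norm_lo B hs.1 h2, e]
  · have := hat_gt B h2 hs.2; rw [← e, hat_norm_lo A hr.1 h1] at this; linarith
  · have := hat_gt A h1 hr.2; rw [e, hat_norm_lo B hs.1 h2] at this; linarith
  · rw [hat_hi h1.le, hat_hi h2.le] at e
    have := h _ ⟨by linarith, by linarith [hr.2]⟩ _ ⟨by linarith, by linarith [hs.2]⟩ e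
    linarith

lemma hat_dj {a b : ℝ → ℂ} (A : Arc a) (B : Arc b) (h : Dj a b)
    {r s : ℝ} (hr : r ∈ Icc (0:ℝ) 2) (hs : s ∈ Icc (0:ℝ) 2) (e : hat a r = hat b s) : r = 0 ∧ s = 0 := by
  have hrs := hat_hat A B (fun t ht u hu e => absurd e (h t ht u hu)) hr hs e
  subst hrs
  rcases le_or_gt r 1 with h1 | h1
  · rw [hat_lo h1, hat_lo h1] at e
    by_contra hc
    have : (r:ℂ) ≠ 0 := fun h => hc ⟨by exact_mod_cast h, by exact_mod_cast h⟩
    exact h 0 z01 0 z01 (mul_left_cancel₀ this e)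
  · rw [hat_hi h1.le, hat_hi h1.le] at e
    exact absurd e (h _ ⟨by linarith, by linarith [hr.2]⟩ _ ⟨by linarith, by linarith [hr.2]⟩)

noncomputable def Gm (a b : ℝ → ℂ) (t : ℝ) : ℂ := hat a (max (2 - 4 * t) 0) + hat b (max (4 * t - 2) 0)

lemma Gm_lo {a b : ℝ → ℂ} {t : ℝ} (h : t ≤ 1/2) : Gm a b t = hat a (2 - 4 * t) := by
  rw [Gm, max_eq_left (by linarith), max_eq_right (by linarith), hat_zero, add_zero]

lemma Gm_hi {a b : ℝ → ℂ} {t : ℝ} (h : 1/2 ≤ t) : Gm a b t = hat b (4 * t - 2) := by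
  rw [Gm, max_eq_right (by linarith), max_eq_left (by linarith), hat_zero, zero_add]

lemma Gm_cut {a b : ℝ → ℂ} (A : Arc a) (B : Arc b) (h : Dj a b) : Cut (closedBall (0:ℂ) 2) (Gm a b) := by
  have hint : interior (closedBall (0:ℂ) 2) = ball 0 2 := interior_closedBall _ (by norm_num)
  have hfr : frontier (closedBall (0:ℂ) 2) = sphere 0 2 := frontier_closedBall _ (by norm_num)
  refine ⟨?_, ?_, ?_, ?_, ?_⟩
  · unfold Gm
    refine ContinuousOn.add ((hat_cont A).comp (by fun_prop) fun t ht => ?_) ((hat_cont B).comp (by fun_prop) fun t ht => ?_)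
    · exact ⟨le_max_right _ _, max_le (by linarith [ht.1]) (by norm_num)⟩
    · exact ⟨le_max_right _ _, max_le (by linarith [ht.2]) (by norm_num)⟩
  · intro t ht u hu e
    rcases le_total t (1/2) with h1 | h1 <;> rcases le_total u (1/2) with h2 | h2
    · rw [Gm_lo h1, Gm_lo h2] at e
      have := hat_hat A A (fun t ht u hu e => A.i ht hu e) ⟨by linarith, by linarith [ht.1]⟩ ⟨by linarith, by linarith [hu.1]⟩ e
      linarith
    · rw [Gm_lo h1, Gm_hi h2] at e
      have := hat_dj A B h ⟨by linarith, by linarith [ht.1]⟩ ⟨by linarith, by linarith [hu.2]⟩ e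
      linarith
    · rw [Gm_hi h1, Gm_lo h2] at e
      have := hat_dj A B h ⟨by linarith, by linarith [hu.1]⟩ ⟨by linarith, by linarith [ht.2]⟩ e.symm
      linarith
    · rw [Gm_hi h1, Gm_hi h2] at e
      have := hat_hat B B (fun t ht u hu e => B.i ht hu e) ⟨by linarith, by linarith [ht.2]⟩ ⟨by linarith, by linarith [hu.2]⟩ e
      linarith
  · rw [hfr, Gm_lo (by norm_num)]; norm_num [hat_two, A.n1]
  · rw [hfr, Gm_hi (by norm_num)]; norm_num [hat_two, B.n1]
  · intro t ht
    rw [hint, mem_ball_zero_iff]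
    rcases le_total t (1/2) with h1 | h1
    · rw [Gm_lo h1]; exact hat_lt A (by linarith) (by linarith [ht.1])
    · rw [Gm_hi h1]; exact hat_lt B (by linarith) (by linarith [ht.2])

lemma diam_cut : Cut (closedBall (0:ℂ) 2) (fun t : ℝ => ((2 - 4 * t : ℝ) : ℂ)) := by
  have hint : interior (closedBall (0:ℂ) 2) = ball 0 2 := interior_closedBall _ (by norm_num)
  have hfr : frontier (closedBall (0:ℂ) 2) = sphere 0 2 := frontier_closedBall _ (by norm_num)
  refine ⟨by fun_prop, fun t _ u _ e => ?_, ?_, ?_, ?_⟩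
  · have := Complex.ofReal_injective e; linarith
  · rw [hfr]; norm_num
  · rw [hfr]; norm_num
  · intro t ht
    rw [hint, mem_ball_zero_iff, Complex.norm_real, Real.norm_eq_abs, abs_lt]
    constructor <;> linarith [ht.1, ht.2]

lemma half_up {e : ℝ → ℂ} (c : ContinuousOn e (Icc 0 1)) (i : InjOn e (Icc 0 1)) (e0 : e 0 = 1) (e1 : e 1 = -1)
    (h : ∀ t ∈ Ioo (0:ℝ) 1, ‖e t‖ < 2 ∧ 0 < (e t).im) :
    ∃ f : ℂ ≃ₜ ℂ, (∀ z : ℂ, ¬ (‖z‖ < 2 ∧ 0 < z.im) → f z = z) ∧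
      ∀ t ∈ Icc (0:ℝ) 1, f (e t) = Complex.exp ((Real.pi * t : ℝ) * Complex.I) := by
  have hint : interior (closedBall (0:ℂ) 2) = ball 0 2 := interior_closedBall _ (by norm_num)
  set C : Set ℂ := closedBall (0:ℂ) 2 ∩ {z : ℂ | 0 ≤ z.im + 0 * z.re} with hC
  have Ccpt : IsCompact C := (isCompact_closedBall _ _).inter_right (isClosed_le continuous_const (by fun_prop))
  have inI : ∀ z : ℂ, ‖z‖ < 2 → 0 < z.im → z ∈ interior C := fun z h1 h2 =>
    half_int' (by rw [hint]; simpa using h1) (by simpa using h2)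
  have inI' : ∀ z : ℂ, z ∈ interior C → ‖z‖ < 2 ∧ 0 < z.im := fun z h1 => by
    have := half_int h1
    rw [hint] at this; simpa using this
  have mkC : ∀ e : ℝ → ℂ, ContinuousOn e (Icc 0 1) → InjOn e (Icc 0 1) → e 0 = 1 → e 1 = -1 →
      (∀ t ∈ Ioo (0:ℝ) 1, ‖e t‖ < 2 ∧ 0 < (e t).im) → Cut C e := by
    intro e c i e0 e1 h
    refine Cut.mk' c i ?_ ?_ ?_ ?_ fun t ht => inI _ (h t ht).1 (h t ht).2
    · rw [e0]; refine ⟨by simp, by simp⟩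
    · rw [e0]; intro h; have := (inI' _ h).2; simp at this
    · rw [e1]; refine ⟨by simp, by simp⟩
    · rw [e1]; intro h; have := (inI' _ h).2; simp at this
  have cut2 : Cut C (fun t : ℝ => Complex.exp ((Real.pi * t : ℝ) * Complex.I)) := by
    refine mkC _ (by fun_prop) (fun t ht u hu e => ?_) (by simp) (by simp) fun t ht => ?_
    · have hp := Real.pi_pos
      have := expI_inj (u := 0) ⟨mul_nonneg hp.le ht.1, by nlinarith [ht.2]⟩ ⟨mul_nonneg hp.le hu.1, by nlinarith [hu.2]⟩ e
      exact mul_left_cancel₀ hp.ne' this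
    · rw [Complex.norm_exp_ofReal_mul_I, Complex.exp_ofReal_mul_I_im]
      exact ⟨by norm_num, Real.sin_pos_of_pos_of_lt_pi (mul_pos Real.pi_pos ht.1) (by nlinarith [ht.2, Real.pi_pos])⟩
  obtain ⟨f, f1, f2⟩ := T_conv (half_conv (convex_closedBall _ _) _ _) Ccpt
    ⟨Complex.I, inI _ (by simp) (by simp)⟩ (mkC e c i e0 e1 h) cut2 (by simp [e0]) (by simp [e1])
  exact ⟨f, fun z hz => f1 z fun hc => hz (inI' z hc), f2⟩

lemma half_down {e : ℝ → ℂ} (c : ContinuousOn e (Icc 0 1)) (i : InjOn e (Icc 0 1)) (e0 : e 0 = 1) (e1 : e 1 = -1)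
    (h : ∀ t ∈ Ioo (0:ℝ) 1, ‖e t‖ < 2 ∧ (e t).im < 0) :
    ∃ f : ℂ ≃ₜ ℂ, (∀ z : ℂ, ¬ (‖z‖ < 2 ∧ z.im < 0) → f z = z) ∧
      ∀ t ∈ Icc (0:ℝ) 1, f (e t) = Complex.exp ((-(Real.pi * t) : ℝ) * Complex.I) := by
  have cinj : Function.Injective (conj : ℂ → ℂ) := (starRingEnd ℂ).injective
  obtain ⟨f, f1, f2⟩ := half_up (e := fun t => conj (e t)) (Complex.continuous_conj.comp_continuousOn c)
    (fun t ht u hu e => i ht hu (cinj e)) (by simp [e0]) (by simp [e1])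
    (fun t ht => by simpa using h t ht)
  let cj : ℂ ≃ₜ ℂ := Complex.conjCLE.toHomeomorph
  have hcj : ∀ z, cj z = conj z := fun z => rfl
  refine ⟨(cj.trans f).trans cj, fun z hz => ?_, fun t ht => ?_⟩
  · simp only [Homeomorph.trans_apply, hcj]
    rw [f1 _ (by simpa using hz)]; simp
  · simp only [Homeomorph.trans_apply, hcj]
    rw [f2 t ht, ← Complex.exp_conj]; simp

lemma sign_const {g : ℝ → ℝ} (hc : ContinuousOn g (Ioo 0 1)) (hn : ∀ t ∈ Ioo (0:ℝ) 1, g t ≠ 0)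
    {t0 : ℝ} (h0 : t0 ∈ Ioo (0:ℝ) 1) (hp : 0 < g t0) : ∀ t ∈ Ioo (0:ℝ) 1, 0 < g t := by
  intro t ht
  by_contra hcon
  push Not at hcon
  obtain ⟨u, hu, e⟩ := isPreconnected_Ioo.intermediate_value ht h0 hc (show (0:ℝ) ∈ Icc _ _ from ⟨hcon, hp.le⟩)
  exact hn u hu e

lemma H0 {a b : ℝ → ℂ} (A : Arc a) (B : Arc b) (D : Dj a b) (a1 : a 1 = 2) (b1 : b 1 = -2) :
    ∃ F : ℂ ≃ₜ ℂ, Pres F ∧ ∀ t ∈ Icc (0:ℝ) 1, F (a t) = ((1 + t : ℝ) : ℂ) := by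
  have hint : interior (closedBall (0:ℂ) 2) = ball 0 2 := interior_closedBall _ (by norm_num)
  obtain ⟨h, hid, he⟩ := T_conv (convex_closedBall (0:ℂ) 2) (isCompact_closedBall _ _) ⟨0, by rw [hint]; simp⟩
    (Gm_cut A B D) diam_cut
    (by rw [Gm_lo (by norm_num)]; norm_num [hat_two, a1]) (by rw [Gm_hi (by norm_num)]; norm_num [hat_two, b1])
  have id2 : ∀ z : ℂ, 2 ≤ ‖z‖ → h z = z := fun z hz => hid z (by rw [hint]; simpa using hz)
  have b2 : ∀ {f : ℂ ≃ₜ ℂ}, (∀ z : ℂ, 2 ≤ ‖z‖ → f z = z) → ∀ z : ℂ, ‖z‖ < 2 → ‖f z‖ < 2 := by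
    intro f hf z hz
    by_contra hc; push Not at hc
    have := f.injective (hf _ hc)
    rw [this] at hc; linarith
  have ha : ∀ r ∈ Icc (0:ℝ) 2, h (hat a r) = (r : ℂ) := fun r hr => by
    have := he ((2 - r) / 4) ⟨by linarith [hr.2], by linarith [hr.1]⟩
    rw [Gm_lo (by linarith [hr.1]), show 2 - 4 * ((2 - r) / 4) = r by ring] at this
    exact this
  have hb : ∀ r ∈ Icc (0:ℝ) 2, h (hat b r) = ((-r : ℝ) : ℂ) := fun r hr => by
    have := he ((2 + r) / 4) ⟨by linarith [hr.1], by linarith [hr.2]⟩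
    rw [Gm_hi (by linarith [hr.1]), show 2 - 4 * ((2 + r) / 4) = -r by ring, show 4 * ((2 + r) / 4) - 2 = r by ring] at this
    exact this
  have h00 : h 0 = 0 := by have := ha 0 ⟨le_rfl, by norm_num⟩; rwa [hat_zero, Complex.ofReal_zero] at this
  have ha0 : h (a 0) = 1 := by
    have := ha 1 (by norm_num); rw [hat_hi le_rfl] at this; simpa using this
  have hb0 : h (b 0) = -1 := by
    have := hb 1 (by norm_num); rw [hat_hi le_rfl] at this; simpa using this
  -- unit points with real image
  have unit : ∀ z : ℂ, ‖z‖ = 1 → (h z).im = 0 → z = a 0 ∨ z = b 0 := by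
    have one : ∀ {c : ℝ → ℂ}, Arc c → ∀ r ∈ Icc (0:ℝ) 2, ‖hat c r‖ = 1 → hat c r = c 0 := by
      intro c C r hr hn
      rcases le_or_gt r 1 with h1 | h1
      · rw [hat_norm_lo C hr.1 h1] at hn; rw [hn, hat_hi le_rfl]; simp
      · have := hat_gt C h1 hr.2; linarith
    intro z hz him
    have h2 := b2 id2 z (by linarith)
    have hr : h z = ((h z).re : ℂ) := Complex.ext rfl (by simpa using him)
    have hab := Complex.abs_re_le_norm (h z)
    rcases le_total 0 (h z).re with h1 | h1
    · left
      have hm : (h z).re ∈ Icc (0:ℝ) 2 := ⟨h1, by rw [abs_of_nonneg h1] at hab; linarith⟩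
      have e : hat a (h z).re = z := h.injective (by rw [ha _ hm]; exact hr.symm)
      rw [← one A _ hm (by rw [e, hz]), e]
    · right
      have hm : -(h z).re ∈ Icc (0:ℝ) 2 := ⟨by linarith, by rw [abs_of_nonpos h1] at hab; linarith⟩
      have e : hat b (-(h z).re) = z := h.injective (by rw [hb _ hm, neg_neg]; exact hr.symm)
      rw [← one B _ hm (by rw [e, hz]), e]
  -- crossing points on the imaginary axis
  have axis : ∀ w : ℂ, ‖w‖ = 2 → ∃ r ∈ Ioo (0:ℝ) 1, ‖h.symm (r * w)‖ = 1 := by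
    intro w hw
    have hcn : ContinuousOn (fun r : ℝ => ‖h.symm (r * w)‖) (Icc 0 1) := by
      have : Continuous fun r : ℝ => h.symm (r * w) := h.symm.continuous.comp (by fun_prop)
      exact this.norm.continuousOn
    have s0 : h.symm 0 = 0 := by rw [h.symm_apply_eq, h00]
    have sw : h.symm w = w := by rw [h.symm_apply_eq, id2 w hw.ge]
    obtain ⟨r, hr, e⟩ := isPreconnected_Icc.intermediate_value z01 o01 hcn (show (1:ℝ) ∈ Icc _ _ from
      ⟨by simp [s0], by simp [sw, hw]⟩)
    have e : ‖h.symm (r * w)‖ = 1 := e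
    refine ⟨r, ⟨lt_of_le_of_ne hr.1 fun h => ?_, lt_of_le_of_ne hr.2 fun h => ?_⟩, e⟩
    · rw [← h] at e; simp [s0] at e
    · rw [h] at e; simp [sw, hw] at e
  have hab0 : a 0 ≠ b 0 := D 0 z01 0 z01
  obtain ⟨α, β, αc, βc, αi, βi, α0, α1, β0, β1, hun, -⟩ := circ_arcs (p := a 0) (q := b 0) (by simpa using A.n0) (by simpa using B.n0) hab0
  have αn : ∀ t ∈ Icc (0:ℝ) 1, ‖α t‖ = 1 := fun t ht => by
    have : α t ∈ sphere (0:ℂ) 1 := by rw [← hun]; exact Or.inl ⟨t, ht, rfl⟩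
    simpa using this
  have βn : ∀ t ∈ Icc (0:ℝ) 1, ‖β t‖ = 1 := fun t ht => by
    have : β t ∈ sphere (0:ℂ) 1 := by rw [← hun]; exact Or.inr ⟨t, ht, rfl⟩
    simpa using this
  have nim : ∀ γ : ℝ → ℂ, InjOn γ (Icc 0 1) → γ 0 = a 0 → γ 1 = b 0 → (∀ t ∈ Icc (0:ℝ) 1, ‖γ t‖ = 1) →
      ∀ t ∈ Ioo (0:ℝ) 1, (h (γ t)).im ≠ 0 := by
    intro γ γi γ0 γ1 γn t ht him
    have htI := Ioo_subset_Icc_self ht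
    rcases unit _ (γn t htI) him with e | e
    · rw [← γ0] at e; have := γi htI z01 e; linarith [ht.1]
    · rw [← γ1] at e; have := γi htI o01 e; linarith [ht.2]
  have gc : ∀ γ : ℝ → ℂ, Continuous γ → Continuous fun t => (h (γ t)).im := fun γ hγ =>
    Complex.continuous_im.comp (h.continuous.comp hγ)
  -- points above and below
  have find : ∀ w : ℂ, ‖w‖ = 2 → w.im ≠ 0 → ∃ t ∈ Ioo (0:ℝ) 1, ∃ r > (0:ℝ), (h (α t)).im = r * w.im ∨ (h (β t)).im = r * w.im := by
    intro w hw hwi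
    obtain ⟨r, hr, e⟩ := axis w hw
    have hm : h.symm (r * w) ∈ sphere (0:ℂ) 1 := by simpa using e
    have him : ((r:ℂ) * w).im = r * w.im := by simp
    have hne : r * w.im ≠ 0 := mul_ne_zero hr.1.ne' hwi
    rw [← hun] at hm
    rcases hm with ⟨t, ht, e⟩ | ⟨t, ht, e⟩
    · have e2 : h (α t) = r * w := by rw [e, h.apply_symm_apply]
      refine ⟨t, ?_, r, hr.1, Or.inl (by rw [e2, him])⟩
      rcases i01 ht with rfl | rfl | h'
      · rw [α0, ha0] at e2; rw [← him, ← e2] at hne; simp at hne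
      · rw [α1, hb0] at e2; rw [← him, ← e2] at hne; simp at hne
      · exact h'
    · have e2 : h (β t) = r * w := by rw [e, h.apply_symm_apply]
      refine ⟨t, ?_, r, hr.1, Or.inr (by rw [e2, him])⟩
      rcases i01 ht with rfl | rfl | h'
      · rw [β0, ha0] at e2; rw [← him, ← e2] at hne; simp at hne
      · rw [β1, hb0] at e2; rw [← him, ← e2] at hne; simp at hne
      · exact h'
  have pos := fun (γ : ℝ → ℂ) (γc : Continuous γ) γi γ0 γ1 γn (t0 : ℝ) (h0 : t0 ∈ Ioo (0:ℝ) 1) (hp : 0 < (h (γ t0)).im) =>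
    sign_const (gc γ γc).continuousOn (nim γ γi γ0 γ1 γn) h0 hp
  have neg := fun (γ : ℝ → ℂ) (γc : Continuous γ) γi γ0 γ1 γn (t0 : ℝ) (h0 : t0 ∈ Ioo (0:ℝ) 1) (hp : 0 < -(h (γ t0)).im) =>
    sign_const (gc γ γc).neg.continuousOn (fun t ht => neg_ne_zero.2 (nim γ γi γ0 γ1 γn t ht)) h0 hp
  obtain ⟨γ, γ', γc, γc', γi, γi', γ0, γ1, γ0', γ1', γn, γn', hun', γp, γp'⟩ : ∃ γ γ' : ℝ → ℂ, Continuous γ ∧ Continuous γ' ∧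
      InjOn γ (Icc 0 1) ∧ InjOn γ' (Icc 0 1) ∧ γ 0 = a 0 ∧ γ 1 = b 0 ∧ γ' 0 = a 0 ∧ γ' 1 = b 0 ∧
      (∀ t ∈ Icc (0:ℝ) 1, ‖γ t‖ = 1) ∧ (∀ t ∈ Icc (0:ℝ) 1, ‖γ' t‖ = 1) ∧ γ '' Icc 0 1 ∪ γ' '' Icc 0 1 = sphere 0 1 ∧
      (∀ t ∈ Ioo (0:ℝ) 1, 0 < (h (γ t)).im) ∧ ∀ t ∈ Ioo (0:ℝ) 1, 0 < -(h (γ' t)).im := by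
    obtain ⟨t, ht, r, hr, e⟩ := find (2 * Complex.I) (by simp) (by simp)
    obtain ⟨t', ht', r', hr', e'⟩ := find (-2 * Complex.I) (by simp) (by simp)
    have q : 0 < r * (2 * Complex.I).im := by simp; exact hr
    have q' : 0 < -(r' * (-2 * Complex.I).im) := by simp; exact hr'
    rcases e with e | e <;> rcases e' with e' | e' <;> rw [← e] at q <;> rw [← e'] at q'
    · have := pos α αc αi α0 α1 αn t ht q t' ht'; linarith
    · exact ⟨α, β, αc, βc, αi, βi, α0, α1, β0, β1, αn, βn, hun, pos α αc αi α0 α1 αn t ht q, neg β βc βi β0 β1 βn t' ht' q'⟩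
    · exact ⟨β, α, βc, αc, βi, αi, β0, β1, α0, α1, βn, αn, by rw [union_comm]; exact hun, pos β βc βi β0 β1 βn t ht q, neg α αc αi α0 α1 αn t' ht' q'⟩
    · have := pos β βc βi β0 β1 βn t ht q t' ht'; linarith
  have hinj : ∀ γ : ℝ → ℂ, InjOn γ (Icc 0 1) → InjOn (fun t => h (γ t)) (Icc 0 1) := fun γ γi t ht u hu e => γi ht hu (h.injective e)
  obtain ⟨f, f1, f2⟩ := half_up (e := fun t => h (γ t)) (h.continuous.comp γc).continuousOn (hinj γ γi) (by simp only [γ0, ha0]) (by simp only [γ1, hb0])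
    (fun t ht => ⟨b2 id2 _ (by rw [γn t (Ioo_subset_Icc_self ht)]; norm_num), γp t ht⟩)
  obtain ⟨g, g1, g2⟩ := half_down (e := fun t => h (γ' t)) (h.continuous.comp γc').continuousOn (hinj γ' γi') (by simp only [γ0', ha0]) (by simp only [γ1', hb0])
    (fun t ht => ⟨b2 id2 _ (by rw [γn' t (Ioo_subset_Icc_self ht)]; norm_num), by linarith [γp' t ht]⟩)
  set F : ℂ ≃ₜ ℂ := (h.trans f).trans g with hF
  have Fz : ∀ z, F z = g (f (h z)) := fun z => rfl
  have fixr : ∀ z : ℂ, (h z).im = 0 → F z = h z := fun z hz => by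
    rw [Fz, f1 _ (fun hc => by linarith [hc.2]), g1 _ (fun hc => by linarith [hc.2])]
  have F0 : F 0 = 0 := by rw [fixr _ (by rw [h00]; rfl), h00]
  have Fout : ∀ z : ℂ, 2 ≤ ‖z‖ → F z = z := fun z hz => by
    rw [Fz, id2 z hz, f1 _ (fun hc => by linarith [hc.1]), g1 _ (fun hc => by linarith [hc.1])]
  have Fγ : ∀ t ∈ Icc (0:ℝ) 1, F (γ t) = Complex.exp ((Real.pi * t : ℝ) * Complex.I) := fun t ht => by
    rw [Fz, f2 t ht]
    refine g1 _ fun hc => ?_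
    have := hc.2
    rw [Complex.exp_ofReal_mul_I_im] at this
    have := Real.sin_nonneg_of_nonneg_of_le_pi (mul_nonneg Real.pi_pos.le ht.1) (by nlinarith [ht.2, Real.pi_pos])
    linarith
  have Fγ' : ∀ t ∈ Icc (0:ℝ) 1, F (γ' t) = Complex.exp ((-(Real.pi * t) : ℝ) * Complex.I) := fun t ht => by
    rw [Fz, f1, g2 t ht]
    intro hc
    rcases i01 ht with rfl | rfl | h'
    · rw [γ0', ha0] at hc; simp at hc
    · rw [γ1', hb0] at hc; simp at hc
    · linarith [hc.2, γp' t h']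
  have Fs : ∀ z : ℂ, ‖z‖ = 1 → ‖F z‖ = 1 := fun z hz => by
    have hm : z ∈ sphere (0:ℂ) 1 := by simpa using hz
    rw [← hun'] at hm
    rcases hm with ⟨t, ht, rfl⟩ | ⟨t, ht, rfl⟩
    · rw [Fγ t ht, Complex.norm_exp_ofReal_mul_I]
    · rw [Fγ' t ht, Complex.norm_exp_ofReal_mul_I]
  have Fs' : ∀ w : ℂ, ‖w‖ = 1 → ‖F.symm w‖ = 1 := fun w hw => by
    obtain ⟨t, ht, rfl⟩ := sphere_param (z := w) (by simpa using hw) (-Real.pi)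
    have hp := Real.pi_pos
    rcases le_total 0 t with h0 | h0
    · have hm : t / Real.pi ∈ Icc (0:ℝ) 1 := ⟨div_nonneg h0 hp.le, (div_le_one hp).2 (by linarith [ht.2])⟩
      have := Fγ _ hm
      rw [mul_div_cancel₀ _ hp.ne'] at this
      rw [← this, F.symm_apply_apply, γn _ hm]
    · have hm : -t / Real.pi ∈ Icc (0:ℝ) 1 := ⟨div_nonneg (by linarith) hp.le, (div_le_one hp).2 (by linarith [ht.1])⟩
      have := Fγ' _ hm
      rw [mul_div_cancel₀ _ hp.ne', neg_neg] at this
      rw [← this, F.symm_apply_apply, γn' _ hm]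
  have ballp : ∀ f : ℂ ≃ₜ ℂ, f 0 = 0 → (∀ w : ℂ, ‖w‖ = 1 → ‖f.symm w‖ = 1) → ∀ z : ℂ, ‖z‖ < 1 → ‖f z‖ < 1 := by
    intro f f0 fs z hz
    by_contra hc
    push Not at hc
    have hcn : ContinuousOn (fun z => ‖f z‖) (ball 0 1) := f.continuous.norm.continuousOn
    obtain ⟨u, hu, e⟩ := (convex_ball (0:ℂ) 1).isPreconnected.intermediate_value (mem_ball_self one_pos) (by simpa using hz : z ∈ ball (0:ℂ) 1) hcn
      (show (1:ℝ) ∈ Icc _ _ from ⟨by simp [f0], hc⟩)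
    have := fs _ e
    rw [f.symm_apply_apply] at this
    rw [mem_ball_zero_iff] at hu
    linarith
  refine ⟨F, ⟨ballp F F0 Fs', Fs, fun z h1 h2 => ⟨?_, b2 Fout z h2⟩, fun z hz => by rw [Fout z hz.ge, hz], fun z hz => by rw [Fout z hz.le]; exact hz⟩, fun t ht => ?_⟩
  · by_contra hc
    push Not at hc
    rcases eq_or_lt_of_le hc with h3 | h3
    · have := Fs' _ h3; rw [F.symm_apply_apply] at this; linarith
    · have := ballp F.symm (by rw [F.symm_apply_eq, F0]) (by simpa using Fs) _ h3
      rw [F.symm_apply_apply] at this; linarith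
  · have := ha (1 + t) ⟨by linarith [ht.1], by linarith [ht.2]⟩
    rw [hat_hi (by linarith [ht.1]), add_sub_cancel_left] at this
    rw [fixr _ (by rw [this]; exact Complex.ofReal_im _), this]

lemma Hstep {a b : ℝ → ℂ} (A : Arc a) (B : Arc b) (D : Dj a b) :
    ∃ F : ℂ ≃ₜ ℂ, Pres F ∧ ∀ t ∈ Icc (0:ℝ) 1, F (a t) = ((1 + t : ℝ) : ℂ) := by
  obtain ⟨g, gn, g1, g2⟩ := mob2 A.n1 B.n1 (D 1 o01 1 o01)
  have G := Pres.of_norm g gn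
  obtain ⟨F, hF, e⟩ := H0 (G.arc A) (G.arc B) (fun t ht u hu e => D t ht u hu (g.injective e)) g1 g2
  exact ⟨g.trans F, G.trans hF, e⟩

lemma lift_arc {a : ℝ → ℂ} (A : Arc a) (hd : ∀ t ∈ Icc (0:ℝ) 1, -a t ∈ Complex.slitPlane) :
    RArc 0 (2 * Real.pi) (fun t => L (a t)) := by
  have ne : ∀ t ∈ Icc (0:ℝ) 1, a t ≠ 0 := fun t ht h => by have := (A.norm_mem ht).1; rw [h, norm_zero] at this; linarith
  have cn : ∀ z : ℂ, -z ∈ Complex.slitPlane → ContinuousAt L z := fun z hz => by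
    unfold L
    exact (ContinuousAt.comp (f := fun z : ℂ => -z) (g := ell) (ell_cont hz) continuous_neg.continuousAt).add continuousAt_const
  refine ⟨fun t ht => (cn _ (hd t ht)).comp_continuousWithinAt (A.c t ht), fun t ht u hu e => A.i ht hu ?_, ?_, ?_, fun t ht => ?_, fun t ht => ⟨(L_im _).1, lt_of_le_of_ne (L_im _).2 fun e => ?_⟩⟩
  · have e' : L (a t) = L (a u) := e
    rw [← E_L (ne t ht), e', E_L (ne u hu)]
  · exact E_norm_one.1 (by rw [E_L (ne _ z01)]; exact A.n0)
  · exact E_norm_two.1 (by rw [E_L (ne _ o01)]; exact A.n1)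
  · have := A.m t ht
    rw [← E_L (ne t (Ioo_subset_Icc_self ht)), E_one_lt, E_lt_two] at this
    exact this
  · have h1 : (L (a t)).im = (Complex.log (-a t)).im + Real.pi := by simp [L, ell]
    refine (Complex.mem_slitPlane_iff_arg.1 (hd t ht)).1 ?_
    rw [← Complex.log_im]; linarith

lemma E_per (w : ℂ) (k : ℤ) : E (w + k * (2 * Real.pi * Complex.I)) = E w := by
  have : (⟨Real.log 2 * (w + k * (2 * Real.pi * Complex.I)).re, (w + k * (2 * Real.pi * Complex.I)).im⟩ : ℂ) =
      (⟨Real.log 2 * w.re, w.im⟩ : ℂ) + k * (2 * Real.pi * Complex.I) := by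
    apply Complex.ext <;> simp
  rw [E, this, Complex.exp_add, Complex.exp_int_mul_two_pi_mul_I, mul_one, E]

lemma E_rot (t y c : ℝ) : Complex.exp (c * Complex.I) * E ⟨t, y⟩ = E ⟨t, c + y⟩ := by
  rw [E, E, ← Complex.exp_add]
  congr 1
  apply Complex.ext <;> simp

lemma E_re (t : ℝ) : E ⟨t, 0⟩ = (Real.exp (Real.log 2 * t) : ℝ) := by
  rw [E, Complex.ofReal_exp]; rfl

def XN (N : ℕ) : Set ℂ := {z | ∃ t ∈ Icc (0:ℝ) 1, z = E ⟨t, 0⟩ ∨ z = E ⟨t, Real.pi / N * |2 * t - 1|⟩}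
def LN (N : ℕ) : Set ℂ := {z | ∃ j : ℤ, ¬ (N:ℤ) ∣ j ∧ ∃ t ∈ Icc (0:ℝ) 1, z = E ⟨t, 2 * Real.pi * j / N⟩}

lemma real_seg {t : ℝ} (ht : t ∈ Icc (0:ℝ) 1) : ∃ s ∈ Icc (0:ℝ) 1, (((1 + t : ℝ)) : ℂ) = E ⟨s, 0⟩ := by
  have h0 : (0:ℝ) < 1 + t := by linarith [ht.1]
  refine ⟨Real.log (1 + t) / Real.log 2, ⟨div_nonneg (Real.log_nonneg (by linarith [ht.1])) l2p.le, (div_le_one l2p).2 (Real.log_le_log h0 (by linarith [ht.2]))⟩, ?_⟩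
  rw [E_re, mul_div_cancel₀ _ l2p.ne', Real.exp_log h0]

lemma seg_real {s : ℝ} (hs : s ∈ Icc (0:ℝ) 1) : ∃ t ∈ Icc (0:ℝ) 1, E ⟨s, 0⟩ = (((1 + t : ℝ)) : ℂ) := by
  have h := l2p
  refine ⟨Real.exp (Real.log 2 * s) - 1, ⟨?_, ?_⟩, by rw [E_re]; congr 1; ring⟩
  · have := Real.one_le_exp (mul_nonneg h.le hs.1); linarith
  · have : Real.exp (Real.log 2 * s) ≤ Real.exp (Real.log 2) := Real.exp_le_exp.2 (by nlinarith [hs.2])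
    rw [Real.exp_log (by norm_num)] at this; linarith

lemma ThmN {κ : Type*} (S : Finset κ) (f : κ → ℝ → ℂ) {d x y : ℝ → ℂ} (hf : ∀ i ∈ S, Arc (f i)) (hd : Arc d)
    (hx : Arc x) (hy : Arc y) (D : ∀ i ∈ S, ∀ j ∈ S, i ≠ j → Dj (f i) (f j)) (Dd : ∀ i ∈ S, Dj d (f i))
    (Dx : ∀ i ∈ S, Dj (f i) x) (Dy : ∀ i ∈ S, Dj (f i) y) (dx : Dj d x) (dy : Dj d y) {t0 t1 : ℝ}
    (h0 : t0 ∈ Ioo (0:ℝ) 1) (h1 : t1 ∈ Ioo (0:ℝ) 1) (hxy : x t0 = y t1)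
    (hxy' : ∀ t ∈ Icc (0:ℝ) 1, ∀ u ∈ Icc (0:ℝ) 1, x t = y u → t = t0 ∧ u = t1) :
    ∃ Φ : ℂ ≃ₜ ℂ, Pres Φ ∧ Φ '' (x '' Icc 0 1 ∪ y '' Icc 0 1) = XN (S.card + 2) ∧
      Φ '' (d '' Icc 0 1 ∪ ⋃ i ∈ S, f i '' Icc 0 1) = LN (S.card + 2) := by
  obtain ⟨F, PF, Fd⟩ := Hstep hd hx dx
  have hp := Real.pi_pos
  have lifts : ∀ a : ℝ → ℂ, Arc a → Dj d a → RArc 0 (2 * Real.pi) (fun t => L (F (a t))) := by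
    intro a A da
    have A' := PF.arc A
    refine lift_arc A' fun t ht => ?_
    by_contra hc
    rw [Complex.mem_slitPlane_iff] at hc
    push Not at hc
    simp only [Complex.neg_re, Complex.neg_im] at hc
    have e : F (a t) = ((F (a t)).re : ℂ) := Complex.ext rfl (by simpa using hc.2)
    have n := A'.norm_mem ht
    rw [e, Complex.norm_real, Real.norm_of_nonneg (by linarith [hc.1])] at n
    have hm : (F (a t)).re - 1 ∈ Icc (0:ℝ) 1 := ⟨by linarith [n.1], by linarith [n.2]⟩
    have := Fd _ hm
    rw [show 1 + ((F (a t)).re - 1) = (F (a t)).re by ring, ← e] at this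
    exact da _ hm t ht (F.injective this)
  have ne : ∀ a : ℝ → ℂ, Arc a → ∀ t ∈ Icc (0:ℝ) 1, E (L (F (a t))) = F (a t) := fun a A t ht => E_L fun h => by
    have := ((PF.arc A).norm_mem ht).1; simp only [h, norm_zero] at this; linarith
  have inj : ∀ a b : ℝ → ℂ, Arc a → Arc b → ∀ t ∈ Icc (0:ℝ) 1, ∀ u ∈ Icc (0:ℝ) 1, L (F (a t)) = L (F (b u)) → a t = b u := by
    intro a b A B t ht u hu e
    apply F.injective
    rw [← ne a A t ht, e, ne b B u hu]
  obtain ⟨h, H, g, g', σ, j0, ⟨hj, hσ, hs, hl, hg, hg'⟩, gU⟩ := X1 (s2 := 2 * Real.pi) (by positivity) S (fun i t => L (F (f i t)))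
    (fun i hi => lifts _ (hf i hi) (Dd i hi))
    (fun i hi j hj hij t ht u hu e => D i hi j hj hij t ht u hu (inj _ _ (hf i hi) (hf j hj) t ht u hu e))
    (lifts x hx dx) (lifts y hy dy) h0 h1 (by simp only [hxy])
    (fun t ht u hu e => hxy' t ht u hu (inj _ _ hx hy t ht u hu e))
    (fun i hi t ht u hu e => Dx i hi t ht u hu (inj _ _ (hf i hi) hx t ht u hu e))
    (fun i hi t ht u hu e => Dy i hi t ht u hu (inj _ _ (hf i hi) hy t ht u hu e))
  obtain ⟨G, PG, hG⟩ := transfer H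
  set N := S.card + 2 with hN
  have hN0 : (0:ℝ) < N := by positivity
  have hNc : ((S.card : ℝ) + 2) = N := by rw [hN]; push_cast; ring
  rw [hNc] at hg hg'
  simp only [hNc] at hl
  set c : ℝ := -(2 * Real.pi * j0 / N) with hc
  have hu : ‖Complex.exp (c * Complex.I)‖ = 1 := by simp
  refine ⟨(F.trans G).trans (rotH _ hu), (PF.trans PG).trans (Pres.of_norm _ fun z => by rw [rotH_apply, norm_mul, hu, one_mul]), ?_, ?_⟩
  · have key : ∀ z, z ∈ x '' Icc 0 1 ∪ y '' Icc 0 1 → ∃ w ∈ g '' Icc 0 1 ∪ g' '' Icc 0 1, G (F z) = E (h w) := by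
      rintro z (⟨t, ht, rfl⟩ | ⟨t, ht, rfl⟩)
      · refine ⟨L (F (x t)), by rw [gU]; exact Or.inl ⟨t, ht, rfl⟩, ?_⟩
        rw [← hG _ (L_im _).1.le (L_im _).2, ne x hx t ht]
      · refine ⟨L (F (y t)), by rw [gU]; exact Or.inr ⟨t, ht, rfl⟩, ?_⟩
        rw [← hG _ (L_im _).1.le (L_im _).2, ne y hy t ht]
    have key' : ∀ w ∈ g '' Icc 0 1 ∪ g' '' Icc 0 1, ∃ z ∈ x '' Icc 0 1 ∪ y '' Icc 0 1, G (F z) = E (h w) := by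
      rw [gU]
      rintro w (⟨t, ht, rfl⟩ | ⟨t, ht, rfl⟩)
      · refine ⟨x t, Or.inl ⟨t, ht, rfl⟩, ?_⟩
        rw [← hG _ (L_im _).1.le (L_im _).2, ne x hx t ht]
      · refine ⟨y t, Or.inr ⟨t, ht, rfl⟩, ?_⟩
        rw [← hG _ (L_im _).1.le (L_im _).2, ne y hy t ht]
    have e1 : ∀ t, Complex.exp (c * Complex.I) * E ⟨t, 2 * Real.pi * j0 / N⟩ = E ⟨t, 0⟩ := fun t => by
      rw [E_rot, hc, neg_add_cancel]
    have e2 : ∀ t, Complex.exp (c * Complex.I) * E ⟨t, 2 * Real.pi * j0 / N + 2 * Real.pi / N / 2 * |2 * t - 1|⟩ = E ⟨t, Real.pi / N * |2 * t - 1|⟩ := fun t => by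
      rw [E_rot, hc]; congr 2; ring
    ext q
    constructor
    · rintro ⟨z, hz, rfl⟩
      obtain ⟨w, hw, e⟩ := key z hz
      simp only [Homeomorph.trans_apply, rotH_apply, e]
      rcases hw with ⟨t, ht, rfl⟩ | ⟨t, ht, rfl⟩
      · exact ⟨t, ht, Or.inl (by rw [hg t ht, e1])⟩
      · exact ⟨t, ht, Or.inr (by rw [hg' t ht, e2])⟩
    · rintro ⟨t, ht, rfl | rfl⟩
      · obtain ⟨z, hz, e⟩ := key' (g t) (Or.inl ⟨t, ht, rfl⟩)
        exact ⟨z, hz, by simp only [Homeomorph.trans_apply, rotH_apply, e]; rw [hg t ht, e1]⟩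
      · obtain ⟨z, hz, e⟩ := key' (g' t) (Or.inr ⟨t, ht, rfl⟩)
        exact ⟨z, hz, by simp only [Homeomorph.trans_apply, rotH_apply, e]; rw [hg' t ht, e2]⟩
  · have e1 : ∀ (t : ℝ) (m : ℕ), Complex.exp (c * Complex.I) * E ⟨t, 2 * Real.pi * m / N⟩ = E ⟨t, 2 * Real.pi * ((m - j0 : ℤ) : ℝ) / N⟩ := fun t m => by
      rw [E_rot, hc]; congr 2; push_cast; ring
    have nd : ∀ m : ℕ, m < N → m ≠ j0 → ¬ (N:ℤ) ∣ (m - j0 : ℤ) := by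
      intro m hm hmj hdv
      have := Int.eq_zero_of_abs_lt_dvd hdv (by rw [abs_lt]; omega)
      omega
    have fi : ∀ i ∈ S, ∀ t ∈ Icc (0:ℝ) 1, ((F.trans G).trans (rotH _ hu)) (f i t) = E ⟨t, 2 * Real.pi * ((σ i - j0 : ℤ) : ℝ) / N⟩ := by
      intro i hi t ht
      simp only [Homeomorph.trans_apply, rotH_apply]
      rw [← ne _ (hf i hi) t ht, hG _ (L_im _).1.le (L_im _).2, hl i hi t ht, e1]
    have fd : ∀ s : ℝ, rotH _ hu (G (E ⟨s, 0⟩)) = E ⟨s, 2 * Real.pi * (((0:ℕ) - j0 : ℤ) : ℝ) / N⟩ := by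
      intro s
      rw [hG _ le_rfl (by simp only; positivity), rotH_apply, ← e1]
      congr 2
      rw [H.lo _ le_rfl]
      simp
    ext q
    constructor
    · rintro ⟨z, ⟨t, ht, rfl⟩ | hz, rfl⟩
      · obtain ⟨s, hs', e⟩ := real_seg ht
        refine ⟨_, nd 0 (by omega) (by omega), s, hs', ?_⟩
        simp only [Homeomorph.trans_apply, Fd t ht, e]
        exact fd s
      · rw [mem_iUnion₂] at hz
        obtain ⟨i, hi, t, ht, rfl⟩ := hz
        exact ⟨_, nd (σ i) (by have := hσ i hi; omega) (hσ i hi).2.2, t, ht, fi i hi t ht⟩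
    · rintro ⟨j, hj', t, ht, rfl⟩
      have hNz : (0:ℤ) < N := by omega
      obtain ⟨m, hm⟩ := Int.eq_ofNat_of_zero_le (Int.emod_nonneg (j + j0) hNz.ne')
      have hlt := Int.emod_lt_of_pos (j + j0) hNz
      have hdm := Int.emod_add_mul_ediv (j + j0) N
      set k := (j + j0) / (N:ℤ) with hk
      have hmj : m ≠ j0 := by
        rintro rfl
        exact hj' ⟨k, by linarith⟩
      have ej : E ⟨t, 2 * Real.pi * j / N⟩ = E ⟨t, 2 * Real.pi * ((m - j0 : ℤ) : ℝ) / N⟩ := by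
        rw [← E_per ⟨t, 2 * Real.pi * ((m - j0 : ℤ) : ℝ) / N⟩ k]
        have : (j:ℝ) = (m - j0 : ℤ) + N * k := by
          rw [← Int.cast_natCast N, ← Int.cast_mul, ← Int.cast_add]; congr 1; linarith
        congr 1
        apply Complex.ext
        · simp
        · simp only [this]; simp; field_simp
      rw [ej]
      rcases Nat.eq_zero_or_pos m with rfl | hm0
      · obtain ⟨s, hs', e⟩ := seg_real ht
        refine ⟨d s, Or.inl ⟨s, hs', rfl⟩, ?_⟩
        simp only [Homeomorph.trans_apply, Fd s hs', ← e]
        exact fd t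
      · obtain ⟨i, hi, rfl⟩ := hs m hm0 (by omega) hmj
        exact ⟨f i t, Or.inr (mem_iUnion₂.2 ⟨i, hi, t, ht, rfl⟩), fi i hi t ht⟩

def Rch (U : Set ℂ) (p q : ℂ) : Prop :=
  ∃ b : ℝ, 0 ≤ b ∧ ∃ g : ℝ → ℂ, ContinuousOn g (Icc 0 b) ∧ InjOn g (Icc 0 b) ∧ g 0 = p ∧ g b = q ∧ MapsTo g (Icc 0 b) U

lemma Rch.step {U : Set ℂ} {p q q' : ℂ} {r : ℝ} (h : Rch U p q) (hr : closedBall q r ⊆ U) (hq : q' ∈ closedBall q r) :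
    Rch U p q' := by
  obtain ⟨b, hb, g, gc, gi, g0, gb, gU⟩ := h
  have hr0 : 0 ≤ r := dist_nonneg.trans hq
  have hT : IsCompact (Icc 0 b ∩ g ⁻¹' closedBall q r) :=
    isCompact_Icc.of_isClosed_subset (gc.preimage_isClosed_of_isClosed isClosed_Icc isClosed_closedBall) inter_subset_left
  obtain ⟨s, ⟨hs, hsb⟩, hl⟩ := hT.exists_isLeast ⟨b, ⟨hb, le_rfl⟩, by rw [mem_preimage, gb]; exact mem_closedBall_self hr0⟩
  have hsub : Icc 0 s ⊆ Icc 0 b := Icc_subset_Icc_right hs.2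
  by_cases hqs : q' = g s
  · exact ⟨s, hs.1, g, gc.mono hsub, gi.mono hsub, g0, hqs.symm, gU.mono_left hsub⟩
  set k : ℝ → ℂ := fun t => g (min t s) + (max (t - s) 0) • (q' - g s) with hk
  have k1 : ∀ t, t ≤ s → k t = g t := fun t ht => by
    simp only [hk]; rw [min_eq_left ht, max_eq_right (by linarith), zero_smul, add_zero]
  have k2 : ∀ t, s ≤ t → k t = g s + (t - s) • (q' - g s) := fun t ht => by
    simp only [hk]; rw [min_eq_right ht, max_eq_left (by linarith)]
  have k3 : ∀ t, s ≤ t → t ≤ s + 1 → k t ∈ closedBall q r := fun t h1 h2 => by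
    rw [k2 t h1]
    exact (convex_closedBall q r).add_smul_sub_mem hsb hq ⟨by linarith, by linarith⟩
  have k4 : ∀ t, 0 ≤ t → t < s → k t ∉ closedBall q r := fun t h1 h2 hc => by
    rw [k1 t h2.le] at hc
    exact absurd (hl ⟨⟨h1, h2.le.trans hs.2⟩, hc⟩) (not_le.2 h2)
  refine ⟨s + 1, by linarith [hs.1], k, ?_, ?_, by rw [k1 0 hs.1, g0], by rw [k2 _ (by linarith)]; simp, ?_⟩
  · refine ContinuousOn.add (gc.comp (by fun_prop) fun t ht => ⟨le_min ht.1 hs.1, (min_le_right _ _).trans hs.2⟩) (by fun_prop)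
  · intro t ht u hu e
    rcases lt_or_ge t s with h1 | h1 <;> rcases lt_or_ge u s with h2 | h2
    · rw [k1 t h1.le, k1 u h2.le] at e
      exact gi ⟨ht.1, h1.le.trans hs.2⟩ ⟨hu.1, h2.le.trans hs.2⟩ e
    · exact absurd (e ▸ k3 u h2 hu.2) (k4 t ht.1 h1)
    · exact absurd (e ▸ k3 t h1 ht.2) (k4 u hu.1 h2)
    · rw [k2 t h1, k2 u h2] at e
      have := smul_left_injective ℝ (sub_ne_zero.2 hqs) (add_left_cancel e)
      linarith
  · intro t ht
    rcases le_total t s with h1 | h1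
    · rw [k1 t h1]; exact gU ⟨ht.1, h1.trans hs.2⟩
    · exact hr (k3 t h1 ht.2)

lemma rch_all {U : Set ℂ} (hU : IsOpen U) (hc : IsPreconnected U) {p q : ℂ} (hp : p ∈ U) (hq : q ∈ U) : Rch U p q := by
  have key : ∀ z ∈ U, ∃ r > 0, closedBall z (2 * r) ⊆ U := fun z hz => by
    obtain ⟨e, he, h⟩ := nhds_basis_closedBall.mem_iff.1 (hU.mem_nhds hz)
    exact ⟨e / 2, by positivity, by rwa [mul_div_cancel₀ _ two_ne_zero]⟩
  have hm : ∀ z, Rch U p z → z ∈ U := by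
    rintro z ⟨b, hb, g, -, -, -, rfl, h⟩; exact h ⟨hb, le_rfl⟩
  refine hc.subset_of_closure_inter_subset (u := {z | Rch U p z}) ?_ ⟨p, hp, ?_⟩ ?_ hq
  · rw [Metric.isOpen_iff]
    intro z hz
    obtain ⟨r, hr, h⟩ := key z (hm z hz)
    exact ⟨r, hr, fun w hw => Rch.step (show Rch U p z from hz) h (by have := mem_ball.1 hw; exact mem_closedBall.2 (by linarith))⟩
  · exact ⟨0, le_rfl, fun _ => p, continuousOn_const, fun t ht u hu _ => by rw [Icc_self] at ht hu; rw [ht, hu], rfl, rfl, fun _ _ => hp⟩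
  · rintro z ⟨hz, hzU⟩
    obtain ⟨r, hr, h⟩ := key z hzU
    obtain ⟨w, hw, hd⟩ := Metric.mem_closure_iff.1 hz r hr
    refine Rch.step (r := r) hw ((closedBall_subset_closedBall' ?_).trans h) (mem_closedBall.2 hd.le)
    rw [dist_comm w z]; linarith

lemma extra_arc {x y : ℝ → ℂ} (hx : Arc x) (hy : Arc y) {t0 t1 : ℝ}
    (h0 : t0 ∈ Icc (0:ℝ) 1) (h1 : t1 ∈ Icc (0:ℝ) 1) (hxy : x t0 = y t1)
    (hxy' : ∀ t ∈ Icc (0:ℝ) 1, ∀ u ∈ Icc (0:ℝ) 1, x t = y u → t = t0 ∧ u = t1) :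
    ∃ d, Arc d ∧ Dj d x ∧ Dj d y := by
  have cx := arc_compact hx.c
  have cy := arc_compact hy.c
  have hI : x '' Icc 0 1 ∩ y '' Icc 0 1 = {x t0} := by
    ext z; constructor
    · rintro ⟨⟨t, ht, rfl⟩, u, hu, e⟩
      rw [(hxy' t ht u hu e.symm).1]; rfl
    · rintro rfl; exact ⟨⟨t0, h0, rfl⟩, t1, h1, hxy.symm⟩
  have con : IsPreconnected (x '' Icc 0 1 ∪ y '' Icc 0 1)ᶜ := by
    refine compl_conn_of_lg (cx.union cy) fun a ha b hb => ?_
    have hc := ratio_cont (a := a) hb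
    have hn := ratio_ne ha hb
    exact HasLg.glue cx.isClosed cy.isClosed (by rw [hI]; exact isPreconnected_singleton)
      (lg_arc zero_le_one hx.c hx.i (hc.mono subset_union_left) fun z hz => hn z (Or.inl hz))
      (lg_arc zero_le_one hy.c hy.i (hc.mono subset_union_right) fun z hz => hn z (Or.inr hz))
  have out : ∀ z : ℂ, (‖z‖ < 1 ∨ 2 < ‖z‖) → z ∈ (x '' Icc 0 1 ∪ y '' Icc 0 1)ᶜ := by
    rintro z hz (⟨t, ht, rfl⟩ | ⟨t, ht, rfl⟩)
    · have := hx.norm_mem ht; rcases hz with h | h <;> linarith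
    · have := hy.norm_mem ht; rcases hz with h | h <;> linarith
  obtain ⟨b, hb, g, gc, gi, g0, gb, gU⟩ := rch_all (cx.union cy).isClosed.isOpen_compl con (out 0 (by simp)) (out 10 (by norm_num))
  have nc : ContinuousOn (fun t => ‖g t‖) (Icc 0 b) := gc.norm
  have ivt : ∀ s t, 0 ≤ s → s ≤ t → t ≤ b → ∀ c, ‖g s‖ ≤ c → c ≤ ‖g t‖ → ∃ u ∈ Icc s t, ‖g u‖ = c := by
    intro s t hs hst ht c h1 h2
    exact intermediate_value_Icc hst (nc.mono (Icc_subset_Icc hs ht)) ⟨h1, h2⟩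
  have n0 : ‖g 0‖ = 0 := by rw [g0, norm_zero]
  have nb : ‖g b‖ = 10 := by rw [gb]; norm_num
  have clo : ∀ c v, v ≤ b → IsCompact (Icc 0 v ∩ (fun t => ‖g t‖) ⁻¹' {c}) := fun c v hv =>
    isCompact_Icc.of_isClosed_subset ((nc.mono (Icc_subset_Icc_right hv)).preimage_isClosed_of_isClosed isClosed_Icc isClosed_singleton) inter_subset_left
  obtain ⟨w, hw, hw'⟩ := ivt 0 b le_rfl hb le_rfl 2 (by rw [n0]; norm_num) (by rw [nb]; norm_num)
  obtain ⟨v, ⟨hv, hv2⟩, vl⟩ := (clo 2 b le_rfl).exists_isLeast ⟨w, hw, hw'⟩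
  replace hv2 : ‖g v‖ = 2 := hv2
  obtain ⟨w, hw, hw'⟩ := ivt 0 v le_rfl hv.1 hv.2 1 (by rw [n0]; norm_num) (by rw [hv2]; norm_num)
  obtain ⟨u, ⟨hu, hu2⟩, ul⟩ := (clo 1 v hv.2).exists_isGreatest ⟨w, hw, hw'⟩
  replace hu2 : ‖g u‖ = 1 := hu2
  have huv : u < v := lt_of_le_of_ne hu.2 fun h => by rw [h] at hu2; linarith
  have lo : ∀ t, 0 ≤ t → t < v → ‖g t‖ < 2 := by
    intro t h1 h2
    by_contra hc
    push Not at hc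
    obtain ⟨w, hw, hw'⟩ := ivt 0 t le_rfl h1 (h2.le.trans hv.2) 2 (by rw [n0]; norm_num) hc
    have := vl ⟨⟨hw.1, by linarith [hw.2, hv.2]⟩, hw'⟩
    linarith [hw.2]
  have hi : ∀ t, u < t → t ≤ v → 1 < ‖g t‖ := by
    intro t h1 h2
    by_contra hc
    push Not at hc
    obtain ⟨w, hw, hw'⟩ := ivt t v (by linarith [hu.1]) h2 hv.2 1 hc (by rw [hv2]; norm_num)
    have := ul ⟨⟨by linarith [hw.1, hu.1], hw.2⟩, hw'⟩
    linarith [hw.1]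
  have pm : MapsTo (fun t : ℝ => u + t * (v - u)) (Icc 0 1) (Icc 0 b) := fun t ht =>
    ⟨by nlinarith [hu.1, ht.1], by nlinarith [hv.2, ht.2]⟩
  have dU : ∀ t ∈ Icc (0:ℝ) 1, g (u + t * (v - u)) ∈ (x '' Icc 0 1 ∪ y '' Icc 0 1)ᶜ := fun t ht => gU (pm ht)
  refine ⟨fun t => g (u + t * (v - u)), ⟨gc.comp (by fun_prop) pm, fun s hs t ht e => ?_, by simpa using hu2, by simpa using hv2, fun t ht => ⟨hi _ ?_ ?_, lo _ ?_ ?_⟩⟩,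
    fun t ht s hs e => dU t ht (Or.inl ⟨s, hs, e.symm⟩), fun t ht s hs e => dU t ht (Or.inr ⟨s, hs, e.symm⟩)⟩
  · have := gi (pm hs) (pm ht) e
    simp only at this
    exact mul_right_cancel₀ (sub_ne_zero.2 huv.ne') (add_left_cancel this)
  · nlinarith [ht.1]
  · nlinarith [ht.2]
  · nlinarith [ht.1, hu.1]
  · nlinarith [ht.2]

noncomputable def mx (t : ℝ) : ℂ := ⟨(1 - t) + 2 * t * Real.cos 1, 2 * t * Real.sin 1⟩
noncomputable def my (t : ℝ) : ℂ := ⟨(1 - t) * Real.cos 1 + 2 * t, (1 - t) * Real.sin 1⟩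
noncomputable def ry (θ t : ℝ) : ℂ := ⟨(1 + t) * Real.cos θ, (1 + t) * Real.sin θ⟩

lemma s1 : 0 < Real.sin 1 := Real.sin_pos_of_pos_of_lt_pi one_pos (by linarith [Real.pi_gt_three])
lemma c1 : 1/2 < Real.cos 1 := by
  rw [← Real.cos_pi_div_three]
  exact Real.cos_lt_cos_of_nonneg_of_le_pi_div_two zero_le_one (by linarith [Real.pi_gt_three]) (by linarith [Real.pi_gt_three])
lemma c1' : Real.cos 1 ≤ 1 := Real.cos_le_one 1
lemma sc1 : Real.sin 1 ^ 2 = 1 - Real.cos 1 ^ 2 := Real.sin_sq 1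

lemma nsq (z : ℂ) : ‖z‖ ^ 2 = z.re ^ 2 + z.im ^ 2 := by rw [Complex.sq_norm, Complex.normSq_apply]; ring

lemma arc_of_sq {a : ℝ → ℂ} (c : ContinuousOn a (Icc 0 1)) (i : InjOn a (Icc 0 1))
    (n0 : (a 0).re ^ 2 + (a 0).im ^ 2 = 1) (n1 : (a 1).re ^ 2 + (a 1).im ^ 2 = 4)
    (m : ∀ t ∈ Ioo (0:ℝ) 1, 1 < (a t).re ^ 2 + (a t).im ^ 2 ∧ (a t).re ^ 2 + (a t).im ^ 2 < 4) : Arc a := by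
  simp only [← nsq] at n0 n1 m
  refine ⟨c, i, ?_, ?_, fun t ht => ⟨?_, ?_⟩⟩
  · nlinarith [norm_nonneg (a 0)]
  · nlinarith [norm_nonneg (a 1)]
  · nlinarith [norm_nonneg (a t), m t ht]
  · nlinarith [norm_nonneg (a t), m t ht]

lemma sq_q {t : ℝ} (ht : t ∈ Ioo (0:ℝ) 1) : 1 < 1 + (4 * Real.cos 1 - 2) * t + (5 - 4 * Real.cos 1) * t ^ 2 ∧
    1 + (4 * Real.cos 1 - 2) * t + (5 - 4 * Real.cos 1) * t ^ 2 < 4 := by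
  have h1 := c1
  have h2 := c1'
  obtain ⟨ht0, ht1⟩ := ht
  constructor
  · have : 0 < (4 * Real.cos 1 - 2) * t := mul_pos (by linarith) ht0
    have : 0 < (5 - 4 * Real.cos 1) * t ^ 2 := mul_pos (by linarith) (by positivity)
    linarith
  · have : 0 < (1 - t) * (3 + (5 - 4 * Real.cos 1) * t) :=
      mul_pos (by linarith) (by have := mul_pos (show 0 < 5 - 4 * Real.cos 1 by linarith) ht0; linarith)
    nlinarith

lemma mx_arc : Arc mx := by
  have e : ∀ t, (mx t).re ^ 2 + (mx t).im ^ 2 = 1 + (4 * Real.cos 1 - 2) * t + (5 - 4 * Real.cos 1) * t ^ 2 := fun t => by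
    simp only [mx, mul_pow]; rw [sc1]; ring
  refine arc_of_sq (pt_cont (by fun_prop) (by fun_prop)) (fun t _ u _ h => ?_) ?_ ?_ fun t ht => ?_
  · have := congrArg Complex.im h
    simp only [mx] at this
    have := mul_right_cancel₀ s1.ne' this
    linarith
  · rw [e]; ring
  · rw [e]; ring
  · rw [e]; exact sq_q ht

lemma my_arc : Arc my := by
  have e : ∀ t, (my t).re ^ 2 + (my t).im ^ 2 = 1 + (4 * Real.cos 1 - 2) * t + (5 - 4 * Real.cos 1) * t ^ 2 := fun t => by
    simp only [my, mul_pow]; rw [sc1]; ring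
  refine arc_of_sq (pt_cont (by fun_prop) (by fun_prop)) (fun t _ u _ h => ?_) ?_ ?_ fun t ht => ?_
  · have := congrArg Complex.im h
    simp only [my] at this
    have := mul_right_cancel₀ s1.ne' this
    linarith
  · rw [e]; ring
  · rw [e]; ring
  · rw [e]; exact sq_q ht

lemma ry_sq (θ t : ℝ) : (ry θ t).re ^ 2 + (ry θ t).im ^ 2 = (1 + t) ^ 2 := by
  simp only [ry, mul_pow]; rw [← mul_add, Real.cos_sq_add_sin_sq, mul_one]

lemma ry_t {θ θ' t u : ℝ} (ht : t ∈ Icc (0:ℝ) 1) (hu : u ∈ Icc (0:ℝ) 1) (h : ry θ t = ry θ' u) : t = u := by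
  have := ry_sq θ t
  rw [h, ry_sq] at this
  nlinarith [ht.1, hu.1]

lemma ry_arc (θ : ℝ) : Arc (ry θ) := by
  refine arc_of_sq (pt_cont (by fun_prop) (by fun_prop)) (fun t ht u hu h => ry_t ht hu h) ?_ ?_ fun t ht => ?_
  · rw [ry_sq]; norm_num
  · rw [ry_sq]; norm_num
  · rw [ry_sq]; constructor <;> nlinarith [ht.1, ht.2]

lemma ry_dj {θ θ' : ℝ} (h : θ ∈ Ioo (2:ℝ) 6) (h' : θ' ∈ Ioo (2:ℝ) 6) (hn : θ ≠ θ') : Dj (ry θ) (ry θ') := by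
  intro t ht u hu e
  obtain rfl := ry_t ht hu e
  have hp := Real.pi_gt_three
  have h1 : (1 + t) ≠ 0 := by linarith [ht.1]
  refine hn (expI_inj (u := 2) ⟨h.1.le, by linarith [h.2]⟩ ⟨h'.1.le, by linarith [h'.2]⟩ ?_)
  have a := congrArg Complex.re e
  have b := congrArg Complex.im e
  simp only [ry] at a b
  apply Complex.ext
  · rw [Complex.exp_ofReal_mul_I_re, Complex.exp_ofReal_mul_I_re]; exact mul_left_cancel₀ h1 a
  · rw [Complex.exp_ofReal_mul_I_im, Complex.exp_ofReal_mul_I_im]; exact mul_left_cancel₀ h1 b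

lemma ry_cone {θ : ℝ} (h : θ ∈ Ioo (2:ℝ) 6) {t : ℝ} (ht : t ∈ Icc (0:ℝ) 1) (h1 : 0 ≤ (ry θ t).im)
    (h2 : 0 ≤ Real.sin 1 * (ry θ t).re - Real.cos 1 * (ry θ t).im) : False := by
  have hp := Real.pi_gt_three
  simp only [ry] at h1 h2
  have h0 : 0 < 1 + t := by linarith [ht.1]
  have h3 : 0 ≤ Real.sin θ := nonneg_of_mul_nonneg_right h1 h0
  have h4 : Real.sin (θ - 1) ≤ 0 := by
    rw [Real.sin_sub]
    have : 0 ≤ (1 + t) * (Real.sin 1 * Real.cos θ - Real.cos 1 * Real.sin θ) := by linarith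
    have := nonneg_of_mul_nonneg_right this h0
    linarith
  have h5 : Real.pi ≤ θ - 1 := by
    by_contra hc
    push Not at hc
    linarith [Real.sin_pos_of_pos_of_lt_pi (by linarith [h.1]) hc]
  have h6 : 0 < Real.sin (θ - Real.pi) := Real.sin_pos_of_pos_of_lt_pi (by linarith) (by linarith [h.2])
  rw [Real.sin_sub_pi] at h6
  linarith

lemma ry_mx {θ : ℝ} (h : θ ∈ Ioo (2:ℝ) 6) : Dj (ry θ) mx := fun t ht u hu e => by
  have := s1
  refine ry_cone h ht ?_ ?_ <;> rw [e] <;> simp only [mx]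
  · have := hu.1; positivity
  · have := mul_nonneg (show 0 ≤ 1 - u by linarith [hu.2]) s1.le
    nlinarith

lemma ry_my {θ : ℝ} (h : θ ∈ Ioo (2:ℝ) 6) : Dj (ry θ) my := fun t ht u hu e => by
  have := mul_nonneg (show 0 ≤ 1 - u by linarith [hu.2]) s1.le
  have := mul_nonneg hu.1 s1.le
  refine ry_cone h ht ?_ ?_ <;> rw [e] <;> simp only [my] <;> nlinarith

lemma mx_my : mx (1/3) = my (1/3) := by
  apply Complex.ext <;> simp only [mx, my] <;> ring

lemma mx_my' {t u : ℝ} (h : mx t = my u) : t = 1/3 ∧ u = 1/3 := by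
  have a := congrArg Complex.re h
  have b := congrArg Complex.im h
  simp only [mx, my] at a b
  have b := mul_right_cancel₀ s1.ne' b
  rw [← b] at a
  constructor <;> linarith

lemma modelN {κ : Type*} (S : Finset κ) (θ : κ → ℝ) {τ : ℝ} (h : ∀ i ∈ S, θ i ∈ Ioo (2:ℝ) 6) (hτ : τ ∈ Ioo (2:ℝ) 6)
    (hi : ∀ i ∈ S, ∀ j ∈ S, i ≠ j → θ i ≠ θ j) (hn : ∀ i ∈ S, τ ≠ θ i) :
    ∃ Φ : ℂ ≃ₜ ℂ, Pres Φ ∧ Φ '' (mx '' Icc 0 1 ∪ my '' Icc 0 1) = XN (S.card + 2) ∧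
      Φ '' (ry τ '' Icc 0 1 ∪ ⋃ i ∈ S, ry (θ i) '' Icc 0 1) = LN (S.card + 2) :=
  ThmN S (fun i => ry (θ i)) (fun i _ => ry_arc _) (ry_arc τ) mx_arc my_arc
    (fun i a j b c => ry_dj (h i a) (h j b) (hi i a j b c)) (fun i a => ry_dj hτ (h i a) (hn i a))
    (fun i a => ry_mx (h i a)) (fun i a => ry_my (h i a)) (ry_mx hτ) (ry_my hτ) (t0 := 1/3) (t1 := 1/3)
    (by norm_num) (by norm_num) mx_my (fun t _ u _ e => mx_my' e)

noncomputable def PP : (ℝ × ℝ) ≃ₜ ℂ := Complex.equivRealProdCLM.symm.toHomeomorph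

lemma PP_apply (p : ℝ × ℝ) : PP p = ⟨p.1, p.2⟩ := by
  apply Complex.ext <;> simp [PP]

lemma ann_iff (p : ℝ × ℝ) : p ∈ stdAnnulus ↔ 1 ≤ ‖PP p‖ ∧ ‖PP p‖ ≤ 2 := by
  have : p ∈ stdAnnulus ↔ 1 ≤ ‖PP p‖ ^ 2 ∧ ‖PP p‖ ^ 2 ≤ 4 := by rw [nsq, PP_apply]; rfl
  rw [this]
  have := norm_nonneg (PP p)
  constructor <;> rintro ⟨h1, h2⟩ <;> constructor <;> nlinarith

lemma Pres.ann {f : ℂ ≃ₜ ℂ} (F : Pres f) {z : ℂ} (h : 1 ≤ ‖z‖ ∧ ‖z‖ ≤ 2) : 1 ≤ ‖f z‖ ∧ ‖f z‖ ≤ 2 := by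
  rcases tri ‖z‖ with k | k | k | k | k
  · linarith [h.1]
  · rw [F.b z k]; norm_num
  · exact ⟨(F.c z k.1 k.2).1.le, (F.c z k.1 k.2).2.le⟩
  · rw [F.d z k]; norm_num
  · linarith [h.2]

lemma fin_aux {K M : Set (ℝ × ℝ)} {Φ Ψ : ℂ ≃ₜ ℂ} (hΦ : Pres Φ) (hΨ : Pres Ψ) (h : Φ '' (PP '' K) = Ψ '' (PP '' M)) :
    ∃ φ : (ℝ × ℝ) ≃ₜ (ℝ × ℝ), φ '' stdAnnulus = stdAnnulus ∧ φ '' K = M := by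
  have hF := hΦ.trans hΨ.symm
  refine ⟨(PP.trans (Φ.trans Ψ.symm)).trans PP.symm, ?_, ?_⟩
  · ext q
    constructor
    · rintro ⟨p, hp, rfl⟩
      rw [ann_iff] at hp ⊢
      simpa using hF.ann hp
    · intro hq
      refine ⟨((PP.trans (Φ.trans Ψ.symm)).trans PP.symm).symm q, ?_, Homeomorph.apply_symm_apply _ q⟩
      rw [ann_iff] at hq ⊢
      simpa using hF.symm.ann hq
  · have e : ∀ K : Set (ℝ × ℝ), ((PP.trans (Φ.trans Ψ.symm)).trans PP.symm) '' K = PP.symm '' (Ψ.symm '' (Φ '' (PP '' K))) := fun K => by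
      simp only [image_image]; rfl
    rw [e, h]
    simp [image_image]

lemma PP_seg (p q : ℝ × ℝ) {g : ℝ → ℂ} (h : ∀ t, g t = PP ((1 - t) • p + t • q)) :
    PP '' segment ℝ p q = g '' Icc 0 1 := by
  rw [segment_eq_image, image_image]
  exact image_congr fun t _ => (h t).symm

lemma PP_model (n : ℕ) : PP '' stdModel n = (mx '' Icc 0 1 ∪ my '' Icc 0 1) ∪
    ⋃ k : Fin (n - 2), ry (2 + 4 * ((k : ℕ) + 1) / n) '' Icc 0 1 := by
  rw [stdModel, image_union, image_union, image_iUnion]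
  congr 1
  · congr 1
    · refine PP_seg _ _ fun t => ?_
      rw [PP_apply, mx]; simp [dirPt]; constructor <;> ring
    · refine PP_seg _ _ fun t => ?_
      rw [PP_apply, my]; simp [dirPt]; ring
  · refine iUnion_congr fun k => PP_seg _ _ fun t => ?_
    rw [PP_apply, ry]; simp only [dirPt, Prod.fst_add, Prod.snd_add, Prod.smul_fst, Prod.smul_snd, smul_eq_mul]
    congr 1 <;> ring

lemma ang_mem {n : ℕ} (k : Fin (n - 2)) : (2 + 4 * ((k : ℕ) + 1) / n : ℝ) ∈ Ioo (2:ℝ) 6 := by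
  have hk : (k : ℕ) + 1 < n := by omega
  have h1 : ((k : ℕ) : ℝ) + 1 < n := by exact_mod_cast hk
  have h0 : (0:ℝ) < n := by have := Nat.cast_nonneg (α := ℝ) (k : ℕ); linarith
  have : (0:ℝ) < 4 * ((k : ℕ) + 1) / n := by positivity
  have : 4 * (((k : ℕ) : ℝ) + 1) / n < 4 := by rw [div_lt_iff₀ h0]; linarith
  constructor <;> linarith

lemma ang_ne {n : ℕ} {k l : Fin (n - 2)} (h : k ≠ l) : (2 + 4 * ((k : ℕ) + 1) / n : ℝ) ≠ 2 + 4 * ((l : ℕ) + 1) / n := by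
  intro e
  have h0 : (n:ℝ) ≠ 0 := by have := k.2; exact_mod_cast (by omega : n ≠ 0)
  field_simp at e
  apply h
  apply Fin.ext
  have : ((k : ℕ) : ℝ) = (l : ℕ) := by linarith
  exact_mod_cast this

/-- if a closed annulus contains a collection of `n` arcs properly embedded
in it, each joining the two boundary circles, pairwise disjoint except for exactly one
transverse interior crossing point between two of them, then the pair (annulus, arcs) is
homeomorphic to the standard model (an annulus with two arcs crossing once and `n - 2`
parallel arcs). We take the annulus to be the standard round annulus, which is no loss
of generality up to homeomorphism. -/
theorem special_annulus_standard_form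
    {n : ℕ} (hn : 2 ≤ n) (a : Fin n → ℝ → ℝ × ℝ)
    (hc : ∀ i, ContinuousOn (a i) (Set.Icc 0 1))
    (hi : ∀ i, Set.InjOn (a i) (Set.Icc 0 1))
    (hin : ∀ i, (a i 0).1 ^ 2 + (a i 0).2 ^ 2 = 1)
    (hout : ∀ i, (a i 1).1 ^ 2 + (a i 1).2 ^ 2 = 4)
    (hint : ∀ i, ∀ t ∈ Set.Ioo (0:ℝ) 1,
      1 < (a i t).1 ^ 2 + (a i t).2 ^ 2 ∧ (a i t).1 ^ 2 + (a i t).2 ^ 2 < 4)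
    (hcross : ∃ i₀ j₀ : Fin n, i₀ ≠ j₀ ∧
      (∃ x : ℝ × ℝ, (1 < x.1 ^ 2 + x.2 ^ 2 ∧ x.1 ^ 2 + x.2 ^ 2 < 4) ∧
        a i₀ '' Set.Icc 0 1 ∩ a j₀ '' Set.Icc 0 1 = {x}) ∧
      (∀ i j, i ≠ j → (i ≠ i₀ ∨ j ≠ j₀) → (i ≠ j₀ ∨ j ≠ i₀) →
        Disjoint (a i '' Set.Icc 0 1) (a j '' Set.Icc 0 1))) :
    ∃ φ : (ℝ × ℝ) ≃ₜ (ℝ × ℝ),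
      φ '' stdAnnulus = stdAnnulus ∧
      φ '' (⋃ i, a i '' Set.Icc 0 1) = stdModel n := by
  obtain ⟨i0, j0, hij, ⟨p, hp, hX⟩, hD⟩ := hcross
  set f : Fin n → ℝ → ℂ := fun i t => PP (a i t) with hf
  have A : ∀ i, Arc (f i) := fun i => by
    refine arc_of_sq (PP.continuous.comp_continuousOn (hc i)) (fun t ht u hu e => hi i ht hu (PP.injective e)) ?_ ?_ fun t ht => ?_
    · simp only [hf, PP_apply]; exact hin i
    · simp only [hf, PP_apply]; exact hout i
    · simp only [hf, PP_apply]; exact hint i t ht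
  have D : ∀ i j, i ≠ j → (i ≠ i0 ∨ j ≠ j0) → (i ≠ j0 ∨ j ≠ i0) → Dj (f i) (f j) := fun i j h1 h2 h3 t ht u hu e =>
    disjoint_left.1 (hD i j h1 h2 h3) ⟨t, ht, rfl⟩ ⟨u, hu, (PP.injective e).symm⟩
  obtain ⟨⟨t0, ht0, e0⟩, t1, ht1, e1⟩ : p ∈ a i0 '' Icc 0 1 ∩ a j0 '' Icc 0 1 := by rw [hX]; rfl
  have hxy : f i0 t0 = f j0 t1 := by simp only [hf]; rw [e0, e1]
  have hxy' : ∀ t ∈ Icc (0:ℝ) 1, ∀ u ∈ Icc (0:ℝ) 1, f i0 t = f j0 u → t = t0 ∧ u = t1 := by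
    intro t ht u hu e
    have e : a i0 t = a j0 u := PP.injective e
    have h1 : a i0 t ∈ a i0 '' Icc 0 1 ∩ a j0 '' Icc 0 1 := ⟨⟨t, ht, rfl⟩, u, hu, e.symm⟩
    rw [hX, mem_singleton_iff] at h1
    exact ⟨hi i0 ht ht0 (h1.trans e0.symm), hi j0 hu ht1 (e.symm.trans (h1.trans e1.symm))⟩
  have int : ∀ i t, t ∈ Icc (0:ℝ) 1 → a i t = p → t ∈ Ioo (0:ℝ) 1 := by
    rintro i t ⟨h1, h2⟩ rfl
    refine ⟨lt_of_le_of_ne h1 ?_, lt_of_le_of_ne h2 ?_⟩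
    · rintro rfl; linarith [hin i, hp.1]
    · rintro rfl; linarith [hout i, hp.2]
  have hK : PP '' (⋃ i, a i '' Icc 0 1) = ⋃ i, f i '' Icc 0 1 := by
    rw [image_iUnion]; simp only [image_image, hf]
  rcases eq_or_lt_of_le hn with rfl | hn3
  · obtain ⟨d, dA, dx, dy⟩ := extra_arc (A i0) (A j0) ht0 ht1 hxy hxy'
    obtain ⟨Φ, hΦ, e, -⟩ := ThmN (∅ : Finset ℕ) (fun _ => d) (by simp) dA (A i0) (A j0) (by simp) (by simp) (by simp) (by simp) dx dy
      (int _ _ ht0 e0) (int _ _ ht1 e1) hxy hxy'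
    obtain ⟨Ψ, hΨ, e', -⟩ := modelN (∅ : Finset ℕ) (fun _ => 4) (τ := 4) (by simp) (by norm_num) (by simp) (by simp)
    refine fin_aux hΦ hΨ ?_
    have : IsEmpty (Fin (2 - 2)) := inferInstanceAs (IsEmpty (Fin 0))
    rw [hK, PP_model, iUnion_of_empty (ι := Fin (2 - 2)), union_empty, e', ← e]
    congr 1
    ext z
    rw [mem_iUnion]
    constructor
    · rintro ⟨i, h⟩
      rcases (by omega : i = i0 ∨ i = j0) with rfl | rfl
      · exact Or.inl h
      · exact Or.inr h
    · rintro (h | h)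
      · exact ⟨_, h⟩
      · exact ⟨_, h⟩
  · obtain ⟨l, hl⟩ : ∃ l, l ∉ ({i0, j0} : Finset (Fin n)) := by
      by_contra hcon
      push Not at hcon
      have h1 : (Finset.univ : Finset (Fin n)).card ≤ ({i0, j0} : Finset (Fin n)).card := Finset.card_le_card fun i _ => hcon i
      have := Finset.card_le_two (a := i0) (b := j0)
      rw [Finset.card_univ, Fintype.card_fin] at h1
      omega
    have hl' : l ≠ i0 ∧ l ≠ j0 := by simpa using hl
    set S : Finset (Fin n) := (((Finset.univ.erase i0).erase j0).erase l) with hS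
    have mS : ∀ i, i ∈ S ↔ i ≠ l ∧ i ≠ j0 ∧ i ≠ i0 := fun i => by simp [hS]
    have cS : S.card = n - 3 := by
      rw [hS, Finset.card_erase_of_mem (by simp [hl'.1, hl'.2]), Finset.card_erase_of_mem (by simp [hij.symm]), Finset.card_erase_of_mem (by simp)]
      simp; omega
    obtain ⟨Φ, hΦ, e, e2⟩ := ThmN S f (fun i _ => A i) (A l) (A i0) (A j0)
      (fun i h j h' hne => D i j hne (Or.inl ((mS i).1 h).2.2) (Or.inl ((mS i).1 h).2.1))
      (fun i h => D l i ((mS i).1 h).1.symm (Or.inl hl'.1) (Or.inl hl'.2))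
      (fun i h => D i i0 ((mS i).1 h).2.2 (Or.inl ((mS i).1 h).2.2) (Or.inl ((mS i).1 h).2.1))
      (fun i h => D i j0 ((mS i).1 h).2.1 (Or.inl ((mS i).1 h).2.2) (Or.inl ((mS i).1 h).2.1))
      (D l i0 hl'.1 (Or.inl hl'.1) (Or.inl hl'.2)) (D l j0 hl'.2 (Or.inl hl'.1) (Or.inl hl'.2))
      (int _ _ ht0 e0) (int _ _ ht1 e1) hxy hxy'
    set k0 : Fin (n - 2) := ⟨0, by omega⟩
    obtain ⟨Ψ, hΨ, e', e2'⟩ := modelN (Finset.univ.erase k0) (fun k : Fin (n - 2) => (2 + 4 * ((k : ℕ) + 1) / n : ℝ))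
      (fun i _ => ang_mem i) (ang_mem k0) (fun i _ j _ h => ang_ne h) (fun i h => ang_ne (Finset.ne_of_mem_erase h).symm)
    have cS' : (Finset.univ.erase k0).card = S.card := by
      rw [cS, Finset.card_erase_of_mem (Finset.mem_univ _)]; simp; omega
    rw [cS'] at e' e2'
    refine fin_aux hΦ hΨ ?_
    have u1 : (⋃ i, f i '' Icc 0 1) = (f i0 '' Icc 0 1 ∪ f j0 '' Icc 0 1) ∪ (f l '' Icc 0 1 ∪ ⋃ i ∈ S, f i '' Icc 0 1) := by
      refine Subset.antisymm (iUnion_subset fun i z hz => ?_) ?_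
      · by_cases h1 : i = i0
        · rw [h1] at hz; exact Or.inl (Or.inl hz)
        by_cases h2 : i = j0
        · rw [h2] at hz; exact Or.inl (Or.inr hz)
        by_cases h3 : i = l
        · rw [h3] at hz; exact Or.inr (Or.inl hz)
        exact Or.inr (Or.inr (mem_iUnion₂.2 ⟨i, (mS i).2 ⟨h3, h2, h1⟩, hz⟩))
      · have k := subset_iUnion (fun i => f i '' Icc 0 1)
        exact union_subset (union_subset (k i0) (k j0)) (union_subset (k l) (iUnion₂_subset fun i _ => k i))
    have u2 : (⋃ k : Fin (n - 2), ry (2 + 4 * ((k : ℕ) + 1) / n) '' Icc 0 1) =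
        ry (2 + 4 * ((k0 : ℕ) + 1) / n) '' Icc 0 1 ∪ ⋃ k ∈ Finset.univ.erase k0, ry (2 + 4 * ((k : ℕ) + 1) / n) '' Icc 0 1 := by
      ext z
      simp only [mem_union, mem_iUnion, exists_prop, Finset.mem_erase, Finset.mem_univ, and_true]
      constructor
      · rintro ⟨k, hk⟩
        by_cases h : k = k0
        · rw [h] at hk; exact Or.inl hk
        · exact Or.inr ⟨k, h, hk⟩
      · rintro (h | ⟨k, -, h⟩)
        · exact ⟨k0, h⟩
        · exact ⟨k, h⟩
    rw [hK, u1, PP_model, u2, image_union, image_union Ψ, e, e2, e', e2']
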